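/- arXiv:2307.07619 — 4 statements merged into one kernel-verified Lean document; each statement's English description precedes it below -/
import Mathlib

section
/- (Bakry–Émery theorem.) Let H : ℝ^N → ℝ be a C² function with e^{−H} integrable, let ν be the probability measure with density proportional to e^{−H}, and assume there is λ > 0 such that the Hessian satisfies Hess H(φ) ≥ λ·Id as quadratic forms for every φ ∈ ℝ^N. Then ν satisfies the log-Sobolev inequality with constant γ ≥ λ: for every smooth compactly supported nonnegative function F : ℝ^N → ℝ, Ent_ν(F) ≤ (2/λ) E_ν[|∇√F|²]. -/
open MeasureTheory Real

noncomputable section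

/-- Partial derivative of `f : ℝ^N → ℝ` in direction `i` at `x`. -/
def pderiv' {N : ℕ} (i : Fin N) (f : (Fin N → ℝ) → ℝ) (x : Fin N → ℝ) : ℝ :=
  deriv (fun t => f (Function.update x i t)) (x i)

/-- Entropy of `F` with respect to the measure `ν` (with `0 log 0 = 0`). -/
def entropy {X : Type*} [MeasurableSpace X] (ν : Measure X) (F : X → ℝ) : ℝ :=
  (∫ x, F x * Real.log (F x) ∂ν) - (∫ x, F x ∂ν) * Real.log (∫ x, F x ∂ν)

open scoped Pointwise in
lemma vol_affine_image (t c : ℝ) (ht : 0 < t) (K : Set ℝ) :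
    volume ((fun x => t * x + c) '' K) = ENNReal.ofReal t * volume K := by
  have : (fun x => t * x + c) '' K = (fun x => x + c) '' (t • K) := by
    ext z; simp [Set.mem_smul_set, eq_add_neg_iff_add_eq]
  rw [this, Set.image_add_right, measure_preimage_add_right, Measure.addHaar_smul]
  simp [abs_of_pos ht]

lemma bm_compact (t s : ℝ) (ht : 0 < t) (hs : 0 < s) (K L C : Set ℝ)
    (hK : IsCompact K) (hL : IsCompact L) (hKn : K.Nonempty) (hLn : L.Nonempty)
    (hC : ∀ x ∈ K, ∀ y ∈ L, t * x + s * y ∈ C) :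
    ENNReal.ofReal t * volume K + ENNReal.ofReal s * volume L ≤ volume C := by
  obtain ⟨a, haK, ha⟩ := hK.exists_isGreatest hKn
  obtain ⟨b, hbL, hb⟩ := hL.exists_isLeast hLn
  rw [← vol_affine_image t (s * b) ht K, ← vol_affine_image s (t * a) hs L]
  have hm : MeasurableSet ((fun x => s * x + t * a) '' L) :=
    (hL.image (by fun_prop)).isClosed.measurableSet
  rw [← measure_union₀ hm.nullMeasurableSet]
  · apply measure_mono
    rintro z (⟨x, hx, rfl⟩ | ⟨y, hy, rfl⟩)
    · exact hC x hx b hbL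
    · simpa [add_comm] using hC a haK y hy
  · refine measure_mono_null (t := {t * a + s * b}) ?_ (by simp)
    rintro z ⟨⟨x, hx, rfl⟩, ⟨y, hy, h⟩⟩
    have h1 := ha hx
    have h2 := hb hy
    simp only [Set.mem_singleton_iff] at *
    nlinarith

lemma bm_meas (t s : ℝ) (ht : 0 < t) (hs : 0 < s) (A B C : Set ℝ)
    (hA : MeasurableSet A) (hB : MeasurableSet B) (hAn : A.Nonempty) (hBn : B.Nonempty)
    (hC : ∀ x ∈ A, ∀ y ∈ B, t * x + s * y ∈ C) :
    ENNReal.ofReal t * volume A + ENNReal.ofReal s * volume B ≤ volume C := by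
  rw [hA.measure_eq_iSup_isCompact, hB.measure_eq_iSup_isCompact]
  simp only [ENNReal.mul_iSup]
  have key : ∀ K ⊆ A, IsCompact K → ∀ L ⊆ B, IsCompact L →
      ENNReal.ofReal t * volume K + ENNReal.ofReal s * volume L ≤ volume C := by
    intro K hKA hK L hLB hL
    obtain ⟨a, ha⟩ := hAn
    obtain ⟨b, hb⟩ := hBn
    refine le_trans ?_ (bm_compact t s ht hs (insert a K) (insert b L) C (hK.insert a)
      (hL.insert b) (by simp) (by simp) ?_)
    · gcongr <;> simp
    · intro x hx y hy
      exact hC x (Set.insert_subset ha hKA hx) y (Set.insert_subset hb hLB hy)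
  simp only [iSup_and']
  refine ENNReal.biSup_add_biSup_le' ⟨∅, by simp⟩ ⟨∅, by simp⟩ ?_
  intro K hK L hL
  exact key K hK.1 hK.2 L hL.1 hL.2

lemma pl_core (t s : ℝ) (ht : 0 < t) (hs : 0 < s) (f g h : ℝ → ℝ)
    (hf : Measurable f) (hg : Measurable g) (hh : Measurable h)
    (f0 : ∀ x, 0 ≤ f x) (g0 : ∀ x, 0 ≤ g x) (h0 : ∀ x, 0 ≤ h x)
    (f1 : ∀ x, f x ≤ 1) (g1 : ∀ x, g x ≤ 1)
    (fs : ∀ r < 1, ∃ x, r < f x) (gs : ∀ r < 1, ∃ x, r < g x)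
    (H : ∀ r x y, 0 < r → r < 1 → r < f x → r < g y → r < h (t * x + s * y)) :
    ENNReal.ofReal t * (∫⁻ x, ENNReal.ofReal (f x)) +
      ENNReal.ofReal s * (∫⁻ x, ENNReal.ofReal (g x)) ≤ ∫⁻ x, ENNReal.ofReal (h x) := by
  rw [lintegral_eq_lintegral_meas_lt _ (Filter.Eventually.of_forall f0) hf.aemeasurable,
    lintegral_eq_lintegral_meas_lt _ (Filter.Eventually.of_forall g0) hg.aemeasurable,
    lintegral_eq_lintegral_meas_lt _ (Filter.Eventually.of_forall h0) hh.aemeasurable,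
    ← lintegral_const_mul' _ _ ENNReal.ofReal_ne_top,
    ← lintegral_const_mul' _ _ ENNReal.ofReal_ne_top]
  rw [← lintegral_add_left']
  · refine setLIntegral_mono' measurableSet_Ioi ?_
    intro r hr
    rcases lt_or_ge r 1 with h1 | h1
    · refine bm_meas t s ht hs _ _ _ (measurableSet_lt measurable_const hf)
        (measurableSet_lt measurable_const hg) (fs r h1) (gs r h1) ?_
      intro x hx y hy
      exact H r x y hr h1 hx hy
    · have e1 : {a | r < f a} = ∅ := by
        ext x; simpa using (f1 x).trans h1
      have e2 : {a | r < g a} = ∅ := by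
        ext x; simpa using (g1 x).trans h1
      simp [e1, e2]
  · refine AEMeasurable.const_mul ?_ _
    refine Measurable.aemeasurable ?_
    refine Antitone.measurable ?_
    intro a b hab
    exact measure_mono fun x hx => lt_of_le_of_lt hab hx

lemma ennreal_amgm (t s : ℝ) (ht : 0 < t) (hs : 0 < s) (hts : t + s = 1) (a b : ENNReal) :
    a ^ t * b ^ s ≤ ENNReal.ofReal t * a + ENNReal.ofReal s * b := by
  have hc : (t⁻¹).HolderConjugate (s⁻¹) := by
    rw [Real.holderConjugate_iff]
    refine ⟨?_, by simpa using hts⟩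
    rw [one_lt_inv₀ ht]; linarith
  have := ENNReal.young_inequality (a ^ t) (b ^ s) hc
  rw [← ENNReal.rpow_mul, ← ENNReal.rpow_mul, mul_inv_cancel₀ ht.ne', mul_inv_cancel₀ hs.ne',
    ENNReal.rpow_one, ENNReal.rpow_one, ENNReal.ofReal_inv_of_pos ht, ENNReal.ofReal_inv_of_pos hs,
    div_eq_mul_inv, div_eq_mul_inv, inv_inv, inv_inv] at this
  rwa [mul_comm a, mul_comm b] at this

lemma sup_aux (f : ℝ → ENNReal) (M : ENNReal) (hM : M = ⨆ x, f x) (h0 : M ≠ 0) (ht : M ≠ ⊤)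
    (r : ℝ) (hr : r < 1) : ∃ x, r < (f x / M).toReal := by
  have hle : ∀ x, f x / M ≤ 1 := fun x =>
    ENNReal.div_le_of_le_mul (by simpa [hM] using le_iSup f x)
  by_contra! hcon
  have hr0 : 0 ≤ r := ENNReal.toReal_nonneg.trans (hcon 0)
  have h3 : M ≤ ENNReal.ofReal r * M := by
    conv_lhs => rw [hM]
    refine iSup_le fun x => ?_
    have := (ENNReal.le_ofReal_iff_toReal_le
      (ne_top_of_le_ne_top ENNReal.one_ne_top (hle x)) hr0).2 (hcon x)
    exact (ENNReal.div_le_iff h0 ht).1 this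
  have h4 : ENNReal.ofReal r * M < 1 * M :=
    (ENNReal.mul_lt_mul_iff_left h0 ht).2 (by simpa using hr)
  rw [one_mul] at h4
  exact absurd h3 (not_le.2 h4)

lemma pl_bdd (t s : ℝ) (ht : 0 < t) (hs : 0 < s) (hts : t + s = 1) (f g h : ℝ → ENNReal)
    (hf : Measurable f) (hg : Measurable g) (hh : Measurable h) (n : ENNReal) (hn : n ≠ ⊤)
    (hfn : ∀ x, f x ≤ n) (hgn : ∀ x, g x ≤ n)
    (H : ∀ x y, f x ^ t * g y ^ s ≤ h (t * x + s * y)) :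
    (∫⁻ x, f x) ^ t * (∫⁻ x, g x) ^ s ≤ ∫⁻ x, h x := by
  set M := ⨆ x, f x with hM
  set K := ⨆ x, g x with hK
  have hfM : ∀ x, f x ≤ M := fun x => le_iSup f x
  have hgK : ∀ x, g x ≤ K := fun x => le_iSup g x
  have hMt : M ≠ ⊤ := ne_top_of_le_ne_top hn (iSup_le hfn)
  have hKt : K ≠ ⊤ := ne_top_of_le_ne_top hn (iSup_le hgn)
  by_cases hM0 : M = 0
  · have : ∀ x, f x = 0 := fun x => by simpa [hM0] using hfM x
    simp [this, ht]
  by_cases hK0 : K = 0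
  · have : ∀ x, g x = 0 := fun x => by simpa [hK0] using hgK x
    simp [this, hs]
  set P := M ^ t * K ^ s with hP
  have hMt0 : M ^ t ≠ 0 := by simp [hM0, hMt]
  have hKt0 : K ^ s ≠ 0 := by simp [hK0, hKt]
  have hP0 : P ≠ 0 := mul_ne_zero hMt0 hKt0
  have hPt : P ≠ ⊤ := ENNReal.mul_ne_top (ENNReal.rpow_ne_top_of_nonneg ht.le hMt)
    (ENNReal.rpow_ne_top_of_nonneg hs.le hKt)
  have f1 : ∀ x, f x / M ≤ 1 := fun x => ENNReal.div_le_of_le_mul (by simpa using hfM x)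
  have g1 : ∀ x, g x / K ≤ 1 := fun x => ENNReal.div_le_of_le_mul (by simpa using hgK x)
  have f2 : ∀ x, f x / M ≠ ⊤ := fun x => ne_top_of_le_ne_top ENNReal.one_ne_top (f1 x)
  have g2 : ∀ x, g x / K ≠ ⊤ := fun x => ne_top_of_le_ne_top ENNReal.one_ne_top (g1 x)
  have h2 : ∀ x, min (h x / P) 1 ≠ ⊤ := fun x => ne_top_of_le_ne_top ENNReal.one_ne_top (min_le_right _ _)
  have main := pl_core t s ht hs (fun x => (f x / M).toReal) (fun x => (g x / K).toReal)
    (fun x => (min (h x / P) 1).toReal) (by fun_prop) (by fun_prop) (by fun_prop)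
    (fun _ => ENNReal.toReal_nonneg) (fun _ => ENNReal.toReal_nonneg)
    (fun _ => ENNReal.toReal_nonneg)
    (fun x => by simpa using ENNReal.toReal_mono ENNReal.one_ne_top (f1 x))
    (fun x => by simpa using ENNReal.toReal_mono ENNReal.one_ne_top (g1 x))
    ?_ ?_ ?_
  · simp only [ENNReal.ofReal_toReal (f2 _), ENNReal.ofReal_toReal (g2 _),
      ENNReal.ofReal_toReal (h2 _)] at main
    have m2 := (ennreal_amgm t s ht hs hts _ _).trans main
    have m3 : ∫⁻ x, min (h x / P) 1 ≤ ∫⁻ x, h x / P := lintegral_mono fun x => min_le_left _ _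
    have m4 := m2.trans m3
    simp only [div_eq_mul_inv] at m4
    rw [lintegral_mul_const _ hf, lintegral_mul_const _ hg, lintegral_mul_const _ hh,
      ENNReal.mul_rpow_of_nonneg _ _ ht.le, ENNReal.mul_rpow_of_nonneg _ _ hs.le,
      ENNReal.inv_rpow, ENNReal.inv_rpow, mul_mul_mul_comm, ← ENNReal.mul_inv (Or.inl hMt0)
      (Or.inr hKt0), ← hP] at m4
    exact (ENNReal.mul_le_mul_iff_left (ENNReal.inv_ne_zero.2 hPt) (ENNReal.inv_ne_top.2 hP0)).1 m4
  · exact sup_aux f M hM hM0 hMt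
  · exact sup_aux g K hK hK0 hKt
  · intro r x y hr0 hr1 hx hy
    have hx' : ENNReal.ofReal r < f x / M := (ENNReal.ofReal_lt_iff_lt_toReal hr0.le (f2 x)).2 hx
    have hy' : ENNReal.ofReal r < g y / K := (ENNReal.ofReal_lt_iff_lt_toReal hr0.le (g2 y)).2 hy
    refine (ENNReal.ofReal_lt_iff_lt_toReal hr0.le (h2 _)).1 ?_
    refine lt_min ?_ (by simpa using hr1)
    have e : ENNReal.ofReal r = ENNReal.ofReal r ^ t * ENNReal.ofReal r ^ s := by
      rw [← ENNReal.rpow_add_of_nonneg _ _ ht.le hs.le, hts, ENNReal.rpow_one]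
    rw [e]
    calc _ < (f x / M) ^ t * (g y / K) ^ s :=
          ENNReal.mul_lt_mul (ENNReal.rpow_lt_rpow hx' ht) (ENNReal.rpow_lt_rpow hy' hs)
      _ = (f x ^ t * g y ^ s) / P := by
          simp only [div_eq_mul_inv]
          rw [ENNReal.mul_rpow_of_nonneg _ _ ht.le, ENNReal.mul_rpow_of_nonneg _ _ hs.le,
            ENNReal.inv_rpow, ENNReal.inv_rpow, mul_mul_mul_comm, ← ENNReal.mul_inv (Or.inl hMt0)
            (Or.inr hKt0)]
      _ ≤ _ := by gcongr; exact H x y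

lemma pl_one (t s : ℝ) (ht : 0 < t) (hs : 0 < s) (hts : t + s = 1) (f g h : ℝ → ENNReal)
    (hf : Measurable f) (hg : Measurable g) (hh : Measurable h)
    (H : ∀ x y, f x ^ t * g y ^ s ≤ h (t * x + s * y)) :
    (∫⁻ x, f x) ^ t * (∫⁻ x, g x) ^ s ≤ ∫⁻ x, h x := by
  have trunc : ∀ (f : ℝ → ENNReal), Measurable f →
      Filter.Tendsto (fun n : ℕ => ∫⁻ x, min (f x) n) Filter.atTop (nhds (∫⁻ x, f x)) := by
    intro f hf
    refine lintegral_tendsto_of_tendsto_of_monotone (fun n => by fun_prop) ?_ ?_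
    · filter_upwards with x n m hnm
      exact min_le_min le_rfl (by exact_mod_cast hnm)
    · filter_upwards with x
      have := (tendsto_const_nhds (x := f x)).min ENNReal.tendsto_nat_nhds_top
      simpa using this
  have b : ∀ n : ℕ, (∫⁻ x, min (f x) n) ^ t * (∫⁻ x, min (g x) n) ^ s ≤ ∫⁻ x, h x := by
    intro n
    refine pl_bdd t s ht hs hts _ _ _ (by fun_prop) (by fun_prop) hh n (by simp)
      (fun x => min_le_right _ _) (fun x => min_le_right _ _) fun x y => le_trans ?_ (H x y)
    gcongr <;> exact min_le_left _ _
  have mono : ∀ (f : ℝ → ENNReal), Monotone (fun n : ℕ => ∫⁻ x, min (f x) n) := by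
    intro f n m hnm
    refine lintegral_mono fun x => ?_
    dsimp only
    gcongr
  have L : ∀ (f : ℝ → ENNReal) (hf : Measurable f) (t : ℝ) (ht : 0 < t),
      (∫⁻ x, f x) ^ t = ⨆ n : ℕ, (∫⁻ x, min (f x) n) ^ t := by
    intro f hf t ht
    refine tendsto_nhds_unique (((ENNReal.continuous_rpow_const).tendsto _).comp (trunc f hf))
      (tendsto_atTop_iSup ?_)
    intro n m hnm
    exact ENNReal.rpow_le_rpow (mono f hnm) ht.le
  rw [L f hf t ht, L g hg s hs, ENNReal.iSup_mul]
  refine iSup_le fun n => ?_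
  rw [ENNReal.mul_iSup]
  refine iSup_le fun m => le_trans ?_ (b (max n m))
  gcongr
  · exact le_max_left n m
  · exact le_max_right n m

lemma pl_n (t s : ℝ) (ht : 0 < t) (hs : 0 < s) (hts : t + s = 1) (n : ℕ) :
    ∀ (f g h : (Fin n → ℝ) → ENNReal)
    (hf : Measurable f) (hg : Measurable g) (hh : Measurable h)
    (H : ∀ x y, f x ^ t * g y ^ s ≤ h (t • x + s • y)),
    (∫⁻ x, f x) ^ t * (∫⁻ x, g x) ^ s ≤ ∫⁻ x, h x := by
  induction n with
  | zero =>
    intro f g h hf hg hh H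
    have : ∀ f : (Fin 0 → ℝ) → ENNReal, ∫⁻ x, f x = f 0 := by
      intro f
      rw [volume_pi, Measure.pi_of_empty _ 0, lintegral_dirac]
    simp only [this]
    simpa using H 0 0
  | succ n ih =>
    intro f g h hf hg hh H
    have ec : ∀ p : ℝ × (Fin n → ℝ),
        (MeasurableEquiv.piFinSuccAbove (fun _ : Fin (n + 1) => ℝ) 0).symm p =
          (Fin.cons p.1 p.2 : Fin (n+1) → ℝ) := by
      intro p
      simp [MeasurableEquiv.piFinSuccAbove_symm_apply, Fin.insertNthEquiv]
    have fub : ∀ f : (Fin (n+1) → ℝ) → ENNReal, Measurable f →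
        ∫⁻ x, f x = ∫⁻ a : ℝ, ∫⁻ x : Fin n → ℝ, f (Fin.cons a x) := by
      intro f hf
      have e := (volume_preserving_piFinSuccAbove (fun _ : Fin (n + 1) => ℝ) 0).symm
      rw [← e.lintegral_comp hf, Measure.volume_eq_prod, lintegral_prod]
      · simp only [ec]
      · exact (hf.comp e.measurable).aemeasurable
    have mc : Measurable (fun p : ℝ × (Fin n → ℝ) => (Fin.cons p.1 p.2 : Fin (n+1) → ℝ)) := by
      simp only [← ec]
      exact (volume_preserving_piFinSuccAbove (fun _ : Fin (n + 1) => ℝ) 0).symm.measurable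
    rw [fub f hf, fub g hg, fub h hh]
    refine pl_one t s ht hs hts _ _ _ ((hf.comp mc).lintegral_prod_right')
      ((hg.comp mc).lintegral_prod_right') ((hh.comp mc).lintegral_prod_right') ?_
    intro a b
    have mk : ∀ a : ℝ, Measurable (fun x : Fin n → ℝ => (Fin.cons a x : Fin (n+1) → ℝ)) :=
      fun a => mc.comp measurable_prodMk_left
    refine ih (fun x => f (Fin.cons a x)) (fun x => g (Fin.cons b x))
      (fun x => h (Fin.cons (t * a + s * b) x)) (hf.comp (mk _)) (hg.comp (mk _)) (hh.comp (mk _)) ?_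
    intro x y
    refine (H _ _).trans (le_of_eq ?_)
    congr 1
    ext i
    refine Fin.cases ?_ (fun i => ?_) i <;> simp

lemma pderiv_eq {N : ℕ} (i : Fin N) (f : (Fin N → ℝ) → ℝ) (x : Fin N → ℝ)
    (hf : DifferentiableAt ℝ f x) : pderiv' i f x = fderiv ℝ f x (Pi.single i 1) := by
  have h1 : HasFDerivAt f (fderiv ℝ f x) (Function.update x i (x i)) := by
    simpa using hf.hasFDerivAt
  exact (h1.comp_hasDerivAt (x i) (hasDerivAt_update x i (x i))).deriv

lemma clm_sum {N : ℕ} (L : (Fin N → ℝ) →L[ℝ] ℝ) (v : Fin N → ℝ) :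
    L v = ∑ i, v i * L (Pi.single i 1) := by
  have := LinearMap.pi_apply_eq_sum_univ (L : (Fin N → ℝ) →ₗ[ℝ] ℝ) v
  simp only [ContinuousLinearMap.coe_coe, smul_eq_mul] at this
  rw [this]
  refine Finset.sum_congr rfl fun i _ => ?_
  congr 2
  ext j
  simp [Pi.single_apply, eq_comm]

lemma taylor_up {E : Type*} [NormedAddCommGroup E] [NormedSpace ℝ E] (G : E → ℝ)
    (hG : Differentiable ℝ G) (x v : E) (c : ℝ)
    (h : ∀ r, 0 < r → r < 1 → fderiv ℝ G (x + r • v) v ≤ fderiv ℝ G x v + c * r) :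
    G (x + v) ≤ G x + fderiv ℝ G x v + c / 2 := by
  have hd : ∀ r : ℝ, HasDerivAt (fun r : ℝ => G (x + r • v) - fderiv ℝ G x v * r - c / 2 * r ^ 2)
      (fderiv ℝ G (x + r • v) v - fderiv ℝ G x v - c * r) r := by
    intro r
    have h1 : HasDerivAt (fun r : ℝ => x + r • v) v r := by
      simpa using ((hasDerivAt_id r).smul_const v).const_add x
    have h2 := (hG (x + r • v)).hasFDerivAt.comp_hasDerivAt r h1
    have h3 := (h2.sub ((hasDerivAt_id r).const_mul (fderiv ℝ G x v))).sub
      (((hasDerivAt_id r).pow 2).const_mul (c / 2))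
    convert! h3 using 1
    simp; ring
  have anti : AntitoneOn (fun r : ℝ => G (x + r • v) - fderiv ℝ G x v * r - c / 2 * r ^ 2)
      (Set.Icc 0 1) := by
    refine antitoneOn_of_deriv_nonpos (convex_Icc 0 1)
      (fun r _ => (hd r).continuousAt.continuousWithinAt)
      (fun r _ => (hd r).differentiableAt.differentiableWithinAt) ?_
    intro r hr
    rw [interior_Icc] at hr
    rw [(hd r).deriv]
    linarith [h r hr.1 hr.2]
  have := anti (a := 0) (b := 1) (by simp) (by simp) zero_le_one
  simp at this
  linarith

lemma norm_sq_le_sum {N : ℕ} (v : Fin N → ℝ) : ‖v‖ * ‖v‖ ≤ ∑ i, v i ^ 2 := by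
  rw [← sq]
  have h0 : 0 ≤ ∑ i, v i ^ 2 := Finset.sum_nonneg fun i _ => sq_nonneg _
  have : ‖v‖ ≤ √(∑ i, v i ^ 2) := by
    rw [pi_norm_le_iff_of_nonneg (Real.sqrt_nonneg _)]
    intro i
    rw [Real.norm_eq_abs, ← Real.sqrt_sq_eq_abs]
    exact Real.sqrt_le_sqrt (Finset.single_le_sum (f := fun i => v i ^ 2)
      (fun i _ => sq_nonneg _) (Finset.mem_univ i))
  calc ‖v‖ ^ 2 ≤ √(∑ i, v i ^ 2) ^ 2 := by gcongr
    _ = _ := Real.sq_sqrt h0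

lemma taylor_cs {N : ℕ} (G : (Fin N → ℝ) → ℝ) (hG : ContDiff ℝ 2 G)
    (hc : HasCompactSupport (fderiv ℝ G)) :
    ∃ C : ℝ, 0 < C ∧ ∀ x v, G (x + v) ≤ G x + fderiv ℝ G x v + C / 2 * ∑ i, v i ^ 2 := by
  obtain ⟨K, hK⟩ := ContDiff.lipschitzWith_of_hasCompactSupport hc
    (hG.fderiv_right (m := 1) (by norm_num)) (by simp)
  refine ⟨K + 1, by positivity, fun x v => ?_⟩
  have h0 : 0 ≤ ∑ i, v i ^ 2 := Finset.sum_nonneg fun i _ => sq_nonneg _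
  have := taylor_up G (hG.differentiable (by simp)) x v (K * ∑ i, v i ^ 2) ?_
  · linarith
  · intro r hr0 hr1
    have h1 := hK.norm_sub_le (x + r • v) x
    have h2 : (fderiv ℝ G (x + r • v) - fderiv ℝ G x) v ≤ K * ‖r • v‖ * ‖v‖ := by
      refine (le_abs_self _).trans ?_
      refine ((fderiv ℝ G (x + r • v) - fderiv ℝ G x).le_opNorm v).trans ?_
      gcongr
      simpa using h1
    rw [norm_smul, Real.norm_of_nonneg hr0.le] at h2
    have h3 := norm_sq_le_sum v
    have h4 : (K : ℝ) * (r * ‖v‖) * ‖v‖ ≤ K * (∑ i, v i ^ 2) * r := by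
      have : (K : ℝ) * (r * ‖v‖) * ‖v‖ = K * r * (‖v‖ * ‖v‖) := by ring
      rw [this]
      have : (K : ℝ) * (∑ i, v i ^ 2) * r = K * r * ∑ i, v i ^ 2 := by ring
      rw [this]
      gcongr
    simp only [sub_apply] at h2
    linarith

lemma hess_lower {N : ℕ} (H : (Fin N → ℝ) → ℝ) (hH : ContDiff ℝ 2 H) (lam : ℝ)
    (hconv : ∀ φ v : Fin N → ℝ,
      lam * ∑ i, (v i) ^ 2 ≤ ∑ i, ∑ j, v i * pderiv' i (pderiv' j H) φ * v j) (x v : Fin N → ℝ) :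
    H x + fderiv ℝ H x v + lam / 2 * ∑ i, v i ^ 2 ≤ H (x + v) := by
  have hd : Differentiable ℝ H := hH.differentiable (by simp)
  have hd2 : Differentiable ℝ (fderiv ℝ H) :=
    (hH.fderiv_right (m := 1) (by norm_num)).differentiable (by simp)
  have hess : ∀ φ, lam * ∑ i, (v i) ^ 2 ≤ fderiv ℝ (fderiv ℝ H) φ v v := by
    intro φ
    refine (hconv φ v).trans (le_of_eq ?_)
    have e : ∀ j, pderiv' j H = fun y => fderiv ℝ H y (Pi.single j 1) := by
      intro j; ext y; exact pderiv_eq j H y (hd y)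
    have e2 : ∀ i j, pderiv' i (pderiv' j H) φ =
        fderiv ℝ (fderiv ℝ H) φ (Pi.single i 1) (Pi.single j 1) := by
      intro i j
      rw [e j, pderiv_eq _ _ _ (by fun_prop)]
      rw [fderiv_clm_apply (hd2 φ) (by fun_prop)]
      simp
    simp only [e2]
    rw [clm_sum (fderiv ℝ (fderiv ℝ H) φ v) v]
    have e3 : ∀ j, fderiv ℝ (fderiv ℝ H) φ v (Pi.single j 1) =
        ∑ i, v i * fderiv ℝ (fderiv ℝ H) φ (Pi.single i 1) (Pi.single j 1) := by
      intro j
      have := clm_sum ((fderiv ℝ (fderiv ℝ H) φ).flip (Pi.single j 1)) v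
      simpa using this
    simp only [e3]
    rw [Finset.sum_comm]
    refine Finset.sum_congr rfl fun j _ => ?_
    rw [Finset.mul_sum]
    refine Finset.sum_congr rfl fun i _ => ?_
    ring
  have hder : ∀ r : ℝ, HasDerivAt (fun r : ℝ => fderiv ℝ H (x + r • v) v - lam * (∑ i, v i ^ 2) * r)
      (fderiv ℝ (fderiv ℝ H) (x + r • v) v v - lam * (∑ i, v i ^ 2)) r := by
    intro r
    have h1 : HasDerivAt (fun r : ℝ => x + r • v) v r := by
      simpa using ((hasDerivAt_id r).smul_const v).const_add x
    have h2a : HasDerivAt (fun r : ℝ => fderiv ℝ H (x + r • v))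
        (fderiv ℝ (fderiv ℝ H) (x + r • v) v) r :=
      (hd2 (x + r • v)).hasFDerivAt.comp_hasDerivAt r h1
    have h2 : HasDerivAt (fun r : ℝ => fderiv ℝ H (x + r • v) v)
        (fderiv ℝ (fderiv ℝ H) (x + r • v) v v) r :=
      (ContinuousLinearMap.apply ℝ ℝ v).hasFDerivAt.comp_hasDerivAt r h2a
    have h3 := h2.sub ((hasDerivAt_id r).const_mul (lam * (∑ i, v i ^ 2)))
    convert! h3 using 1
    simp
  have mono : Monotone (fun r : ℝ => fderiv ℝ H (x + r • v) v - lam * (∑ i, v i ^ 2) * r) := by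
    refine monotone_of_deriv_nonneg (fun r => (hder r).differentiableAt) fun r => ?_
    rw [(hder r).deriv]
    linarith [hess (x + r • v)]
  have := taylor_up (fun y => - H y) hd.neg x v (-lam * ∑ i, v i ^ 2) ?_
  · rw [fderiv_fun_neg] at this
    simp only [neg_apply] at this
    linarith
  · intro r hr _
    have := mono hr.le
    simp only [zero_smul, add_zero, mul_zero, sub_zero] at this
    rw [fderiv_fun_neg, fderiv_fun_neg]
    simp only [neg_apply]
    linarith

lemma hess_convex {N : ℕ} (H : (Fin N → ℝ) → ℝ) (lam : ℝ)
    (hH : ∀ x v, H x + fderiv ℝ H x v + lam / 2 * ∑ i, v i ^ 2 ≤ H (x + v))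
    (t s : ℝ) (ht : 0 < t) (hs : 0 < s) (hts : t + s = 1) (x y : Fin N → ℝ) :
    H (t • x + s • y) + lam / 2 * (t * s) * ∑ i, (x i - y i) ^ 2 ≤ t * H x + s * H y := by
  set z := t • x + s • y with hz
  have ex : x = z + s • (x - y) := by
    have : t = 1 - s := by linarith
    rw [hz, this]; module
  have ey : y = z + (-t) • (x - y) := by
    have : s = 1 - t := by linarith
    rw [hz, this]; module
  have h1 := hH z (s • (x - y))
  have h2 := hH z ((-t) • (x - y))
  rw [← ex] at h1
  rw [← ey] at h2
  simp only [map_smul, Pi.smul_apply, Pi.sub_apply, smul_eq_mul, mul_pow, ← Finset.mul_sum] at h1 h2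
  set D := fderiv ℝ H z (x - y)
  set Q := ∑ i, (x i - y i) ^ 2
  have h3 := add_le_add (mul_le_mul_of_nonneg_left h1 ht.le) (mul_le_mul_of_nonneg_left h2 hs.le)
  have hs' : s = 1 - t := by linarith
  refine le_trans (le_of_eq ?_) h3
  rw [hs']; ring

lemma pl_gibbs {N : ℕ} (H : (Fin N → ℝ) → ℝ) (hHc : Continuous H)
    (hint : Integrable (fun x => Real.exp (-H x)) volume) (lam t s : ℝ)
    (ht : 0 < t) (hs : 0 < s) (hts : t + s = 1)
    (hH : ∀ x y, H (t • x + s • y) + lam / 2 * (t * s) * ∑ i, (x i - y i) ^ 2 ≤ t * H x + s * H y)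
    (g w : (Fin N → ℝ) → ℝ) (hg : Continuous g) (hw : Continuous w)
    (B : ℝ) (hgB : ∀ x, |g x| ≤ B) (hwB : ∀ x, |w x| ≤ B)
    (hgw : ∀ x y, g x - lam / 2 * (t * s) * ∑ i, (x i - y i) ^ 2 ≤ w (t • x + s • y)) :
    (∫ x, exp (g x / t) ∂(volume.tilted fun x => -H x)) ^ t ≤
      ∫ x, exp (w x) ∂(volume.tilted fun x => -H x) := by
  have key := pl_n t s ht hs hts N (fun x => ENNReal.ofReal (exp (-H x + g x / t)))
    (fun x => ENNReal.ofReal (exp (-H x))) (fun x => ENNReal.ofReal (exp (-H x + w x)))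
    (by fun_prop) (by fun_prop) (by fun_prop) ?_
  · have hi : ∀ u : (Fin N → ℝ) → ℝ, Continuous u → ∀ B, (∀ x, |u x| ≤ B) →
        Integrable (fun x => exp (-H x + u x)) := by
      intro u hu B hB
      simp only [exp_add]
      refine hint.mul_bdd (c := exp B) (by fun_prop) ?_
      filter_upwards with x
      rw [Real.norm_eq_abs, abs_exp]
      exact exp_le_exp.2 ((le_abs_self _).trans (hB x))
    have i1 := hi (fun x => g x / t) (by fun_prop) (B / t) (fun x => by
      rw [abs_div, abs_of_pos ht]; gcongr; exact hgB x)
    have i2 := hi w hw B hwB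
    rw [← ofReal_integral_eq_lintegral_ofReal i1 (.of_forall fun x => (exp_pos _).le),
      ← ofReal_integral_eq_lintegral_ofReal hint (.of_forall fun x => (exp_pos _).le),
      ← ofReal_integral_eq_lintegral_ofReal i2 (.of_forall fun x => (exp_pos _).le)] at key
    have Zp : 0 < ∫ x, exp (-H x) := integral_exp_pos hint
    have n1 : 0 ≤ ∫ x, exp (-H x + g x / t) := integral_nonneg fun x => (exp_pos _).le
    have n2 : 0 ≤ ∫ x, exp (-H x + w x) := integral_nonneg fun x => (exp_pos _).le
    rw [ENNReal.ofReal_rpow_of_nonneg n1 ht.le, ENNReal.ofReal_rpow_of_nonneg Zp.le hs.le,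
      ← ENNReal.ofReal_mul (by positivity), ENNReal.ofReal_le_ofReal_iff n2] at key
    rw [integral_exp_tilted (fun x => -H x) (fun x => g x / t), integral_exp_tilted]
    simp only [Pi.add_apply]
    change ((∫ x, exp (-H x + g x / t)) / ∫ x, exp (-H x)) ^ t ≤
      (∫ x, exp (-H x + w x)) / ∫ x, exp (-H x)
    rw [Real.div_rpow n1 Zp.le, le_div_iff₀ Zp]
    refine le_trans (le_of_eq ?_) key
    have : (∫ x, exp (-H x)) = (∫ x, exp (-H x)) ^ t * (∫ x, exp (-H x)) ^ s := by
      rw [← Real.rpow_add Zp, hts, Real.rpow_one]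
    have hne : (∫ x, exp (-H x)) ^ t ≠ 0 := by positivity
    generalize (∫ x, exp (-H x + g x / t)) ^ t = X
    generalize (∫ x, exp (-H x)) = Z at *
    calc X / Z ^ t * Z = X / Z ^ t * (Z ^ t * Z ^ s) := by rw [← this]
      _ = X * Z ^ s := by field_simp
  · intro x y
    rw [ENNReal.ofReal_rpow_of_pos (exp_pos _), ENNReal.ofReal_rpow_of_pos (exp_pos _),
      ← ENNReal.ofReal_mul (by positivity)]
    refine ENNReal.ofReal_le_ofReal ?_
    rw [← Real.exp_mul, ← Real.exp_mul, ← Real.exp_add, exp_le_exp]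
    have e : (-H x + g x / t) * t = - (t * H x) + g x := by field_simp
    rw [e]
    linarith [hH x y, hgw x y]

lemma deriv_step (A B I J lam C κ₀ : ℝ) (hA : 0 < A) (hlam : 0 < lam) (hκ : 0 < κ₀)
    (h : ∀ s κ : ℝ, 0 < s → s < 1 → 0 < lam * (1 - s) - C * s →
      κ = s / (2 * (lam * (1 - s) - C * s)) → κ ≤ κ₀ → 0 < A + s / (1 - s) * B →
      (A + s / (1 - s) * B) ^ (1 - s) ≤ A + κ * I + κ ^ 2 * J) :
    B - A * log A ≤ 1 / (2 * lam) * I := by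
  set κ : ℝ → ℝ := fun s => s / (2 * (lam * (1 - s) - C * s)) with hκd
  have dκ : HasDerivAt κ (1 / (2 * lam)) 0 := by
    have h1 : HasDerivAt (fun s : ℝ => 2 * (lam * (1 - s) - C * s)) (2 * (lam * (-1) - C * 1)) 0 :=
      ((((hasDerivAt_id (0:ℝ)).const_sub 1).const_mul lam).sub
        ((hasDerivAt_id (0:ℝ)).const_mul C)).const_mul 2
    have h2 := (hasDerivAt_id (0:ℝ)).div h1 (by simp; positivity)
    convert! h2 using 1
    simp; field_simp
  have κ0 : κ 0 = 0 := by simp [hκd]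
  have dr : HasDerivAt (fun s => log (A + κ s * I + κ s ^ 2 * J)) (1 / (2 * lam) * I / A) 0 := by
    have h1 := (((dκ.mul_const I).const_add A).add ((dκ.pow 2).mul_const J)).log
      (by simp [κ0]; exact hA.ne')
    convert! h1 using 1
    simp [κ0]
  have dm : HasDerivAt (fun s : ℝ => A + s / (1 - s) * B) B 0 := by
    have h1 := ((hasDerivAt_id (0:ℝ)).div ((hasDerivAt_id (0:ℝ)).const_sub 1) (by simp))
    have h2 := (h1.mul_const B).const_add A
    convert! h2 using 1
    simp
  have dl : HasDerivAt (fun s : ℝ => (1 - s) * log (A + s / (1 - s) * B)) (-log A + B / A) 0 := by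
    have h1 := ((hasDerivAt_id (0:ℝ)).const_sub 1).mul (dm.log (by simp; exact hA.ne'))
    convert! h1 using 1
    simp
  have d := dr.sub dl
  have hev : ∀ᶠ s in nhdsWithin (0:ℝ) (Set.Ioi 0),
      (1 - s) * log (A + s / (1 - s) * B) ≤ log (A + κ s * I + κ s ^ 2 * J) := by
    have e1 : ∀ᶠ s in nhds (0:ℝ), 0 < A + s / (1 - s) * B :=
      dm.continuousAt.eventually (lt_mem_nhds (by simpa using hA))
    have e2 : ∀ᶠ s in nhds (0:ℝ), κ s < κ₀ :=
      dκ.continuousAt.eventually (gt_mem_nhds (by simpa [κ0] using hκ))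
    have e3 : ∀ᶠ s in nhds (0:ℝ), 0 < lam * (1 - s) - C * s := by
      have : ContinuousAt (fun s : ℝ => lam * (1 - s) - C * s) 0 := by fun_prop
      exact this.eventually (lt_mem_nhds (by simpa using hlam))
    have e4 : ∀ᶠ s in nhds (0:ℝ), s < 1 := gt_mem_nhds one_pos
    filter_upwards [e1.filter_mono nhdsWithin_le_nhds, e2.filter_mono nhdsWithin_le_nhds,
      e3.filter_mono nhdsWithin_le_nhds, e4.filter_mono nhdsWithin_le_nhds,
      self_mem_nhdsWithin] with s h1 h2 h3 h4 h5
    rw [← Real.log_rpow h1]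
    exact Real.log_le_log (Real.rpow_pos_of_pos h1 _) (h s (κ s) h5 h4 h3 rfl h2.le h1)
  have hd2 := (hasDerivWithinAt_iff_tendsto_slope' (s := Set.Ioi 0) (by simp)).1
    (d.hasDerivWithinAt (s := Set.Ioi 0))
  have nn : 0 ≤ 1 / (2 * lam) * I / A - (-log A + B / A) := by
    refine ge_of_tendsto hd2 ?_
    filter_upwards [hev, self_mem_nhdsWithin] with s h1 h2
    rw [slope_def_field]
    have h2' : (0:ℝ) < s := h2
    simp [κ0]
    refine div_nonneg (by linarith) h2'.le
  have : 0 ≤ A * (1 / (2 * lam) * I / A - (-log A + B / A)) := mul_nonneg hA.le nn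
  have e : A * (1 / (2 * lam) * I / A - (-log A + B / A)) = 1 / (2 * lam) * I + A * log A - B := by
    field_simp
    ring
  rw [e] at this
  linarith

lemma exp_quad {u : ℝ} (h0 : 0 ≤ u) (h1 : u ≤ 1) : exp u ≤ 1 + u + u ^ 2 := by
  have := Real.abs_exp_sub_one_sub_id_le (x := u) (by rw [abs_of_nonneg h0]; exact h1)
  linarith [(abs_le.1 this).2]

lemma lsi_smooth {N : ℕ} (H : (Fin N → ℝ) → ℝ) (hHc : Continuous H)
    (hint : Integrable (fun x => Real.exp (-H x)) volume) (lam : ℝ) (hlam : 0 < lam)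
    (hH : ∀ t s : ℝ, 0 < t → 0 < s → t + s = 1 → ∀ x y,
      H (t • x + s • y) + lam / 2 * (t * s) * ∑ i, (x i - y i) ^ 2 ≤ t * H x + s * H y)
    (ν : Measure (Fin N → ℝ)) (hν : ν = volume.tilted fun x => -H x)
    (G : (Fin N → ℝ) → ℝ) (hG : ContDiff ℝ 2 G)
    (hc : HasCompactSupport (fderiv ℝ G)) (B : ℝ) (hB : ∀ x, |G x| ≤ B) :
    ∫ x, G x * exp (G x) ∂ν - (∫ x, exp (G x) ∂ν) * log (∫ x, exp (G x) ∂ν) ≤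
      1 / (2 * lam) * ∫ x, (∑ i, (fderiv ℝ G x (Pi.single i 1)) ^ 2) * exp (G x) ∂ν := by
  have hprob : IsProbabilityMeasure ν := by rw [hν]; exact isProbabilityMeasure_tilted hint
  obtain ⟨C, hC0, hC⟩ := taylor_cs G hG hc
  have hGc : Continuous G := hG.continuous
  have hfc : Continuous (fderiv ℝ G) := hG.continuous_fderiv (by simp)
  set D : (Fin N → ℝ) → ℝ := fun x => ∑ i, (fderiv ℝ G x (Pi.single i 1)) ^ 2 with hD
  have hDc : Continuous D := by rw [hD]; fun_prop
  have hD0 : ∀ x, 0 ≤ D x := fun x => Finset.sum_nonneg fun i _ => sq_nonneg _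
  obtain ⟨M, hM0, hM⟩ : ∃ M, 0 < M ∧ ∀ x, D x ≤ M := by
    have hcs : HasCompactSupport D := by
      refine hc.comp_left (g := fun L : (Fin N → ℝ) →L[ℝ] ℝ => ∑ i, (L (Pi.single i 1)) ^ 2) ?_
      simp
    obtain ⟨M, hM⟩ := hDc.bounded_above_of_compact_support hcs
    exact ⟨max M 1, by positivity, fun x => ((le_abs_self _).trans (hM x)).trans (le_max_left _ _)⟩
  have hi : ∀ u : (Fin N → ℝ) → ℝ, Continuous u → ∀ B, (∀ x, |u x| ≤ B) → Integrable u ν := by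
    intro u hu B hB
    exact Integrable.of_bound hu.aestronglyMeasurable B (.of_forall hB)
  have heB : ∀ x, exp (G x) ≤ exp B := fun x => exp_le_exp.2 ((le_abs_self _).trans (hB x))
  have iA : Integrable (fun x => exp (G x)) ν :=
    hi _ (by fun_prop) (exp B) fun x => by rw [abs_exp]; exact heB x
  have iB : Integrable (fun x => G x * exp (G x)) ν :=
    hi _ (by fun_prop) (B * exp B) fun x => by
      rw [abs_mul, abs_exp]
      exact mul_le_mul (hB x) (heB x) (exp_pos _).le ((abs_nonneg _).trans (hB x))
  have iI : Integrable (fun x => D x * exp (G x)) ν :=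
    hi _ (by fun_prop) (M * exp B) fun x => by
      rw [abs_mul, abs_exp, abs_of_nonneg (hD0 x)]
      exact mul_le_mul (hM x) (heB x) (exp_pos _).le hM0.le
  have iJ : Integrable (fun x => D x ^ 2 * exp (G x)) ν :=
    hi _ (by fun_prop) (M ^ 2 * exp B) fun x => by
      rw [abs_mul, abs_exp, abs_of_nonneg (by positivity)]
      exact mul_le_mul (pow_le_pow_left₀ (hD0 x) (hM x) 2) (heB x) (exp_pos _).le (by positivity)
  have hA : 0 < ∫ x, exp (G x) ∂ν := integral_exp_pos iA
  refine deriv_step _ _ _ (∫ x, D x ^ 2 * exp (G x) ∂ν) lam C (1 / M) hA hlam (by positivity) ?_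
  intro s κ hs0 hs1 hden hκ hκM hpos
  have ht0 : 0 < 1 - s := by linarith
  have hκ0 : 0 < κ := by rw [hκ]; positivity
  have hκD0 : ∀ x, 0 ≤ κ * D x := fun x => mul_nonneg hκ0.le (hD0 x)
  have hκD : ∀ x, κ * D x ≤ 1 := fun x => by
    calc κ * D x ≤ 1 / M * M := mul_le_mul hκM (hM x) (hD0 x) (by positivity)
      _ = 1 := by field_simp
  have key := pl_gibbs H hHc hint lam (1 - s) s ht0 hs0 (by ring) (hH _ _ ht0 hs0 (by ring))
    G (fun x => G x + κ * D x) hGc (by fun_prop) (B + 1) (fun x => (hB x).trans (by linarith))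
    (fun x => (abs_add_le _ _).trans (add_le_add (hB x) (by
      rw [abs_of_nonneg (hκD0 x)]; exact hκD x))) ?_
  · rw [← hν] at key
    have l1 : (∫ x, exp (G x) ∂ν) + s / (1 - s) * ∫ x, G x * exp (G x) ∂ν ≤
        ∫ x, exp (G x / (1 - s)) ∂ν := by
      rw [← integral_const_mul, ← integral_add iA (iB.const_mul _)]
      refine integral_mono (iA.add (iB.const_mul _)) ?_ ?_
      · refine hi _ (by fun_prop) (exp (B / (1 - s))) fun x => ?_
        rw [abs_exp, exp_le_exp]
        gcongr
        exact (le_abs_self _).trans (hB x)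
      · intro x
        have e : G x / (1 - s) = G x + s / (1 - s) * G x := by field_simp; ring
        have := Real.add_one_le_exp (s / (1 - s) * G x)
        dsimp only
        rw [e, Real.exp_add]
        nlinarith [exp_pos (G x)]
    have l2 : ∫ x, exp (G x + κ * D x) ∂ν ≤ (∫ x, exp (G x) ∂ν) +
        κ * (∫ x, D x * exp (G x) ∂ν) + κ ^ 2 * ∫ x, D x ^ 2 * exp (G x) ∂ν := by
      rw [← integral_const_mul, ← integral_const_mul, ← integral_add iA (iI.const_mul _),
        ← integral_add (show Integrable (fun x => exp (G x) + κ * (D x * exp (G x))) ν from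
          iA.add (iI.const_mul _)) (iJ.const_mul _)]
      refine integral_mono ?_ ((iA.add (iI.const_mul _)).add (iJ.const_mul _)) ?_
      · refine hi _ (by fun_prop) (exp (B + 1)) fun x => ?_
        rw [abs_exp, exp_le_exp]
        exact add_le_add ((le_abs_self _).trans (hB x)) (hκD x)
      · intro x
        have := exp_quad (hκD0 x) (hκD x)
        dsimp only
        rw [Real.exp_add]
        nlinarith [exp_pos (G x)]
    exact (Real.rpow_le_rpow hpos.le l1 ht0.le).trans (key.trans l2)
  · intro x y
    set z := (1 - s) • x + s • y with hz
    have ex : x = z + s • (x - y) := by rw [hz]; module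
    have h1 := hC z (s • (x - y))
    rw [← ex, map_smul, clm_sum] at h1
    simp only [Pi.smul_apply, Pi.sub_apply, smul_eq_mul, mul_pow, ← Finset.mul_sum] at h1
    set d : Fin N → ℝ := fun i => fderiv ℝ G z (Pi.single i 1)
    have h2 : s * ∑ i, (x i - y i) * d i ≤
        s * (lam * (1 - s) - C * s) / 2 * ∑ i, (x i - y i) ^ 2 + κ * ∑ i, d i ^ 2 := by
      rw [Finset.mul_sum, Finset.mul_sum, Finset.mul_sum, ← Finset.sum_add_distrib]
      refine Finset.sum_le_sum fun i _ => ?_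
      set m := lam * (1 - s) - C * s
      have : s * m / 2 * (x i - y i) ^ 2 + κ * d i ^ 2 - s * ((x i - y i) * d i) =
          s / (2 * m) * (m * (x i - y i) - d i) ^ 2 := by
        rw [hκ]; field_simp; ring
      have : 0 ≤ s / (2 * m) * (m * (x i - y i) - d i) ^ 2 := by positivity
      linarith
    have h3 : D z = ∑ i, d i ^ 2 := rfl
    rw [h3]
    linarith

lemma pderiv_sqrt {N : ℕ} (i : Fin N) (F : (Fin N → ℝ) → ℝ) (hF : Differentiable ℝ F)
    (x : Fin N → ℝ) : pderiv' i (fun y => Real.sqrt (F y)) x =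
      fderiv ℝ F x (Pi.single i 1) / (2 * √(F x)) := by
  rcases le_or_gt (F x) 0 with h | h
  · rw [Real.sqrt_eq_zero_of_nonpos h, mul_zero, div_zero]
    unfold pderiv'
    refine IsLocalMin.deriv_eq_zero (Filter.Eventually.of_forall fun t => ?_)
    simp only [Function.update_eq_self]
    rw [Real.sqrt_eq_zero_of_nonpos h]
    exact Real.sqrt_nonneg _
  · rw [pderiv_eq _ _ _ ((hF x).sqrt h.ne'), ((hF x).hasFDerivAt.sqrt h.ne').fderiv]
    simp
    ring

lemma grad_sq_le {N : ℕ} (F : (Fin N → ℝ) → ℝ) (h0 : ∀ x, 0 ≤ F x) (C : ℝ) (hC0 : 0 < C)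
    (hC : ∀ x v, F (x + v) ≤ F x + fderiv ℝ F x v + C / 2 * ∑ i, v i ^ 2) (i : Fin N)
    (x : Fin N → ℝ) : (fderiv ℝ F x (Pi.single i 1)) ^ 2 ≤ 2 * C * F x := by
  set d := fderiv ℝ F x (Pi.single i 1) with hd
  have h1 := hC x ((-d / C) • Pi.single i 1)
  have h2 := h0 (x + (-d / C) • Pi.single i 1)
  have h3 : ∑ j, ((-d / C) • (Pi.single i 1 : Fin N → ℝ)) j ^ 2 = (-d / C) ^ 2 := by
    rw [Finset.sum_eq_single i] <;> simp +contextual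
  rw [map_smul, ← hd, h3, smul_eq_mul] at h1
  have h4 : 0 ≤ F x + -d / C * d + C / 2 * (-d / C) ^ 2 := h2.trans h1
  have h5 : F x + -d / C * d + C / 2 * (-d / C) ^ 2 = (2 * C * F x - d ^ 2) / (2 * C) := by
    field_simp; ring
  rw [h5] at h4
  have := (div_nonneg_iff.1 h4)
  rcases this with h | h
  · linarith [h.1]
  · linarith [h.2]

lemma entropy_tendsto {X : Type*} [MeasurableSpace X] (ν : Measure X) [IsProbabilityMeasure ν]
    (F : X → ℝ) (hF : Measurable F) (h0 : ∀ x, 0 ≤ F x) (M : ℝ) (hM : ∀ x, F x ≤ M) :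
    Filter.Tendsto (fun ε : ℝ => entropy ν (fun x => F x + ε)) (nhdsWithin 0 (Set.Ioi 0))
      (nhds (entropy ν F)) := by
  have hcont := Real.continuous_mul_log
  have hsmall : ∀ᶠ ε : ℝ in nhdsWithin 0 (Set.Ioi 0), 0 < ε ∧ ε < 1 := by
    filter_upwards [self_mem_nhdsWithin, (gt_mem_nhds (one_pos (α := ℝ))).filter_mono
      nhdsWithin_le_nhds] with ε h1 h2 using ⟨h1, h2⟩
  have hid : Filter.Tendsto (fun ε : ℝ => ε) (nhdsWithin 0 (Set.Ioi 0)) (nhds 0) :=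
    nhdsWithin_le_nhds
  have hadd : ∀ x, Filter.Tendsto (fun ε : ℝ => F x + ε) (nhdsWithin 0 (Set.Ioi 0))
      (nhds (F x)) := by
    intro x; simpa using hid.const_add (F x)
  obtain ⟨K, hK⟩ : ∃ K, ∀ u ∈ Set.Icc 0 (M + 1), ‖u * log u‖ ≤ K :=
    isCompact_Icc.exists_bound_of_continuousOn hcont.continuousOn
  have t1 : Filter.Tendsto (fun ε : ℝ => ∫ x, (F x + ε) * log (F x + ε) ∂ν)
      (nhdsWithin 0 (Set.Ioi 0)) (nhds (∫ x, F x * log (F x) ∂ν)) := by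
    refine tendsto_integral_filter_of_dominated_convergence (fun _ => K) ?_ ?_
      (integrable_const _) ?_
    · filter_upwards with ε
      exact Measurable.aestronglyMeasurable (by fun_prop)
    · filter_upwards [hsmall] with ε hε
      filter_upwards with x
      exact hK _ ⟨by linarith [h0 x], by linarith [hM x]⟩
    · filter_upwards with x
      exact (hcont.tendsto (F x)).comp (hadd x)
  have t2 : Filter.Tendsto (fun ε : ℝ => ∫ x, (F x + ε) ∂ν)
      (nhdsWithin 0 (Set.Ioi 0)) (nhds (∫ x, F x ∂ν)) := by
    refine tendsto_integral_filter_of_dominated_convergence (fun _ => M + 1) ?_ ?_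
      (integrable_const _) ?_
    · filter_upwards with ε
      exact Measurable.aestronglyMeasurable (by fun_prop)
    · filter_upwards [hsmall] with ε hε
      filter_upwards with x
      rw [Real.norm_eq_abs, abs_of_nonneg (by linarith [h0 x])]
      linarith [hM x]
    · filter_upwards with x
      exact hadd x
  exact t1.sub ((hcont.tendsto _).comp t2)

/-- Bakry–Émery theorem: if `Hess H ≥ λ·Id` as quadratic forms with `λ > 0`, then the
Gibbs measure `ν ∝ e^{−H}` satisfies the log-Sobolev inequality with constant `λ`:
`Ent_ν(F) ≤ (2/λ) E_ν[|∇√F|²]` for smooth compactly supported nonnegative `F`. -/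
theorem bakry_emery {N : ℕ} (H : (Fin N → ℝ) → ℝ) (hH : ContDiff ℝ 2 H)
    (hint : Integrable (fun x => Real.exp (-H x)) volume)
    (ν : Measure (Fin N → ℝ))
    (hν : ν = MeasureTheory.Measure.tilted volume (fun x => -H x))
    (lam : ℝ) (hlam : 0 < lam)
    (hconv : ∀ φ v : Fin N → ℝ,
      lam * ∑ i, (v i) ^ 2 ≤ ∑ i, ∑ j, v i * pderiv' i (pderiv' j H) φ * v j) :
    ∀ F : (Fin N → ℝ) → ℝ, ContDiff ℝ (⊤ : ℕ∞) F → HasCompactSupport F → (∀ x, 0 ≤ F x) →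
      entropy ν F ≤ (2 / lam) * ∫ x, ∑ i, (pderiv' i (fun y => Real.sqrt (F y)) x) ^ 2 ∂ν := by
  intro F hF hFc h0
  have hprob : IsProbabilityMeasure ν := by rw [hν]; exact isProbabilityMeasure_tilted hint
  have hF2 : ContDiff ℝ 2 F := contDiff_infty.1 hF 2
  have hFd : Differentiable ℝ F := hF2.differentiable (by simp)
  have hFcont : Continuous F := hF2.continuous
  have hfc : Continuous (fderiv ℝ F) := hF2.continuous_fderiv (by simp)
  have hdc : HasCompactSupport (fderiv ℝ F) := hFc.fderiv ℝ
  obtain ⟨C, hC0, hC⟩ := taylor_cs F hF2 hdc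
  have hgrad := grad_sq_le F h0 C hC0 hC
  obtain ⟨M, hM⟩ := hFcont.bounded_above_of_compact_support hFc
  have hFM : ∀ x, F x ≤ M := fun x => (le_abs_self _).trans (hM x)
  have hM0 : 0 ≤ M := (h0 0).trans (hFM 0)
  simp only [pderiv_sqrt _ F hFd]
  have iS : Integrable (fun x => ∑ i, (fderiv ℝ F x (Pi.single i 1) / (2 * √(F x))) ^ 2) ν := by
    refine integrable_finsetSum _ fun i _ => ?_
    refine Integrable.of_bound (C := C) (Measurable.aestronglyMeasurable ?_) ?_
    · have : Measurable (fun x => fderiv ℝ F x (Pi.single i 1)) :=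
        Continuous.measurable (by fun_prop)
      have := hFcont.measurable
      fun_prop
    · filter_upwards with x
      rw [Real.norm_of_nonneg (sq_nonneg _), div_pow, mul_pow, Real.sq_sqrt (h0 x)]
      refine div_le_of_le_mul₀ (by have := h0 x; positivity) hC0.le ?_
      nlinarith [hgrad i x, mul_nonneg hC0.le (h0 x)]
  refine le_of_tendsto (entropy_tendsto ν F hFcont.measurable h0 M hFM) ?_
  filter_upwards [self_mem_nhdsWithin] with ε hε
  have hε : 0 < ε := hε
  have hp : ∀ x, 0 < F x + ε := fun x => by linarith [h0 x]
  have hGd : ∀ x, fderiv ℝ (fun x => log (F x + ε)) x = (F x + ε)⁻¹ • fderiv ℝ F x := by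
    intro x
    exact (((hFd x).hasFDerivAt.add_const ε).log (hp x).ne').fderiv
  have key := lsi_smooth H hH.continuous hint lam hlam
    (fun t s ht hs hts x y => hess_convex H lam (hess_lower H hH lam hconv) t s ht hs hts x y)
    ν hν (fun x => log (F x + ε)) ((hF2.add contDiff_const).log fun x => (hp x).ne') ?_
    (max |log ε| |log (M + ε)|) ?_
  · simp only [Real.exp_log (hp _), hGd] at key
    unfold entropy
    have e1 : ∫ x, (F x + ε) * log (F x + ε) ∂ν = ∫ x, log (F x + ε) * (F x + ε) ∂ν := by
      simp only [mul_comm]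
    rw [e1]
    refine key.trans ?_
    have e2 : 2 / lam * ∫ x, ∑ i, (fderiv ℝ F x (Pi.single i 1) / (2 * √(F x))) ^ 2 ∂ν =
        1 / (2 * lam) * ∫ x, 4 * ∑ i, (fderiv ℝ F x (Pi.single i 1) / (2 * √(F x))) ^ 2 ∂ν := by
      rw [integral_const_mul]; ring
    rw [e2]
    refine mul_le_mul_of_nonneg_left ?_ (by positivity)
    refine integral_mono_of_nonneg (.of_forall fun x => ?_) (iS.const_mul 4) (.of_forall fun x => ?_)
    · exact mul_nonneg (Finset.sum_nonneg fun i _ => sq_nonneg _) (hp x).le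
    · dsimp only
      rw [Finset.sum_mul, Finset.mul_sum]
      refine Finset.sum_le_sum fun i _ => ?_
      have hg := hgrad i x
      simp only [smul_apply, smul_eq_mul]
      generalize fderiv ℝ F x (Pi.single i 1) = d at *
      have e3 : ((F x + ε)⁻¹ * d) ^ 2 * (F x + ε) = d ^ 2 / (F x + ε) := by
        have := (hp x).ne'
        field_simp
      rw [e3, div_pow, mul_pow, Real.sq_sqrt (h0 x)]
      rcases (h0 x).eq_or_lt with hz | hz
      · have : d = 0 := by
          rw [← hz] at hg
          nlinarith [sq_nonneg d]
        simp [this]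
      · have e4 : 4 * (d ^ 2 / (2 ^ 2 * F x)) = d ^ 2 / F x := by ring
        rw [e4]
        gcongr
        linarith
  · have : fderiv ℝ (fun x => log (F x + ε)) = (fun x => (F x + ε)⁻¹) • fderiv ℝ F := by
      ext1 x; exact hGd x
    rw [this]
    exact hdc.smul_left
  · intro x
    exact abs_le_max_abs_abs (Real.log_le_log hε (by linarith [h0 x]))
      (Real.log_le_log (hp x) (by linarith [hFM x]))

end
end

section
/- (Tensorisation of the log-Sobolev inequality.) Let ν₁ be a probability measure on ℝ^m satisfying the log-Sobolev inequality with constant γ₁ > 0 and ν₂ a probability measure on ℝ^n satisfying it with constant γ₂ > 0. Then the product measure ν = ν₁ ⊗ ν₂ on ℝ^{m+n} satisfies the log-Sobolev inequality with constant γ = min{γ₁, γ₂}: for every smooth compactly supported nonnegative F : ℝ^{m+n} → ℝ, Ent_ν(F) ≤ (2/min{γ₁,γ₂}) E_ν[|∇√F|²], where ∇ is the full gradient on ℝ^{m+n}. -/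
open MeasureTheory Real

noncomputable section

/-- Partial derivative of `f : ℝ^m × ℝ^n → ℝ` in the `i`-th direction of the first factor. -/
def pderivFst {m n : ℕ} (i : Fin m) (f : (Fin m → ℝ) × (Fin n → ℝ) → ℝ)
    (x : (Fin m → ℝ) × (Fin n → ℝ)) : ℝ :=
  deriv (fun t => f (Function.update x.1 i t, x.2)) (x.1 i)

/-- Partial derivative of `f : ℝ^m × ℝ^n → ℝ` in the `j`-th direction of the second factor. -/
def pderivSnd {m n : ℕ} (j : Fin n) (f : (Fin m → ℝ) × (Fin n → ℝ) → ℝ)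
    (x : (Fin m → ℝ) × (Fin n → ℝ)) : ℝ :=
  deriv (fun t => f (x.1, Function.update x.2 j t)) (x.2 j)

section helpers

open Set Filter Topology

lemma cs_bounded {E : Type*} [TopologicalSpace E] {F : E → ℝ} (hF : Continuous F)
    (hc : HasCompactSupport F) : ∃ C, ∀ x, ‖F x‖ ≤ C :=
  hc.exists_bound_of_continuous hF

lemma sq_fderiv_le {E : Type*} [NormedAddCommGroup E] [NormedSpace ℝ E] {F : E → ℝ}
    (hF : ContDiff ℝ (⊤ : ℕ∞) F) (hc : HasCompactSupport F) (hp : ∀ x, 0 ≤ F x) (v : E) :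
    ∃ C, 0 ≤ C ∧ ∀ x, (fderiv ℝ F x v) ^ 2 ≤ C * F x := by
  have hD : ContDiff ℝ 1 (fun x => fderiv ℝ F x v) :=
    (hF.fderiv_right (m := 1) (by norm_cast)).clm_apply contDiff_const
  have hDc : HasCompactSupport (fun x => fderiv ℝ F x v) := hc.fderiv_apply ℝ v
  obtain ⟨K, hK⟩ := hD.lipschitzWith_of_hasCompactSupport hDc one_ne_zero
  set C : ℝ := K * ‖v‖ + 1 with hC
  have hCpos : 0 < C := by positivity
  have hFd : Differentiable ℝ F := hF.differentiable (by simp)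
  refine ⟨4 * C, by positivity, fun x => ?_⟩
  set d := fderiv ℝ F x v with hd
  have key : ∀ t : ℝ, |F (x + t • v) - t * d - F x| ≤ C * |t| * |t| := by
    intro t
    have h1 : ∀ s : ℝ, HasDerivAt (fun s : ℝ => F (x + s • v) - s * d)
        (fderiv ℝ F (x + s • v) v - d) s := by
      intro s
      have h2 : HasDerivAt (fun s : ℝ => x + s • v) v s := by
        simpa using ((hasDerivAt_id s).smul_const v).const_add x
      have h3 := (hFd (x + s • v)).hasFDerivAt.comp_hasDerivAt s h2
      have h4 : HasDerivAt (fun s : ℝ => s * d) d s := by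
        simpa using (hasDerivAt_id s).mul_const d
      exact h3.sub h4
    have h5 := Convex.norm_image_sub_le_of_norm_hasDerivWithin_le (s := Metric.closedBall (0:ℝ) |t|)
      (C := C * |t|) (x := 0) (y := t)
      (fun s _ => (h1 s).hasDerivWithinAt) (fun s hs => by
        have h6 := hK.dist_le_mul (x + s • v) x
        rw [dist_eq_norm, dist_eq_norm] at h6
        simp only [add_sub_cancel_left, norm_smul] at h6
        have hs' : ‖s‖ ≤ |t| := by simpa using hs
        calc _ ≤ K * (‖s‖ * ‖v‖) := h6
          _ = (K * ‖v‖) * ‖s‖ := by ring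
          _ ≤ C * |t| := by
            apply mul_le_mul _ hs' (norm_nonneg _) hCpos.le
            rw [hC]; linarith) (convex_closedBall _ _) (by simp) (by simp)
    simpa using h5
  have h7 := (abs_le.1 (key (-d / (2 * C)))).2
  have h8 := hp (x + (-d / (2 * C)) • v)
  have h9 : C * |-d / (2 * C)| * |-d / (2 * C)| = d ^ 2 / (4 * C) := by
    rw [mul_assoc, abs_mul_abs_self]; field_simp; ring
  rw [h9] at h7
  have h10 : -d / (2 * C) * d = - 2 * (d ^ 2 / (4 * C)) := by field_simp; ring
  rw [h10] at h7
  have h11 : d ^ 2 / (4 * C) ≤ F x := by linarith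
  rw [div_le_iff₀ (by positivity)] at h11
  linarith

lemma deriv_sqrt_sq {E : Type*} [NormedAddCommGroup E] [NormedSpace ℝ E] {F : E → ℝ}
    (hF : ContDiff ℝ (⊤ : ℕ∞) F) (hp : ∀ x, 0 ≤ F x) {c : ℝ → E} {v x : E} {t₀ : ℝ}
    (hc : HasDerivAt c v t₀) (hx : c t₀ = x) :
    (deriv (fun t => Real.sqrt (F (c t))) t₀) ^ 2 = (fderiv ℝ F x v) ^ 2 / (4 * F x) := by
  subst hx
  have hFd : Differentiable ℝ F := hF.differentiable (by simp)
  have h1 := (hFd (c t₀)).hasFDerivAt.comp_hasDerivAt t₀ hc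
  by_cases h0 : F (c t₀) = 0
  · have : IsLocalMin (fun t => Real.sqrt (F (c t))) t₀ :=
      Filter.Eventually.of_forall fun t => by simp [h0]
    rw [this.deriv_eq_zero]; simp [h0]
  · have h2 := (h1.sqrt h0).deriv
    simp only [Function.comp_def] at h2
    rw [h2, div_pow, mul_pow, Real.sq_sqrt (hp _)]
    norm_num

lemma hasDerivAt_update' {N : ℕ} (x : Fin N → ℝ) (i : Fin N) (t : ℝ) :
    HasDerivAt (fun t => Function.update x i t) (Pi.single i 1) t := hasDerivAt_update x i t

lemma contDiff_marginal {m n : ℕ} (ν₁ : Measure (Fin m → ℝ)) [IsProbabilityMeasure ν₁]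
    {F : (Fin m → ℝ) × (Fin n → ℝ) → ℝ}
    (hF : ContDiff ℝ (⊤ : ℕ∞) F) (hc : HasCompactSupport F) :
    ContDiff ℝ (⊤ : ℕ∞) (fun y => ∫ x, F (x, y) ∂ν₁) := by
  have hk : IsCompact ((fun p : (Fin m → ℝ) × (Fin n → ℝ) => - p.1) '' tsupport F) :=
    hc.isCompact.image (by fun_prop)
  have h := contDiffOn_convolution_right_with_param (μ := ν₁) (𝕜 := ℝ) (n := ⊤)
    (ContinuousLinearMap.mul ℝ ℝ) (f := fun _ => (1 : ℝ))
    (g := fun (y : Fin n → ℝ) (x : Fin m → ℝ) => F (-x, y)) (s := univ) isOpen_univ hk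
    (by
      intro p x _ hx
      by_contra hne
      exact hx ⟨(-x, p), subset_tsupport _ hne, by simp⟩)
    (integrable_const _).locallyIntegrable
    (by
      apply ContDiff.contDiffOn
      show ContDiff ℝ _ (fun q : (Fin n → ℝ) × (Fin m → ℝ) => F (-q.2, q.1))
      exact hF.comp (contDiff_snd.neg.prodMk contDiff_fst))
  rw [univ_prod_univ, contDiffOn_univ] at h
  have h2 := h.comp (contDiff_id.prodMk (contDiff_const (c := (0 : Fin m → ℝ))))
  convert h2 using 2 with y
  simp [convolution_def]

lemma compactSupport_marginal {m n : ℕ} (ν₁ : Measure (Fin m → ℝ))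
    {F : (Fin m → ℝ) × (Fin n → ℝ) → ℝ} (hc : HasCompactSupport F) :
    HasCompactSupport (fun y => ∫ x, F (x, y) ∂ν₁) := by
  refine HasCompactSupport.intro (hc.isCompact.image continuous_snd) fun y hy => ?_
  have : ∀ x, F (x, y) = 0 := fun x => by
    by_contra hne
    exact hy ⟨(x, y), subset_tsupport _ hne, rfl⟩
  simp [this]

lemma fderiv_marginal {m n : ℕ} (ν₁ : Measure (Fin m → ℝ)) [IsProbabilityMeasure ν₁]
    {F : (Fin m → ℝ) × (Fin n → ℝ) → ℝ}
    (hF : ContDiff ℝ (⊤ : ℕ∞) F) (hc : HasCompactSupport F) (y w : Fin n → ℝ) :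
    fderiv ℝ (fun y => ∫ x, F (x, y) ∂ν₁) y w = ∫ x, fderiv ℝ F (x, y) (0, w) ∂ν₁ := by
  have hFd : Differentiable ℝ F := hF.differentiable (by simp)
  have hcont : Continuous (fderiv ℝ F) := hF.continuous_fderiv (by simp)
  obtain ⟨C, hC⟩ := (hc.fderiv ℝ).exists_bound_of_continuous hcont
  obtain ⟨C', hC'⟩ := cs_bounded hF.continuous hc
  set J := ContinuousLinearMap.inr ℝ (Fin m → ℝ) (Fin n → ℝ)
  have hm : ∀ y, Continuous fun x => (fderiv ℝ F (x, y)).comp J := fun y =>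
    (hcont.comp (by fun_prop)).clm_comp continuous_const
  have hb : ∀ x y, ‖(fderiv ℝ F (x, y)).comp J‖ ≤ C * ‖J‖ := fun x y =>
    (ContinuousLinearMap.opNorm_comp_le _ _).trans
      (mul_le_mul_of_nonneg_right (hC _) (norm_nonneg _))
  have h := hasFDerivAt_integral_of_dominated_of_fderiv_le (𝕜 := ℝ) (μ := ν₁) (s := univ) (x₀ := y)
    (F := fun y x => F (x, y)) (F' := fun y x => (fderiv ℝ F (x, y)).comp J)
    (bound := fun _ => C * ‖J‖) univ_mem
    (Eventually.of_forall fun y => 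
      (hF.continuous.comp (by fun_prop : Continuous fun x => (x, y))).aestronglyMeasurable)
    (Integrable.of_bound
      (hF.continuous.comp (by fun_prop : Continuous fun x => (x, y))).aestronglyMeasurable C'
      (Eventually.of_forall fun x => hC' _))
    (hm y).aestronglyMeasurable
    (Eventually.of_forall fun x y _ => hb x y)
    (integrable_const _)
    (Eventually.of_forall fun x y _ => (hFd (x, y)).hasFDerivAt.comp y (hasFDerivAt_prodMk_right x y))
  rw [h.fderiv, ContinuousLinearMap.integral_apply]
  · rfl
  · exact Integrable.of_bound (hm y).aestronglyMeasurable _ (Eventually.of_forall fun x => hb x y)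

/-- Cauchy-Schwarz in the form needed for the marginal. -/
lemma cs_quot {X : Type*} [MeasurableSpace X] (μ : Measure X) {D F : X → ℝ}
    (hD : Integrable D μ) (hF : Integrable F μ) (hQ : Integrable (fun x => D x ^ 2 / (4 * F x)) μ)
    (hp : ∀ x, 0 ≤ F x) (h0 : ∀ x, F x = 0 → D x = 0) :
    (∫ x, D x ∂μ) ^ 2 / (4 * ∫ x, F x ∂μ) ≤ ∫ x, D x ^ 2 / (4 * F x) ∂μ := by
  have key : ∀ s : ℝ, s * (∫ x, D x ∂μ) - s ^ 2 * (∫ x, F x ∂μ) ≤ ∫ x, D x ^ 2 / (4 * F x) ∂μ := by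
    intro s
    rw [← integral_const_mul, ← integral_const_mul,
      ← integral_sub (hD.const_mul _) (hF.const_mul _)]
    apply integral_mono ((hD.const_mul _).sub (hF.const_mul _)) hQ
    intro x
    show s * D x - s ^ 2 * F x ≤ D x ^ 2 / (4 * F x)
    rcases (hp x).eq_or_lt with h | h
    · simp [← h, h0 x h.symm]
    · rw [le_div_iff₀ (by positivity)]
      nlinarith [sq_nonneg (D x - 2 * s * F x)]
  rcases (integral_nonneg hp : 0 ≤ ∫ x, F x ∂μ).eq_or_lt with h | h
  · rw [← h]; simpa using key 0
  · refine le_trans (le_of_eq ?_) (key ((∫ x, D x ∂μ) / (2 * ∫ x, F x ∂μ)))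
    field_simp; ring

end helpers

/-- Tensorisation of the log-Sobolev inequality: if `ν₁`, `ν₂` satisfy log-Sobolev
inequalities with constants `γ₁`, `γ₂`, then the product measure `ν₁ ⊗ ν₂` satisfies the
log-Sobolev inequality with constant `min γ₁ γ₂` for the full gradient. -/
theorem lsi_tensorisation {m n : ℕ}
    (ν₁ : Measure (Fin m → ℝ)) [IsProbabilityMeasure ν₁]
    (ν₂ : Measure (Fin n → ℝ)) [IsProbabilityMeasure ν₂]
    (γ₁ γ₂ : ℝ) (hγ₁ : 0 < γ₁) (hγ₂ : 0 < γ₂)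
    (hLSI₁ : ∀ F : (Fin m → ℝ) → ℝ, ContDiff ℝ (⊤ : ℕ∞) F → HasCompactSupport F →
      (∀ x, 0 ≤ F x) →
      entropy ν₁ F ≤ (2 / γ₁) * ∫ x, ∑ i, (pderiv' i (fun y => Real.sqrt (F y)) x) ^ 2 ∂ν₁)
    (hLSI₂ : ∀ F : (Fin n → ℝ) → ℝ, ContDiff ℝ (⊤ : ℕ∞) F → HasCompactSupport F →
      (∀ x, 0 ≤ F x) →
      entropy ν₂ F ≤ (2 / γ₂) * ∫ x, ∑ j, (pderiv' j (fun y => Real.sqrt (F y)) x) ^ 2 ∂ν₂) :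
    ∀ F : (Fin m → ℝ) × (Fin n → ℝ) → ℝ, ContDiff ℝ (⊤ : ℕ∞) F → HasCompactSupport F →
      (∀ x, 0 ≤ F x) →
      entropy (ν₁.prod ν₂) F ≤ (2 / min γ₁ γ₂) *
        ∫ x, ((∑ i, (pderivFst i (fun y => Real.sqrt (F y)) x) ^ 2)
          + ∑ j, (pderivSnd j (fun y => Real.sqrt (F y)) x) ^ 2) ∂(ν₁.prod ν₂) := by
  intro F hF hc hp
  obtain ⟨M, hM⟩ := cs_bounded hF.continuous hc
  have hlog : Continuous fun x => F x * Real.log (F x) :=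
    Real.continuous_mul_log.comp hF.continuous
  have hlogc : HasCompactSupport fun x => F x * Real.log (F x) :=
    hc.comp_left (g := fun u => u * Real.log u) (by simp)
  have hFi : Integrable F (ν₁.prod ν₂) := hF.continuous.integrable_of_hasCompactSupport hc
  have hli : Integrable (fun x => F x * Real.log (F x)) (ν₁.prod ν₂) :=
    hlog.integrable_of_hasCompactSupport hlogc
  set f : (Fin n → ℝ) → ℝ := fun y => ∫ x, F (x, y) ∂ν₁ with hf
  have hfs : ContDiff ℝ (⊤ : ℕ∞) f := contDiff_marginal ν₁ hF hc
  have hfc : HasCompactSupport f := compactSupport_marginal ν₁ hc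
  have hfp : ∀ y, 0 ≤ f y := fun y => integral_nonneg fun x => hp _
  have hfli : Integrable (fun y => f y * Real.log (f y)) ν₂ :=
    (Real.continuous_mul_log.comp hfs.continuous).integrable_of_hasCompactSupport
      (hfc.comp_left (g := fun u => u * Real.log u) (by simp))
  -- the quadratic quotients
  have hq : ∀ v, ∃ C, ∀ x, ‖(fderiv ℝ F x v) ^ 2 / (4 * F x)‖ ≤ C := by
    intro v
    obtain ⟨C, hC0, hC⟩ := sq_fderiv_le hF hc hp v
    refine ⟨C, fun x => ?_⟩
    have := hp x
    rw [Real.norm_of_nonneg (by positivity)]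
    rcases this.eq_or_lt with h | h
    · simpa [← h] using hC0
    · rw [div_le_iff₀ (by positivity)]
      nlinarith [hC x, mul_nonneg hC0 this]
  have hcont : Continuous (fderiv ℝ F) := hF.continuous_fderiv (by simp)
  have hqm : ∀ v, Measurable fun x => (fderiv ℝ F x v) ^ 2 / (4 * F x) := fun v =>
    ((hcont.clm_apply continuous_const).measurable.pow_const 2).div
      (hF.continuous.measurable.const_mul 4)
  have hqi : ∀ v, Integrable (fun x => (fderiv ℝ F x v) ^ 2 / (4 * F x)) (ν₁.prod ν₂) := by
    intro v
    obtain ⟨C, hC⟩ := hq v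
    exact Integrable.of_bound (hqm v).aestronglyMeasurable C (Filter.Eventually.of_forall hC)
  have hA1 : ∀ i x, (pderivFst i (fun y => Real.sqrt (F y)) x) ^ 2
      = (fderiv ℝ F x (Pi.single i 1, 0)) ^ 2 / (4 * F x) := by
    intro i x
    exact deriv_sqrt_sq hF hp (c := fun t => (Function.update x.1 i t, x.2))
      ((hasDerivAt_update' x.1 i (x.1 i)).prodMk (hasDerivAt_const _ _)) (by simp)
  have hB1 : ∀ j x, (pderivSnd j (fun y => Real.sqrt (F y)) x) ^ 2
      = (fderiv ℝ F x (0, Pi.single j 1)) ^ 2 / (4 * F x) := by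
    intro i x
    exact deriv_sqrt_sq hF hp (c := fun t => (x.1, Function.update x.2 i t))
      ((hasDerivAt_const _ _).prodMk (hasDerivAt_update' x.2 i (x.2 i))) (by simp)
  set A : (Fin m → ℝ) × (Fin n → ℝ) → ℝ := fun x =>
    ∑ i, (pderivFst i (fun y => Real.sqrt (F y)) x) ^ 2 with hA
  set B : (Fin m → ℝ) × (Fin n → ℝ) → ℝ := fun x =>
    ∑ j, (pderivSnd j (fun y => Real.sqrt (F y)) x) ^ 2 with hB
  have hAi : Integrable A (ν₁.prod ν₂) := by
    apply integrable_finsetSum; intro i _; simp only [hA1]; exact hqi _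
  have hBi : Integrable B (ν₁.prod ν₂) := by
    apply integrable_finsetSum; intro i _; simp only [hB1]; exact hqi _
  have hA0 : 0 ≤ ∫ x, A x ∂(ν₁.prod ν₂) :=
    integral_nonneg fun x => Finset.sum_nonneg fun i _ => sq_nonneg _
  have hB0 : 0 ≤ ∫ x, B x ∂(ν₁.prod ν₂) :=
    integral_nonneg fun x => Finset.sum_nonneg fun i _ => sq_nonneg _
  -- entropy decomposition
  have hmf : ∫ x, F x ∂(ν₁.prod ν₂) = ∫ y, f y ∂ν₂ := integral_prod_symm _ hFi
  have hml : ∫ x, F x * Real.log (F x) ∂(ν₁.prod ν₂)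
      = ∫ y, ∫ x, F (x, y) * Real.log (F (x, y)) ∂ν₁ ∂ν₂ := integral_prod_symm _ hli
  have hli2 : Integrable (fun y => ∫ x, F (x, y) * Real.log (F (x, y)) ∂ν₁) ν₂ :=
    hli.integral_prod_right
  have hent : entropy (ν₁.prod ν₂) F
      = (∫ y, entropy ν₁ (fun x => F (x, y)) ∂ν₂) + entropy ν₂ f := by
    have : ∫ y, entropy ν₁ (fun x => F (x, y)) ∂ν₂
        = (∫ y, ∫ x, F (x, y) * Real.log (F (x, y)) ∂ν₁ ∂ν₂) - ∫ y, f y * Real.log (f y) ∂ν₂ :=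
      integral_sub hli2 hfli
    rw [this]
    simp only [entropy]
    rw [hml, hmf]
    ring
  have hslice : ∀ y, ContDiff ℝ (⊤ : ℕ∞) (fun x => F (x, y)) := fun y =>
    hF.comp (contDiff_id.prodMk contDiff_const)
  have hslicec : ∀ y, HasCompactSupport (fun x => F (x, y)) := fun y => by
    refine HasCompactSupport.intro (hc.isCompact.image continuous_fst) fun x hx => ?_
    by_contra hne
    exact hx ⟨(x, y), subset_tsupport _ hne, rfl⟩
  have h1 : (∫ y, entropy ν₁ (fun x => F (x, y)) ∂ν₂) ≤ (2 / γ₁) * ∫ x, A x ∂(ν₁.prod ν₂) := by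
    rw [integral_prod_symm _ hAi, ← integral_const_mul]
    apply integral_mono (hli2.sub hfli) (hAi.integral_prod_right.const_mul _)
    intro y
    exact hLSI₁ (fun x => F (x, y)) (hslice y) (hslicec y) (fun x => hp _)
  have hD0 : ∀ v x, F x = 0 → fderiv ℝ F x v = 0 := by
    intro v x hx
    have : IsLocalMin F x := Filter.Eventually.of_forall fun z => by rw [hx]; exact hp z
    rw [this.fderiv_eq_zero]; rfl
  have hBj : ∀ j y, (pderiv' j (fun y => Real.sqrt (f y)) y) ^ 2
      ≤ ∫ x, (pderivSnd j (fun y => Real.sqrt (F y)) (x, y)) ^ 2 ∂ν₁ := by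
    intro j y
    have h : (pderiv' j (fun y => Real.sqrt (f y)) y) ^ 2
        = (fderiv ℝ f y (Pi.single j 1)) ^ 2 / (4 * f y) :=
      deriv_sqrt_sq hfs hfp (hasDerivAt_update' y j (y j)) (by simp)
    rw [h, fderiv_marginal ν₁ hF hc]
    simp only [hB1]
    have hpair : Continuous fun x : Fin m → ℝ => (x, y) := by fun_prop
    have hDc : Continuous fun z => fderiv ℝ F z (0, Pi.single j 1) :=
      hcont.clm_apply continuous_const
    obtain ⟨C, hC⟩ := cs_bounded hDc (hc.fderiv_apply ℝ _)
    obtain ⟨C', hC'⟩ := hq (0, Pi.single j 1)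
    apply cs_quot ν₁
    · exact Integrable.of_bound (hDc.comp hpair).aestronglyMeasurable C
        (Filter.Eventually.of_forall fun x => hC _)
    · exact Integrable.of_bound (hF.continuous.comp hpair).aestronglyMeasurable M
        (Filter.Eventually.of_forall fun x => hM _)
    · exact Integrable.of_bound ((hqm _).comp hpair.measurable).aestronglyMeasurable C'
        (Filter.Eventually.of_forall fun x => hC' _)
    · exact fun x => hp _
    · exact fun x => hD0 _ _
  have h2 : entropy ν₂ f ≤ (2 / γ₂) * ∫ x, B x ∂(ν₁.prod ν₂) := by
    refine (hLSI₂ f hfs hfc hfp).trans (mul_le_mul_of_nonneg_left ?_ (by positivity))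
    rw [integral_prod_symm _ hBi]
    apply integral_mono_of_nonneg
    · exact Filter.Eventually.of_forall fun y => Finset.sum_nonneg fun i _ => sq_nonneg _
    · exact hBi.integral_prod_right
    · refine Filter.Eventually.of_forall fun y => ?_
      show _ ≤ ∫ x, B (x, y) ∂ν₁
      rw [hB]
      simp only
      rw [integral_finsetSum]
      · exact Finset.sum_le_sum fun j _ => hBj j y
      · intro j _
        simp only [hB1]
        obtain ⟨C', hC'⟩ := hq (0, Pi.single j 1)
        exact Integrable.of_bound ((hqm _).comp (by fun_prop : Continuous fun x : Fin m → ℝ =>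
          (x, y)).measurable).aestronglyMeasurable C'
          (Filter.Eventually.of_forall fun x => hC' _)
  have hmin : 0 < min γ₁ γ₂ := lt_min hγ₁ hγ₂
  have e1 : 2 / γ₁ ≤ 2 / min γ₁ γ₂ := div_le_div_of_nonneg_left (by norm_num) hmin (min_le_left _ _)
  have e2 : 2 / γ₂ ≤ 2 / min γ₁ γ₂ := div_le_div_of_nonneg_left (by norm_num) hmin (min_le_right _ _)
  have hAB : ∫ x, (A x + B x) ∂(ν₁.prod ν₂)
      = (∫ x, A x ∂(ν₁.prod ν₂)) + ∫ x, B x ∂(ν₁.prod ν₂) := integral_add hAi hBi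
  calc entropy (ν₁.prod ν₂) F ≤ 2 / γ₁ * (∫ x, A x ∂(ν₁.prod ν₂))
        + 2 / γ₂ * ∫ x, B x ∂(ν₁.prod ν₂) := by rw [hent]; exact add_le_add h1 h2
    _ ≤ 2 / min γ₁ γ₂ * ∫ x, (A x + B x) ∂(ν₁.prod ν₂) := by
      rw [hAB, mul_add]
      exact add_le_add (mul_le_mul_of_nonneg_right e1 hA0) (mul_le_mul_of_nonneg_right e2 hB0)


end
end

section
/- (Holley–Stroock criterion.) Let ν be a probability measure on ℝ^N satisfying the log-Sobolev inequality with constant γ > 0. Let F : ℝ^N → ℝ be measurable with 0 < inf F ≤ sup F < ∞, and let ν^F be the probability measure with density F/E_ν[F] with respect to ν. Then ν^F satisfies the log-Sobolev inequality with constant γ^F ≥ (inf F / sup F) · γ. -/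
open MeasureTheory Real

noncomputable section

theorem hs_entropy_aux {X : Type*} [MeasurableSpace X] (μ ρ : Measure X)
    [IsProbabilityMeasure μ] [IsProbabilityMeasure ρ] (C : ℝ) (hC : 0 ≤ C)
    (hle : ρ ≤ ENNReal.ofReal C • μ) (G : X → ℝ) (hG : ∀ x, 0 ≤ G x)
    (i1 : Integrable G μ) (i2 : Integrable (fun x => G x * Real.log (G x)) μ) :
    entropy ρ G ≤ C * entropy μ G := by
  have hfin : ENNReal.ofReal C ≠ ⊤ := ENNReal.ofReal_ne_top
  have j1 : Integrable G ρ := (i1.smul_measure hfin).mono_measure hle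
  have j2 : Integrable (fun x => G x * Real.log (G x)) ρ :=
    (i2.smul_measure hfin).mono_measure hle
  have ht0 : 0 ≤ ∫ x, G x ∂μ := integral_nonneg hG
  have hs0 : 0 ≤ ∫ x, G x ∂ρ := integral_nonneg hG
  rcases ht0.eq_or_lt with ht | ht
  · have h0 : G =ᵐ[μ] 0 := (integral_eq_zero_iff_of_nonneg hG i1).1 ht.symm
    have hac : ρ ≪ μ := (Measure.absolutelyContinuous_of_le hle).trans
      Measure.smul_absolutelyContinuous
    have h1 : G =ᵐ[ρ] 0 := hac.ae_le h0
    have e : ∀ κ : Measure X, G =ᵐ[κ] 0 → entropy κ G = 0 := by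
      intro κ hκ
      have e1 : ∫ x, G x ∂κ = 0 := by
        rw [integral_congr_ae hκ]; simp
      have e2 : ∫ x, G x * Real.log (G x) ∂κ = 0 := by
        have : (fun x => G x * Real.log (G x)) =ᵐ[κ] fun _ => (0 : ℝ) := by
          filter_upwards [hκ] with x hx
          simp [hx]
        rw [integral_congr_ae this]; simp
      simp [entropy, e1, e2]
    rw [e _ h0, e _ h1]; simp
  · set t := ∫ x, G x ∂μ with htdef
    set s := ∫ x, G x ∂ρ with hsdef
    have key : ∀ u : ℝ, 0 ≤ u → 0 ≤ u * Real.log u - (u * Real.log t + u - t) := by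
      intro u hu
      rcases hu.eq_or_lt with h | h
      · subst h; simp; exact ht.le
      · have h1 := Real.log_le_sub_one_of_pos (div_pos ht h)
        rw [Real.log_div ht.ne' h.ne'] at h1
        have h2 := mul_le_mul_of_nonneg_left h1 hu
        have h3 : u * (t / u - 1) = t - u := by field_simp
        rw [h3] at h2
        linarith
    have val : ∀ (κ : Measure X) [IsProbabilityMeasure κ], Integrable G κ →
        Integrable (fun x => G x * Real.log (G x)) κ →
        Integrable (fun x => G x * Real.log (G x) - (G x * Real.log t + G x - t)) κ ∧
        ∫ x, (G x * Real.log (G x) - (G x * Real.log t + G x - t)) ∂κ =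
          (∫ x, G x * Real.log (G x) ∂κ) -
            ((∫ x, G x ∂κ) * Real.log t + (∫ x, G x ∂κ) - t) := by
      intro κ _ k1 k2
      have k3 : Integrable (fun x => G x * Real.log t) κ := k1.mul_const _
      have k4 : Integrable (fun x => G x * Real.log t + G x) κ := k3.add k1
      have k5 : Integrable (fun x => G x * Real.log t + G x - t) κ :=
        k4.sub (integrable_const t)
      refine ⟨k2.sub k5, ?_⟩
      rw [integral_sub k2 k5, integral_sub k4 (integrable_const t), integral_add k3 k1,
        integral_mul_const]
      simp
    obtain ⟨m1, m2⟩ := val μ i1 i2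
    obtain ⟨r1, r2⟩ := val ρ j1 j2
    have hmono := integral_mono_measure hle
      (Filter.Eventually.of_forall fun x => key (G x) (hG x)) (m1.smul_measure hfin)
    rw [integral_smul_measure, r2, m2, ENNReal.toReal_ofReal hC, smul_eq_mul] at hmono
    have hk := key s hs0
    have e1 : entropy μ G = (∫ x, G x * Real.log (G x) ∂μ) - (t * Real.log t + t - t) := by
      simp [entropy, htdef]
    rw [e1]
    refine le_trans ?_ hmono
    simp only [entropy, ← hsdef]
    linarith

/-- Holley–Stroock criterion: if `ν` satisfies the log-Sobolev inequality with constant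
`γ` and `0 < inf F ≤ sup F < ∞`, then the measure `ν^F` with density `F / E_ν[F]`
relative to `ν` satisfies the log-Sobolev inequality with constant `(inf F / sup F) · γ`. -/
theorem holley_stroock {N : ℕ} (ν : Measure (Fin N → ℝ)) [IsProbabilityMeasure ν]
    (γ : ℝ) (hγ : 0 < γ)
    (hLSI : ∀ G : (Fin N → ℝ) → ℝ, ContDiff ℝ (⊤ : ℕ∞) G → HasCompactSupport G →
      (∀ x, 0 ≤ G x) →
      entropy ν G ≤ (2 / γ) * ∫ x, ∑ i, (pderiv' i (fun y => Real.sqrt (G y)) x) ^ 2 ∂ν)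
    (F : (Fin N → ℝ) → ℝ) (hFmeas : Measurable F)
    (a b : ℝ) (ha : 0 < a) (hab : ∀ x, a ≤ F x ∧ F x ≤ b)
    (νF : Measure (Fin N → ℝ))
    (hνF : νF = ν.withDensity fun x => ENNReal.ofReal (F x / ∫ y, F y ∂ν)) :
    ∀ G : (Fin N → ℝ) → ℝ, ContDiff ℝ (⊤ : ℕ∞) G → HasCompactSupport G → (∀ x, 0 ≤ G x) →
      entropy νF G ≤ (2 / (((⨅ x, F x) / (⨆ x, F x)) * γ)) *
        ∫ x, ∑ i, (pderiv' i (fun y => Real.sqrt (G y)) x) ^ 2 ∂νF := by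
  intro G hGs hGc hG0
  have hFb : BddBelow (Set.range F) := ⟨a, by rintro _ ⟨x, rfl⟩; exact (hab x).1⟩
  have hFa : BddAbove (Set.range F) := ⟨b, by rintro _ ⟨x, rfl⟩; exact (hab x).2⟩
  set m := ⨅ x, F x with hm
  set M := ⨆ x, F x with hM
  set Z := ∫ y, F y ∂ν with hZ
  have hmF : ∀ x, m ≤ F x := fun x => ciInf_le hFb x
  have hMF : ∀ x, F x ≤ M := fun x => le_ciSup hFa x
  have hm0 : 0 < m := lt_of_lt_of_le ha (le_ciInf fun x => (hab x).1)
  have hM0 : 0 < M := lt_of_lt_of_le hm0 ((hmF 0).trans (hMF 0))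
  have hFi : Integrable F ν := by
    refine Integrable.of_bound hFmeas.aestronglyMeasurable M
      (Filter.Eventually.of_forall fun x => ?_)
    rw [Real.norm_eq_abs, abs_of_pos (hm0.trans_le (hmF x))]
    exact hMF x
  have hZ0 : 0 < Z := by
    have : ∫ _, m ∂ν ≤ Z := integral_mono (integrable_const m) hFi hmF
    simp at this
    linarith
  have hfm : Measurable fun x => ENNReal.ofReal (F x / Z) :=
    (hFmeas.div_const Z).ennreal_ofReal
  have hprob : IsProbabilityMeasure νF := by
    constructor
    rw [hνF, withDensity_apply _ MeasurableSet.univ, Measure.restrict_univ,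
      ← ofReal_integral_eq_lintegral_ofReal (hFi.div_const Z)
        (Filter.Eventually.of_forall fun x => (div_pos (hm0.trans_le (hmF x)) hZ0).le),
      integral_div, ← hZ, div_self hZ0.ne', ENNReal.ofReal_one]
  have hle1 : νF ≤ ENNReal.ofReal (M / Z) • ν := by
    rw [hνF, ← withDensity_const]
    refine withDensity_mono (Filter.Eventually.of_forall fun x => ?_)
    exact ENNReal.ofReal_le_ofReal (div_le_div_of_nonneg_right (hMF x) hZ0.le)
  have hle2 : ν ≤ ENNReal.ofReal (Z / m) • νF := by
    rw [hνF, ← withDensity_smul _ hfm]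
    conv_lhs => rw [← withDensity_one (μ := ν)]
    refine withDensity_mono (Filter.Eventually.of_forall fun x => ?_)
    simp only [Pi.one_apply, Pi.smul_apply, smul_eq_mul]
    rw [← ENNReal.ofReal_mul (by positivity), ← ENNReal.ofReal_one]
    refine ENNReal.ofReal_le_ofReal ?_
    have : Z / m * (F x / Z) = F x / m := by field_simp
    rw [this, le_div_iff₀ hm0]
    linarith [hmF x]
  have hGl : HasCompactSupport fun x => G x * Real.log (G x) := hGc.mul_right
  have hent := hs_entropy_aux ν νF (M / Z) (by positivity) hle1 G hG0
    (hGs.continuous.integrable_of_hasCompactSupport hGc)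
    ((Real.continuous_mul_log.comp hGs.continuous).integrable_of_hasCompactSupport hGl)
  have hL := hLSI G hGs hGc hG0
  set g : (Fin N → ℝ) → ℝ :=
    fun x => ∑ i, (pderiv' i (fun y => Real.sqrt (G y)) x) ^ 2 with hg
  have hg0 : ∀ x, 0 ≤ g x := fun x => Finset.sum_nonneg fun i _ => sq_nonneg _
  have hI : ∫ x, g x ∂ν ≤ Z / m * ∫ x, g x ∂νF := by
    by_cases hi : Integrable g νF
    · have := integral_mono_measure hle2 (Filter.Eventually.of_forall hg0)
        (hi.smul_measure ENNReal.ofReal_ne_top)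
      rwa [integral_smul_measure, ENNReal.toReal_ofReal (by positivity), smul_eq_mul] at this
    · have hi2 : ¬ Integrable g ν := fun h =>
        hi ((h.smul_measure ENNReal.ofReal_ne_top).mono_measure hle1)
      rw [integral_undef hi, integral_undef hi2]; simp
  calc entropy νF G ≤ M / Z * entropy ν G := hent
    _ ≤ M / Z * (2 / γ * (Z / m * ∫ x, g x ∂νF)) := by
        refine mul_le_mul_of_nonneg_left (hL.trans ?_) (by positivity)
        exact mul_le_mul_of_nonneg_left hI (by positivity)
    _ = 2 / (m / M * γ) * ∫ x, g x ∂νF := by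
        field_simp

end
end

section
/- (Log-Sobolev inequality for Ising models under a spectral high-temperature condition.) Let Λ be a finite set, A a symmetric Λ×Λ matrix with 0 ≤ A ≤ Id as quadratic forms, β ∈ (0,1), and h ∈ ℝ^Λ. Let μ be the Ising measure on {−1,+1}^Λ with μ(σ) ∝ exp(−(β/2)(σ, Aσ) + (h,σ)), and let D_μ(F) = (1/2) Σ_{x∈Λ} E_μ[(F(σ^x) − F(σ))²] be the standard Dirichlet form, where σ^x is σ with the spin at x flipped. Then for every F : {−1,+1}^Λ → [0,∞), Ent_μ(F) ≤ (1 + 2β/(1−β)) · D_μ(√F). -/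
open Real Matrix

noncomputable section

/-- The `±1`-valued spin configuration associated with `σ : Λ → Bool` (`true ↦ +1`). -/
def spin {Λ : Type*} (σ : Λ → Bool) : Λ → ℝ := fun x => if σ x then 1 else -1

/-- Unnormalised Ising weight at inverse temperature `β` with external field `h`. -/
def isingWeight {Λ : Type*} [Fintype Λ] (A : Matrix Λ Λ ℝ) (β : ℝ) (h : Λ → ℝ)
    (σ : Λ → Bool) : ℝ :=
  Real.exp (-(β / 2) * (spin σ ⬝ᵥ A.mulVec (spin σ)) + h ⬝ᵥ spin σ)

/-- The Ising probability measure `μ(σ) ∝ exp(−(β/2)(σ, Aσ) + (h,σ))`. -/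
def isingProb {Λ : Type*} [Fintype Λ] [DecidableEq Λ] (A : Matrix Λ Λ ℝ) (β : ℝ) (h : Λ → ℝ)
    (σ : Λ → Bool) : ℝ :=
  isingWeight A β h σ / ∑ σ' : Λ → Bool, isingWeight A β h σ'

/-- Entropy of `F` under a probability weight `μ` on a finite configuration space. -/
def fent {Λ : Type*} [Fintype Λ] [DecidableEq Λ] (μ F : (Λ → Bool) → ℝ) : ℝ :=
  (∑ σ : Λ → Bool, μ σ * (F σ * Real.log (F σ)))
    - (∑ σ : Λ → Bool, μ σ * F σ) * Real.log (∑ σ : Λ → Bool, μ σ * F σ)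

/-- The configuration `σ` with the spin at `x` flipped. -/
def spinFlip {Λ : Type*} [DecidableEq Λ] (x : Λ) (σ : Λ → Bool) : Λ → Bool :=
  Function.update σ x (!σ x)

/-- The standard Dirichlet form `D_μ(F) = ½ Σ_x E_μ[(F(σ^x) − F(σ))²]`. -/
def dirichlet {Λ : Type*} [Fintype Λ] [DecidableEq Λ] (μ F : (Λ → Bool) → ℝ) : ℝ :=
  (1/2) * ∑ x : Λ, ∑ σ : Λ → Bool, μ σ * (F (spinFlip x σ) - F σ) ^ 2


theorem max_principle {E : Type*} [NormedAddCommGroup E] [ProperSpace E] (f : ℝ → E → ℝ)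
    (hc' : ContinuousOn (fun p : ℝ × E => f p.1 p.2) (Set.Icc 0 1 ×ˢ Set.univ))
    (R : ℝ) (hR : ∀ s ∈ Set.Icc (0:ℝ) 1, ∀ y, 0 < f s y → ‖y‖ ≤ R)
    (h0 : ∀ y, f 0 y ≤ 0)
    (hd : ∀ s ∈ Set.Ioc (0:ℝ) 1, ∀ y, 0 < f s y → (∀ y', f s y' ≤ f s y) →
      ∃ d < 0, HasDerivAt (fun s => f s y) d s) :
    ∀ s ∈ Set.Icc (0:ℝ) 1, ∀ y, f s y ≤ 0 := by
  intro s hs y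
  by_contra! hpos
  have hK : IsCompact (Set.Icc (0:ℝ) 1 ×ˢ Metric.closedBall (0:E) R) :=
    isCompact_Icc.prod (isCompact_closedBall _ _)
  have hmem : (s, y) ∈ Set.Icc (0:ℝ) 1 ×ˢ Metric.closedBall (0:E) R := by
    refine ⟨hs, ?_⟩
    simpa using hR s hs y hpos
  obtain ⟨⟨s0, y0⟩, ⟨hs0, hy0⟩, hmax⟩ := hK.exists_isMaxOn ⟨_, hmem⟩
    (hc'.mono (Set.prod_mono le_rfl (Set.subset_univ _)))
  have hp0 : 0 < f s0 y0 := lt_of_lt_of_le hpos (hmax hmem)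
  have hall : ∀ s' ∈ Set.Icc (0:ℝ) 1, ∀ y', f s' y' ≤ f s0 y0 := by
    intro s' hs' y'
    by_cases h : 0 < f s' y'
    · have : (s', y') ∈ Set.Icc (0:ℝ) 1 ×ˢ Metric.closedBall (0:E) R :=
        ⟨hs', by simpa using hR s' hs' y' h⟩
      exact hmax this
    · linarith
  have hs0pos : 0 < s0 := by
    rcases hs0.1.lt_or_eq with h | h
    · exact h
    · exfalso
      have := h0 y0
      simp only at h
      rw [h] at this
      linarith
  obtain ⟨d, hd0, hder⟩ := hd s0 ⟨hs0pos, hs0.2⟩ y0 hp0 (hall s0 hs0)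
  have hlt : ∀ᶠ t in nhdsWithin s0 (Set.Iio s0), slope (fun s => f s y0) s0 t < 0 := by
    have := (hasDerivWithinAt_iff_tendsto_slope' (by simp)).1
      (hder.hasDerivWithinAt (s := Set.Iio s0))
    exact this.eventually (gt_mem_nhds hd0)
  have hI : ∀ᶠ t in nhdsWithin s0 (Set.Iio s0), t ∈ Set.Ioo 0 s0 :=
    Ioo_mem_nhdsLT hs0pos
  obtain ⟨t, ht, ht2⟩ := (hlt.and hI).exists
  have h3 := hall t ⟨ht2.1.le, ht2.2.le.trans hs0.2⟩ y0
  rw [slope_def_field] at ht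
  have : (0:ℝ) ≤ (f t y0 - f s0 y0) / (t - s0) :=
    div_nonneg_of_nonpos (by linarith) (by linarith [ht2.2])
  linarith

theorem second_deriv_test (g g' : ℝ → ℝ) (g2 : ℝ) (h1 : ∀ r, HasDerivAt g (g' r) r)
    (h2 : HasDerivAt g' g2 0) (hmax : ∀ r, g r ≤ g 0) : g' 0 = 0 ∧ g2 ≤ 0 := by
  have hlm : IsLocalMax g 0 := Filter.Eventually.of_forall hmax
  have hz : g' 0 = 0 := hlm.hasDerivAt_eq_zero (h1 0)
  refine ⟨hz, ?_⟩
  by_contra! hpos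
  have hdg : deriv g = g' := funext fun r => (h1 r).deriv
  have hmin : IsLocalMin g 0 := by
    apply isLocalMin_of_deriv_deriv_pos
    · rw [hdg, h2.deriv]; exact hpos
    · rw [hdg, hz]
    · exact (h1 0).continuousAt
  have hconst : g =ᶠ[nhds 0] fun _ => g 0 := by
    filter_upwards [hmin] with r hr
    exact le_antisymm (hmax r) hr
  have h3 : deriv g =ᶠ[nhds 0] deriv (fun _ : ℝ => g 0) := hconst.deriv
  have h4 := h3.deriv_eq
  rw [hdg, h2.deriv] at h4
  simp at h4
  linarith

/-! two point inequality -/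
theorem two_point_aux (t : ℝ) :
    0 ≤ 7/6 - 4*t/3 + t^2/6 + Real.log ((1+t+t^2)/3) := by
  set g : ℝ → ℝ := fun t => 7/6 - 4*t/3 + t^2/6 + Real.log ((1+t+t^2)/3) with hg
  have hder : ∀ t, HasDerivAt g ((t-1)^3/(3*(1+t+t^2))) t := by
    intro t
    have hp : 0 < 1+t+t^2 := by nlinarith [sq_nonneg (t+1)]
    have h1 : HasDerivAt (fun t : ℝ => (1+t+t^2)/3) ((0 + 1 + 2*t)/3) t := by
      have := (((hasDerivAt_const t (1:ℝ)).add (hasDerivAt_id t)).add (hasDerivAt_pow 2 t)).div_const 3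
      exact this.congr_deriv (by norm_num)
    have h2 := h1.log (by positivity)
    have h3 : HasDerivAt (fun t : ℝ => 7/6 - 4*t/3 + t^2/6) (0 - 4*1/3 + 2*t/6) t := by
      have := ((hasDerivAt_const t (7/6:ℝ)).sub (((hasDerivAt_id t).const_mul 4).div_const 3)).add
        ((hasDerivAt_pow 2 t).div_const 6)
      exact this.congr_deriv (by norm_num)
    refine (h3.add h2).congr_deriv ?_
    field_simp
    ring
  have g1 : g 1 = 0 := by simp only [hg]; norm_num
  show 0 ≤ g t
  rcases le_total t 1 with h | h
  · have : AntitoneOn g (Set.Icc t 1) := by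
      apply antitoneOn_of_deriv_nonpos (convex_Icc _ _)
      · exact fun x _ => (hder x).continuousAt.continuousWithinAt
      · exact fun x _ => (hder x).differentiableAt.differentiableWithinAt
      · intro x hx
        rw [interior_Icc] at hx
        rw [(hder x).deriv]
        have hp : 0 < 1+x+x^2 := by nlinarith [sq_nonneg (x+1)]
        apply div_nonpos_of_nonpos_of_nonneg _ (by positivity)
        have : (1 - x)^3 ≥ 0 := pow_nonneg (by linarith [hx.2]) 3
        nlinarith
    rw [← g1]
    exact this ⟨le_rfl, h⟩ ⟨h, le_rfl⟩ h
  · have : MonotoneOn g (Set.Icc 1 t) := by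
      apply monotoneOn_of_deriv_nonneg (convex_Icc _ _)
      · exact fun x _ => (hder x).continuousAt.continuousWithinAt
      · exact fun x _ => (hder x).differentiableAt.differentiableWithinAt
      · intro x hx
        rw [interior_Icc] at hx
        rw [(hder x).deriv]
        have hp : 0 < 1+x+x^2 := by nlinarith [sq_nonneg (x+1)]
        exact div_nonneg (pow_nonneg (by linarith [hx.1]) 3) (by positivity)
    rw [← g1]
    exact this ⟨le_rfl, h⟩ ⟨h, le_rfl⟩ h

theorem two_point_half (a b : ℝ) (ha : 0 ≤ a) (hb : 0 ≤ b) (hab : 0 < a^2+a*b+b^2) :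
    a^2 * Real.log (a^2) - a^2 * Real.log ((a^2+a*b+b^2)/3) - a^2 + (a^2+a*b+b^2)/3
      ≤ 1/2*(a-b)^2 := by
  rcases ha.eq_or_lt with h | h
  · subst h
    simp
    nlinarith [sq_nonneg b]
  · have := two_point_aux (b/a)
    have e : (1 + b/a + (b/a)^2)/3 = ((a^2+a*b+b^2)/3)/a^2 := by field_simp
    rw [e, Real.log_div (by positivity) (by positivity)] at this
    have h2 := mul_le_mul_of_nonneg_left this (sq_nonneg a)
    have e2 : a^2 * (7/6 - 4*(b/a)/3 + (b/a)^2/6 + (Real.log ((a^2+a*b+b^2)/3) - Real.log (a^2)))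
      = 7/6*a^2 - 4*a*b/3 + b^2/6 + a^2*(Real.log ((a^2+a*b+b^2)/3) - Real.log (a^2)) := by
      field_simp
    rw [e2] at h2
    nlinarith

theorem xlog_ge (a b : ℝ) (ha : 0 ≤ a) (hb : 0 < b) :
    a - b ≤ a * Real.log a - a * Real.log b := by
  rcases ha.eq_or_lt with h | h
  · subst h; simp; linarith
  · have := Real.one_sub_inv_le_log_of_pos (show 0 < a/b by positivity)
    rw [Real.log_div h.ne' hb.ne'] at this
    have h2 := mul_le_mul_of_nonneg_left this h.le
    have e : a * (1 - (a/b)⁻¹) = a - b := by field_simp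
    rw [e] at h2; linarith

theorem two_point (p q a b : ℝ) (hp : 0 ≤ p) (hq : 0 ≤ q) (hpq : p + q = 1)
    (ha : 0 ≤ a) (hb : 0 ≤ b) :
    p * (a^2 * Real.log (a^2)) + q * (b^2 * Real.log (b^2))
      - (p*a^2+q*b^2) * Real.log (p*a^2+q*b^2) ≤ 1/2*(a-b)^2 := by
  by_cases hab : 0 < a^2+a*b+b^2
  · have h1 := two_point_half a b ha hb hab
    have h2 := two_point_half b a hb ha (by nlinarith)
    rw [show b^2+b*a+a^2 = a^2+a*b+b^2 by ring] at h2
    have h3 := xlog_ge (p*a^2+q*b^2) ((a^2+a*b+b^2)/3) (by positivity) (by positivity)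
    have h4 := mul_le_mul_of_nonneg_left h1 hp
    have h5 := mul_le_mul_of_nonneg_left h2 hq
    have hq' : q = 1 - p := by linarith
    subst hq'
    nlinarith
  · have ha0 : a = 0 := by nlinarith [mul_nonneg ha hb, sq_nonneg a, sq_nonneg b]
    have hb0 : b = 0 := by nlinarith [mul_nonneg ha hb, sq_nonneg a, sq_nonneg b]
    subst ha0 hb0; simp

theorem xlogx_cs {ι : Type*} [Fintype ι] (m f g : ι → ℝ) (hm : ∀ i, 0 ≤ m i) :
    (Real.sqrt (∑ i, m i * f i ^ 2) - Real.sqrt (∑ i, m i * g i ^ 2)) ^ 2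
      ≤ ∑ i, m i * (f i - g i) ^ 2 := by
  have hf : 0 ≤ ∑ i, m i * f i ^ 2 := Finset.sum_nonneg fun i _ => mul_nonneg (hm i) (sq_nonneg _)
  have hg : 0 ≤ ∑ i, m i * g i ^ 2 := Finset.sum_nonneg fun i _ => mul_nonneg (hm i) (sq_nonneg _)
  have hcs : ∑ i, m i * (f i * g i) ≤
      Real.sqrt (∑ i, m i * f i ^ 2) * Real.sqrt (∑ i, m i * g i ^ 2) := by
    have := Finset.sum_mul_sq_le_sq_mul_sq Finset.univ (fun i => Real.sqrt (m i) * f i)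
      (fun i => Real.sqrt (m i) * g i)
    rw [← Real.sqrt_mul hf]
    apply Real.le_sqrt_of_sq_le
    have h1 : ∀ i, Real.sqrt (m i) * f i * (Real.sqrt (m i) * g i) = m i * (f i * g i) := by
      intro i
      linear_combination (f i * g i) * Real.mul_self_sqrt (hm i)
    have h2 : ∀ (k : ι → ℝ) i, (Real.sqrt (m i) * k i) ^ 2 = m i * k i ^ 2 := by
      intro k i
      linear_combination (k i ^ 2) * Real.mul_self_sqrt (hm i)
    simpa only [h1, h2] using this
  have e : ∑ i, m i * (f i - g i) ^ 2 = ∑ i, m i * f i ^ 2 + ∑ i, m i * g i ^ 2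
      - 2 * ∑ i, m i * (f i * g i) := by
    rw [Finset.mul_sum, ← Finset.sum_add_distrib, ← Finset.sum_sub_distrib]
    apply Finset.sum_congr rfl; intro i _; ring
  rw [e]
  nlinarith [Real.sq_sqrt hf, Real.sq_sqrt hg]

theorem sum_fin_succ_bool {n : ℕ} (G : (Fin (n+1) → Bool) → ℝ) :
    ∑ σ, G σ = ∑ τ : Fin n → Bool, (G (Fin.cons true τ) + G (Fin.cons false τ)) := by
  rw [← (Fin.consEquiv (fun _ => Bool)).sum_comp, Fintype.sum_prod_type, Fintype.sum_bool,
    ← Finset.sum_add_distrib]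
  rfl

theorem product_lsi_fin : ∀ (n : ℕ) (p : Fin n → Bool → ℝ) (_ : ∀ x b, 0 ≤ p x b)
    (_ : ∀ x, p x true + p x false = 1) (f : (Fin n → Bool) → ℝ),
    fent (fun σ => ∏ x, p x (σ x)) (fun σ => f σ ^ 2) ≤
      dirichlet (fun σ => ∏ x, p x (σ x)) f := by
  intro n
  induction n with
  | zero =>
    intro p _ _ f
    simp [fent, dirichlet]
  | succ n ih =>
    intro p hp hs f
    have ih1 := ih (fun x => p x.succ) (fun x b => hp _ _) (fun x => hs _)
      (fun τ => f (Fin.cons true τ))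
    have ih0 := ih (fun x => p x.succ) (fun x b => hp _ _) (fun x => hs _)
      (fun τ => f (Fin.cons false τ))
    have fl0 : ∀ b (τ : Fin n → Bool), spinFlip 0 (Fin.cons b τ : Fin (n+1) → Bool) = Fin.cons (!b) τ := by
      intro b τ; unfold spinFlip; rw [Fin.update_cons_zero]; rfl
    have fls : ∀ b (τ : Fin n → Bool) i, spinFlip i.succ (Fin.cons b τ : Fin (n+1) → Bool)
        = Fin.cons b (spinFlip i τ) := by
      intro b τ i; unfold spinFlip; rw [Fin.cons_update]; rfl
    unfold fent dirichlet at *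
    simp only [sum_fin_succ_bool, Fin.prod_univ_succ, Fin.cons_zero, Fin.cons_succ,
      Fin.sum_univ_succ, fl0, fls, Bool.not_true, Bool.not_false]
    set m : (Fin n → Bool) → ℝ := fun τ => ∏ i, p i.succ (τ i) with hm
    have hm0 : ∀ τ, 0 ≤ m τ := fun τ => Finset.prod_nonneg fun i _ => hp _ _
    set f1 : (Fin n → Bool) → ℝ := fun τ => f (Fin.cons true τ) with hf1
    set f0 : (Fin n → Bool) → ℝ := fun τ => f (Fin.cons false τ) with hf0
    have hS1 : 0 ≤ ∑ τ, m τ * f1 τ ^ 2 :=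
      Finset.sum_nonneg fun i _ => mul_nonneg (hm0 i) (sq_nonneg _)
    have hS0 : 0 ≤ ∑ τ, m τ * f0 τ ^ 2 :=
      Finset.sum_nonneg fun i _ => mul_nonneg (hm0 i) (sq_nonneg _)
    have tp := two_point (p 0 true) (p 0 false) _ _ (hp _ _) (hp _ _) (hs 0)
      (Real.sqrt_nonneg (∑ τ, m τ * f1 τ ^ 2)) (Real.sqrt_nonneg (∑ τ, m τ * f0 τ ^ 2))
    rw [Real.sq_sqrt hS1, Real.sq_sqrt hS0] at tp
    have cs := xlogx_cs m f1 f0 hm0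
    have k1 := mul_le_mul_of_nonneg_left ih1 (hp 0 true)
    have k0 := mul_le_mul_of_nonneg_left ih0 (hp 0 false)
    have e1 : ∑ τ, (p 0 true * m τ * (f1 τ ^ 2) + p 0 false * m τ * (f0 τ ^ 2))
       = p 0 true * ∑ τ, m τ * f1 τ ^ 2 + p 0 false * ∑ τ, m τ * f0 τ ^ 2 := by
      simp only [Finset.sum_add_distrib, Finset.mul_sum, mul_assoc]
    have e2 : ∑ τ, (p 0 true * m τ * (f1 τ ^ 2 * Real.log (f1 τ ^ 2))
          + p 0 false * m τ * (f0 τ ^ 2 * Real.log (f0 τ ^ 2)))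
       = p 0 true * ∑ τ, m τ * (f1 τ ^ 2 * Real.log (f1 τ ^ 2))
          + p 0 false * ∑ τ, m τ * (f0 τ ^ 2 * Real.log (f0 τ ^ 2)) := by
      simp only [Finset.sum_add_distrib, Finset.mul_sum, mul_assoc]
    have e3 : ∑ τ, (p 0 true * m τ * (f0 τ - f1 τ) ^ 2 + p 0 false * m τ * (f1 τ - f0 τ) ^ 2)
       = ∑ τ, m τ * (f1 τ - f0 τ) ^ 2 := by
      apply Finset.sum_congr rfl; intro τ _
      have := hs 0
      linear_combination (m τ * (f1 τ - f0 τ) ^ 2) * this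
    have e4 : ∑ x : Fin n, ∑ τ, (p 0 true * m τ * (f1 (spinFlip x τ) - f1 τ) ^ 2
          + p 0 false * m τ * (f0 (spinFlip x τ) - f0 τ) ^ 2)
       = p 0 true * ∑ x : Fin n, ∑ τ, m τ * (f1 (spinFlip x τ) - f1 τ) ^ 2
         + p 0 false * ∑ x : Fin n, ∑ τ, m τ * (f0 (spinFlip x τ) - f0 τ) ^ 2 := by
      simp only [Finset.sum_add_distrib, Finset.mul_sum, mul_assoc]
    change ∑ τ, (p 0 true * m τ * (f1 τ ^ 2 * Real.log (f1 τ ^ 2))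
          + p 0 false * m τ * (f0 τ ^ 2 * Real.log (f0 τ ^ 2)))
      - (∑ τ, (p 0 true * m τ * (f1 τ ^ 2) + p 0 false * m τ * (f0 τ ^ 2)))
        * Real.log (∑ τ, (p 0 true * m τ * (f1 τ ^ 2) + p 0 false * m τ * (f0 τ ^ 2)))
      ≤ 1/2 * (∑ τ, (p 0 true * m τ * (f0 τ - f1 τ) ^ 2 + p 0 false * m τ * (f1 τ - f0 τ) ^ 2)
        + ∑ x : Fin n, ∑ τ, (p 0 true * m τ * (f1 (spinFlip x τ) - f1 τ) ^ 2
          + p 0 false * m τ * (f0 (spinFlip x τ) - f0 τ) ^ 2))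
    rw [e1, e2, e3, e4]
    nlinarith

theorem product_lsi {Λ : Type*} [Fintype Λ] [DecidableEq Λ] (p : Λ → Bool → ℝ)
    (hp : ∀ x b, 0 ≤ p x b)
    (hs : ∀ x, p x true + p x false = 1) (f : (Λ → Bool) → ℝ) :
    fent (fun σ => ∏ x, p x (σ x)) (fun σ => f σ ^ 2) ≤
      dirichlet (fun σ => ∏ x, p x (σ x)) f := by
  let e := Fintype.equivFin Λ
  let E : (Λ → Bool) ≃ (Fin (Fintype.card Λ) → Bool) := e.arrowCongr (Equiv.refl Bool)
  have key := product_lsi_fin _ (fun i => p (e.symm i)) (fun x b => hp _ _) (fun x => hs _)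
    (fun τ => f (E.symm τ))
  have hpr : ∀ σ : Λ → Bool, ∏ i, p (e.symm i) (E σ i) = ∏ x, p x (σ x) := by
    intro σ
    rw [← e.symm.prod_comp]
    rfl
  have hfl : ∀ x (σ : Λ → Bool), E.symm (spinFlip (e x) (E σ)) = spinFlip x σ := by
    intro x σ
    funext y
    simp only [E, spinFlip, Equiv.arrowCongr_symm, Equiv.arrowCongr_apply, Function.comp,
      Function.update_apply]
    simp
  unfold fent dirichlet at *
  simp only [← E.sum_comp, Equiv.symm_apply_apply, hpr] at key
  rw [← e.sum_comp] at key
  simp only [hfl] at key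
  exact key

section heat
variable {Λ : Type*} [Fintype Λ] [DecidableEq Λ]

/-- Weighted exponential sums. -/
def SS (Q c : (Λ → Bool) → ℝ) (s : ℝ) (y : Λ → ℝ) : ℝ :=
  ∑ σ : Λ → Bool, c σ * Real.exp (s / 2 * Q σ + y ⬝ᵥ spin σ)

theorem SS_pos (Q c : (Λ → Bool) → ℝ) (hc : ∀ σ, 0 < c σ) (s : ℝ) (y : Λ → ℝ) : 0 < SS Q c s y :=
  Finset.sum_pos (fun σ _ => mul_pos (hc σ) (Real.exp_pos _)) Finset.univ_nonempty

theorem SS_nonneg (Q c : (Λ → Bool) → ℝ) (hc : ∀ σ, 0 ≤ c σ) (s : ℝ) (y : Λ → ℝ) : 0 ≤ SS Q c s y :=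
  Finset.sum_nonneg (fun σ _ => mul_nonneg (hc σ) (Real.exp_pos _).le)

theorem SS_mono (Q c d : (Λ → Bool) → ℝ) (hc : ∀ σ, c σ ≤ d σ) (s : ℝ) (y : Λ → ℝ) :
    SS Q c s y ≤ SS Q d s y :=
  Finset.sum_le_sum (fun σ _ => mul_le_mul_of_nonneg_right (hc σ) (Real.exp_pos _).le)

theorem SS_sum {ι : Type*} [Fintype ι] (Q : (Λ → Bool) → ℝ) (c : ι → (Λ → Bool) → ℝ)
    (a : ι → ℝ) (s : ℝ) (y : Λ → ℝ) :
    SS Q (fun σ => ∑ i, a i * c i σ) s y = ∑ i, a i * SS Q (c i) s y := by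
  unfold SS
  simp only [Finset.sum_mul, Finset.mul_sum]
  rw [Finset.sum_comm]
  simp only [mul_assoc]

theorem SS_continuous (Q c : (Λ → Bool) → ℝ) :
    Continuous (fun p : ℝ × (Λ → ℝ) => SS Q c p.1 p.2) := by
  unfold SS dotProduct
  fun_prop

theorem SS_hasDerivAt_time (Q c : (Λ → Bool) → ℝ) (s : ℝ) (y : Λ → ℝ) :
    HasDerivAt (fun s => SS Q c s y) (SS Q (fun σ => c σ * (Q σ / 2)) s y) s := by
  unfold SS
  apply HasDerivAt.fun_sum
  intro σ _
  have h1 : HasDerivAt (fun s : ℝ => s / 2 * Q σ + y ⬝ᵥ spin σ) (1 / 2 * Q σ) s :=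
    (((hasDerivAt_id s).div_const 2).mul_const (Q σ)).add_const _
  refine (h1.exp.const_mul (c σ)).congr_deriv ?_
  ring

theorem SS_hasDerivAt_dir (Q c : (Λ → Bool) → ℝ) (s : ℝ) (y v : Λ → ℝ) (k r : ℝ) :
    HasDerivAt (fun r : ℝ => SS Q c s (y + (k * r) • v))
      (k * SS Q (fun σ => c σ * (v ⬝ᵥ spin σ)) s (y + (k * r) • v)) r := by
  unfold SS
  rw [Finset.mul_sum]
  apply HasDerivAt.fun_sum
  intro σ _
  have h1 : HasDerivAt (fun r : ℝ => s / 2 * Q σ + (y + (k * r) • v) ⬝ᵥ spin σ)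
      (k * (v ⬝ᵥ spin σ)) r := by
    simp only [add_dotProduct, smul_dotProduct, smul_eq_mul]
    have := ((((hasDerivAt_id r).const_mul k).mul_const (v ⬝ᵥ spin σ)).const_add
      (y ⬝ᵥ spin σ)).const_add (s / 2 * Q σ)
    exact this.congr_deriv (by ring)
  refine (h1.exp.const_mul (c σ)).congr_deriv ?_
  ring

/-- log partition function -/
def uu (Q : (Λ → Bool) → ℝ) (s : ℝ) (y : Λ → ℝ) : ℝ := Real.log (SS Q (fun _ => 1) s y)

/-- mean in direction `v` -/
def mm (Q : (Λ → Bool) → ℝ) (v : Λ → ℝ) (s : ℝ) (y : Λ → ℝ) : ℝ :=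
  SS Q (fun σ => v ⬝ᵥ spin σ) s y / SS Q (fun _ => 1) s y

/-- second moment in direction `v` -/
def qq (Q : (Λ → Bool) → ℝ) (v : Λ → ℝ) (s : ℝ) (y : Λ → ℝ) : ℝ :=
  SS Q (fun σ => (v ⬝ᵥ spin σ) ^ 2) s y / SS Q (fun _ => 1) s y

theorem one_pos' (Q : (Λ → Bool) → ℝ) (s : ℝ) (y : Λ → ℝ) : 0 < SS Q (fun _ => 1) s y :=
  SS_pos _ _ (fun _ => one_pos) _ _

theorem uu_continuous (Q : (Λ → Bool) → ℝ) :
    Continuous (fun p : ℝ × (Λ → ℝ) => uu Q p.1 p.2) :=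
  (SS_continuous Q _).log (fun p => (one_pos' Q p.1 p.2).ne')

theorem uu_dir (Q : (Λ → Bool) → ℝ) (s : ℝ) (y v : Λ → ℝ) (k r : ℝ) :
    HasDerivAt (fun r : ℝ => uu Q s (y + (k * r) • v)) (k * mm Q v s (y + (k * r) • v)) r := by
  refine ((SS_hasDerivAt_dir Q _ s y v k r).log (one_pos' Q s _).ne').congr_deriv ?_
  simp only [one_mul, mm]
  ring

theorem mm_dir (Q : (Λ → Bool) → ℝ) (s : ℝ) (y v : Λ → ℝ) (k r : ℝ) :
    HasDerivAt (fun r : ℝ => mm Q v s (y + (k * r) • v))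
      (k * (qq Q v s (y + (k * r) • v) - mm Q v s (y + (k * r) • v) ^ 2)) r := by
  have h0 := (one_pos' Q s (y + (k * r) • v)).ne'
  refine ((SS_hasDerivAt_dir Q _ s y v k r).fun_div (SS_hasDerivAt_dir Q _ s y v k r) h0).congr_deriv ?_
  simp only [one_mul, mm, qq, sq]
  field_simp

theorem uu_time {ι : Type*} [Fintype ι] (V : ι → Λ → ℝ) (Q : (Λ → Bool) → ℝ)
    (hQ : ∀ σ, Q σ = ∑ i, (V i ⬝ᵥ spin σ) ^ 2) (s : ℝ) (y : Λ → ℝ) :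
    HasDerivAt (fun s => uu Q s y) (∑ i, qq Q (V i) s y / 2) s := by
  refine ((SS_hasDerivAt_time Q _ s y).log (one_pos' Q s _).ne').congr_deriv ?_
  have : (fun σ => 1 * (Q σ / 2)) = fun σ => ∑ i, (1/2) * (V i ⬝ᵥ spin σ) ^ 2 := by
    funext σ; rw [hQ, ← Finset.mul_sum]; ring
  rw [this, SS_sum, Finset.sum_div]
  apply Finset.sum_congr rfl; intro i _
  simp only [qq]; ring

theorem spin_abs (σ : Λ → Bool) (x : Λ) : |spin σ x| = 1 := by
  unfold spin; split_ifs <;> simp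

theorem dot_spin_le (v : Λ → ℝ) (σ : Λ → Bool) : |v ⬝ᵥ spin σ| ≤ ∑ x, |v x| := by
  unfold dotProduct
  refine (Finset.abs_sum_le_sum_abs _ _).trans (Finset.sum_le_sum fun x _ => ?_)
  rw [abs_mul, spin_abs, mul_one]

theorem uu_lip (Q : (Λ → Bool) → ℝ) (s : ℝ) (y z : Λ → ℝ) :
    uu Q s (y + z) ≤ uu Q s y + ∑ x, |z x| := by
  unfold uu
  rw [← Real.log_exp (∑ x, |z x|), ← Real.log_mul (one_pos' Q s _).ne' (Real.exp_pos _).ne']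
  apply Real.log_le_log (one_pos' Q s _)
  unfold SS
  rw [Finset.sum_mul]
  apply Finset.sum_le_sum
  intro σ _
  rw [mul_assoc, ← Real.exp_add, one_mul, one_mul]
  apply Real.exp_le_exp.2
  rw [add_dotProduct]
  linarith [(abs_le.1 (dot_spin_le z σ)).2]

theorem mm_abs (Q : (Λ → Bool) → ℝ) (v : Λ → ℝ) (s : ℝ) (y : Λ → ℝ) :
    |mm Q v s y| ≤ ∑ x, |v x| := by
  unfold mm
  rw [abs_div, abs_of_pos (one_pos' Q s y), div_le_iff₀ (one_pos' Q s y)]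
  unfold SS
  rw [Finset.mul_sum]
  refine (Finset.abs_sum_le_sum_abs _ _).trans (Finset.sum_le_sum fun σ _ => ?_)
  rw [abs_mul, abs_of_pos (Real.exp_pos _), one_mul]
  exact mul_le_mul_of_nonneg_right (dot_spin_le v σ) (Real.exp_pos _).le

/-- weights at time 0 factor -/
theorem exp_dot_spin (y : Λ → ℝ) (σ : Λ → Bool) :
    Real.exp (y ⬝ᵥ spin σ) = ∏ x, Real.exp (if σ x then y x else - y x) := by
  rw [← Real.exp_sum]
  congr 1
  unfold dotProduct spin
  apply Finset.sum_congr rfl; intro x _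
  split_ifs <;> ring

theorem SS_zero (Q : (Λ → Bool) → ℝ) (y : Λ → ℝ) :
    SS Q (fun _ => 1) 0 y = ∏ x, (2 * Real.cosh (y x)) := by
  unfold SS
  simp only [zero_div, zero_mul, zero_add, one_mul, exp_dot_spin]
  have := Finset.prod_univ_sum (fun _ : Λ => (Finset.univ : Finset Bool))
    (fun x b => Real.exp (if b then y x else - y x))
  rw [Fintype.piFinset_univ] at this
  rw [← this]
  apply Finset.prod_congr rfl
  intro x _
  rw [Fintype.sum_bool, Real.cosh_eq]
  simp
  ring

theorem cosh_ineq (y z : ℝ) :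
    (2 * Real.cosh (y + z)) * (2 * Real.cosh (y - z)) ≤ (2 * Real.cosh y) ^ 2 * Real.exp (z ^ 2) := by
  have h1 : Real.cosh z ^ 2 ≤ Real.exp (z ^ 2) := by
    have := Real.cosh_le_exp_half_sq z
    calc Real.cosh z ^ 2 ≤ Real.exp (z ^ 2 / 2) ^ 2 :=
          pow_le_pow_left₀ (Real.cosh_pos z).le this 2
      _ = Real.exp (z ^ 2) := by rw [← Real.exp_nat_mul]; congr 1; push_cast; ring
  rw [Real.cosh_add, Real.cosh_sub]
  have hy := Real.cosh_sq y
  have hz := Real.cosh_sq z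
  have : (Real.cosh y * Real.cosh z + Real.sinh y * Real.sinh z) *
      (Real.cosh y * Real.cosh z - Real.sinh y * Real.sinh z) ≤ Real.cosh y ^ 2 * Real.cosh z ^ 2 := by
    nlinarith [sq_nonneg (Real.sinh y * Real.sinh z)]
  nlinarith [mul_le_mul_of_nonneg_left h1 (sq_nonneg (Real.cosh y))]

theorem uu_zero_ineq (Q : (Λ → Bool) → ℝ) (y z : Λ → ℝ) :
    uu Q 0 (y + z) + uu Q 0 (y - z) - 2 * uu Q 0 y ≤ z ⬝ᵥ z := by
  have hc : ∀ t : ℝ, (2 * Real.cosh t) ≠ 0 := fun t => by have := Real.cosh_pos t; positivity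
  unfold uu
  rw [SS_zero, SS_zero, SS_zero, Real.log_prod (fun x _ => hc _), Real.log_prod (fun x _ => hc _),
    Real.log_prod (fun x _ => hc _), Finset.mul_sum, ← Finset.sum_add_distrib,
    ← Finset.sum_sub_distrib]
  unfold dotProduct
  apply Finset.sum_le_sum
  intro x _
  have h := Real.log_le_log (by have := Real.cosh_pos (y x + z x); have := Real.cosh_pos (y x - z x); positivity)
    (cosh_ineq (y x) (z x))
  rw [Real.log_mul (hc _) (hc _), Real.log_mul (pow_ne_zero _ (hc _)) (Real.exp_pos _).ne', Real.log_pow,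
    Real.log_exp] at h
  simp only [Pi.add_apply, Pi.sub_apply]
  push_cast at h
  linarith

theorem dot_expand (y v : Λ → ℝ) (r : ℝ) :
    (y + r • v) ⬝ᵥ (y + r • v) = y ⬝ᵥ y + (2 * (v ⬝ᵥ y)) * r + (v ⬝ᵥ v) * r ^ 2 := by
  simp only [add_dotProduct, dotProduct_add, smul_dotProduct, dotProduct_smul, smul_eq_mul,
    dotProduct_comm y v]
  ring

theorem quad_deriv (a b c r : ℝ) :
    HasDerivAt (fun r : ℝ => a + b * r + c * r ^ 2) (b + 2 * c * r) r := by
  have := (((hasDerivAt_id r).const_mul b).const_add a).add ((hasDerivAt_pow 2 r).const_mul c)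
  exact this.congr_deriv (by norm_num; ring)

/-- conditions at a spatial maximum, `y` direction -/
theorem max_y (Q : (Λ → Bool) → ℝ) (s : ℝ) (y z v : Λ → ℝ) (E : ℝ)
    (hmax : ∀ r : ℝ, uu Q s (y + z + r • v) + uu Q s (y - z + r • v) - 2 * uu Q s (y + r • v)
      - E * ((y + r • v) ⬝ᵥ (y + r • v)) ≤
      uu Q s (y + z) + uu Q s (y - z) - 2 * uu Q s y - E * (y ⬝ᵥ y)) :
    mm Q v s (y + z) + mm Q v s (y - z) - 2 * mm Q v s y = 2 * E * (v ⬝ᵥ y) ∧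
    (qq Q v s (y + z) - mm Q v s (y + z) ^ 2) + (qq Q v s (y - z) - mm Q v s (y - z) ^ 2)
      - 2 * (qq Q v s y - mm Q v s y ^ 2) ≤ 2 * E * (v ⬝ᵥ v) := by
  have key := second_deriv_test
    (fun r => uu Q s (y + z + (1 * r) • v) + uu Q s (y - z + (1 * r) • v)
      - 2 * uu Q s (y + (1 * r) • v)
      - E * (y ⬝ᵥ y + (2 * (v ⬝ᵥ y)) * r + (v ⬝ᵥ v) * r ^ 2))
    (fun r => 1 * mm Q v s (y + z + (1 * r) • v) + 1 * mm Q v s (y - z + (1 * r) • v)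
      - 2 * (1 * mm Q v s (y + (1 * r) • v)) - E * (2 * (v ⬝ᵥ y) + 2 * (v ⬝ᵥ v) * r)) _
    (fun r => (((uu_dir Q s (y + z) v 1 r).fun_add (uu_dir Q s (y - z) v 1 r)).fun_sub
      ((uu_dir Q s y v 1 r).const_mul 2)).fun_sub ((quad_deriv _ _ _ r).const_mul E))
    (((((mm_dir Q s (y + z) v 1 0).const_mul 1).fun_add ((mm_dir Q s (y - z) v 1 0).const_mul 1)).fun_sub
      (((mm_dir Q s y v 1 0).const_mul 1).const_mul 2)).fun_sub
      (((((hasDerivAt_id (0:ℝ)).const_mul (2 * (v ⬝ᵥ v)))).const_add (2 * (v ⬝ᵥ y))).const_mul E))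
    (fun r => by
      have := hmax r
      rw [dot_expand] at this
      simpa using this)
  simp at key
  constructor
  · linarith [key.1]
  · linarith [key.2]

theorem max_z (Q : (Λ → Bool) → ℝ) (s : ℝ) (y z v : Λ → ℝ) (K : ℝ)
    (hmax : ∀ r : ℝ, uu Q s (y + z + r • v) + uu Q s (y - z - r • v)
      - K * ((z + r • v) ⬝ᵥ (z + r • v)) ≤
      uu Q s (y + z) + uu Q s (y - z) - K * (z ⬝ᵥ z)) :
    mm Q v s (y + z) - mm Q v s (y - z) = 2 * K * (v ⬝ᵥ z) := by
  have hlm : IsLocalMax (fun r : ℝ => uu Q s (y + z + (1 * r) • v) + uu Q s (y - z + (-1 * r) • v)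
      - K * (z ⬝ᵥ z + (2 * (v ⬝ᵥ z)) * r + (v ⬝ᵥ v) * r ^ 2)) 0 := by
    refine Filter.Eventually.of_forall fun r => ?_
    have := hmax r
    rw [dot_expand] at this
    simpa [sub_eq_add_neg] using this
  have := hlm.hasDerivAt_eq_zero
    (((uu_dir Q s (y + z) v 1 0).fun_add (uu_dir Q s (y - z) v (-1) 0)).fun_sub
      ((quad_deriv _ _ _ 0).const_mul K))
  simp at this
  linarith

theorem K_deriv (β s : ℝ) (h : 0 < 1 - s * β) :
    HasDerivAt (fun s : ℝ => (1 - s * β)⁻¹) (β * ((1 - s * β)⁻¹) ^ 2) s := by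
  have h1 : HasDerivAt (fun s : ℝ => 1 - s * β) (-(1 * β)) s :=
    ((hasDerivAt_id s).mul_const β).const_sub 1
  refine (h1.fun_inv h.ne').congr_deriv ?_
  field_simp

theorem dot_self_nonneg' (z : Λ → ℝ) : 0 ≤ z ⬝ᵥ z :=
  Finset.sum_nonneg fun x _ => mul_self_nonneg _

theorem uu_cont_comp {X : Type*} [TopologicalSpace X] (Q : (Λ → Bool) → ℝ) (s : X → ℝ)
    (y : X → Λ → ℝ) (hs : Continuous s) (hy : Continuous y) :
    Continuous (fun q => uu Q (s q) (y q)) :=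
  (uu_continuous Q).comp (hs.prodMk hy)

theorem mid_cont (Q : (Λ → Bool) → ℝ) (β ε θ : ℝ) (hden : ∀ s ∈ Set.Icc (0:ℝ) 1, 0 < 1 - s * β) :
    ContinuousOn (fun q : ℝ × ((Λ → ℝ) × (Λ → ℝ)) =>
      uu Q q.1 (q.2.1 + q.2.2) + uu Q q.1 (q.2.1 - q.2.2) - 2 * uu Q q.1 q.2.1
       - (1 - q.1 * β)⁻¹ * (q.2.2 ⬝ᵥ q.2.2)
       - ε * Real.exp (θ * q.1) * (1 + q.2.1 ⬝ᵥ q.2.1)) (Set.Icc 0 1 ×ˢ Set.univ) := by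
  have c1 := uu_cont_comp Q (fun q : ℝ × ((Λ → ℝ) × (Λ → ℝ)) => q.1) (fun q => q.2.1 + q.2.2)
    (by fun_prop) (by fun_prop)
  have c2 := uu_cont_comp Q (fun q : ℝ × ((Λ → ℝ) × (Λ → ℝ)) => q.1) (fun q => q.2.1 - q.2.2)
    (by fun_prop) (by fun_prop)
  have c3 := uu_cont_comp Q (fun q : ℝ × ((Λ → ℝ) × (Λ → ℝ)) => q.1) (fun q => q.2.1)
    (by fun_prop) (by fun_prop)
  have c4 : ContinuousOn (fun q : ℝ × ((Λ → ℝ) × (Λ → ℝ)) => (1 - q.1 * β)⁻¹)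
      (Set.Icc 0 1 ×ˢ Set.univ) := by
    apply ContinuousOn.inv₀
    · fun_prop
    · intro q hq; exact (hden q.1 hq.1).ne'
  have c5 : Continuous (fun q : ℝ × ((Λ → ℝ) × (Λ → ℝ)) => q.2.2 ⬝ᵥ q.2.2) := by
    unfold dotProduct; fun_prop
  have c6 : Continuous (fun q : ℝ × ((Λ → ℝ) × (Λ → ℝ)) =>
      ε * Real.exp (θ * q.1) * (1 + q.2.1 ⬝ᵥ q.2.1)) := by
    unfold dotProduct; fun_prop
  have c7 := (c1.add c2).sub (c3.const_mul 2)
  exact (c7.continuousOn.sub (c4.mul c5.continuousOn)).sub c6.continuousOn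

set_option maxHeartbeats 1000000 in
theorem midpoint_ineq_eps {ι : Type*} [Fintype ι] (V : ι → Λ → ℝ) (Q : (Λ → Bool) → ℝ)
    (hQ : ∀ σ, Q σ = ∑ i, (V i ⬝ᵥ spin σ) ^ 2) (β : ℝ) (hβ0 : 0 < β) (hβ1 : β < 1)
    (hV : ∀ z, ∑ i, (V i ⬝ᵥ z) ^ 2 ≤ β * (z ⬝ᵥ z)) :
    ∃ θ : ℝ, ∀ ε : ℝ, 0 < ε → ε * Real.exp θ ≤ 1 →
    ∀ s ∈ Set.Icc (0:ℝ) 1, ∀ p : (Λ → ℝ) × (Λ → ℝ),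
      uu Q s (p.1 + p.2) + uu Q s (p.1 - p.2) - 2 * uu Q s p.1 - (1 - s * β)⁻¹ * (p.2 ⬝ᵥ p.2)
       - ε * Real.exp (θ * s) * (1 + p.1 ⬝ᵥ p.1) ≤ 0 := by
  set C : ℝ := ∑ i, (∑ x, |V i x|) ^ 2 with hC
  set C' : ℝ := ∑ i, V i ⬝ᵥ V i with hC'
  have hC0 : 0 ≤ C := Finset.sum_nonneg fun i _ => sq_nonneg _
  have hC'0 : 0 ≤ C' := Finset.sum_nonneg fun i _ => dot_self_nonneg' _
  refine ⟨C + C' + 3, ?_⟩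
  set θ := C + C' + 3 with hθ
  intro ε hε hεθ
  have hden : ∀ s ∈ Set.Icc (0:ℝ) 1, 0 < 1 - s * β := by
    intro s hs; nlinarith [hs.1, hs.2]
  have hKge : ∀ s ∈ Set.Icc (0:ℝ) 1, 1 ≤ (1 - s * β)⁻¹ := by
    intro s hs
    apply (one_le_inv₀ (hden s hs)).2
    nlinarith [hs.1]
  have hEge : ∀ s ∈ Set.Icc (0:ℝ) 1, ε ≤ ε * Real.exp (θ * s) := by
    intro s hs
    have : 1 ≤ Real.exp (θ * s) := Real.one_le_exp (mul_nonneg (by linarith) hs.1)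
    nlinarith
  have hEle : ∀ s ∈ Set.Icc (0:ℝ) 1, ε * Real.exp (θ * s) ≤ 1 := by
    intro s hs
    refine le_trans ?_ hεθ
    apply mul_le_mul_of_nonneg_left _ hε.le
    apply Real.exp_le_exp.2
    nlinarith [hs.2]
  set n : ℝ := (Fintype.card Λ : ℝ) with hn
  have hn0 : 0 ≤ n := Nat.cast_nonneg _
  refine max_principle (fun s (p : (Λ → ℝ) × (Λ → ℝ)) =>
      uu Q s (p.1 + p.2) + uu Q s (p.1 - p.2) - 2 * uu Q s p.1 - (1 - s * β)⁻¹ * (p.2 ⬝ᵥ p.2)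
       - ε * Real.exp (θ * s) * (1 + p.1 ⬝ᵥ p.1)) ?_ (2 + n + n / ε) ?_ ?_ ?_
  · exact mid_cont Q β ε θ hden
  · -- compactness
    rintro s hs ⟨y, z⟩ hpos
    simp only at hpos
    have l1 := uu_lip Q s y z
    have l2 := uu_lip Q s y (-z)
    rw [← sub_eq_add_neg] at l2
    simp only [Pi.neg_apply, abs_neg] at l2
    have hy0 := dot_self_nonneg' y
    have hz0 := dot_self_nonneg' z
    have k1 : z ⬝ᵥ z ≤ (1 - s * β)⁻¹ * (z ⬝ᵥ z) := by nlinarith [hKge s hs]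
    have k2 : ε * (y ⬝ᵥ y) ≤ ε * Real.exp (θ * s) * (1 + y ⬝ᵥ y) := by nlinarith [hEge s hs]
    have k3 : ∑ x, (|z x| - 1) ^ 2 + ε * (y ⬝ᵥ y) ≤ n := by
      have : ∑ x, (|z x| - 1) ^ 2 = z ⬝ᵥ z - 2 * ∑ x, |z x| + n := by
        unfold dotProduct
        rw [Finset.mul_sum, ← Finset.sum_sub_distrib]
        have : n = ∑ x : Λ, (1:ℝ) := by simp [hn]
        rw [this, ← Finset.sum_add_distrib]
        apply Finset.sum_congr rfl; intro x _
        nlinarith [sq_abs (z x)]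
      rw [this]; linarith
    have hne : 0 ≤ n / ε := by positivity
    rw [Prod.norm_def]
    apply max_le
    · refine (pi_norm_le_iff_of_nonneg (by positivity)).2 fun x => ?_
      have h1 : y x * y x ≤ y ⬝ᵥ y :=
        Finset.single_le_sum (f := fun x => y x * y x) (fun x _ => mul_self_nonneg _) (Finset.mem_univ x)
      have h2 : 0 ≤ ∑ x, (|z x| - 1) ^ 2 := Finset.sum_nonneg fun _ _ => sq_nonneg _
      have h3 : y ⬝ᵥ y ≤ n / ε := by rw [le_div_iff₀ hε]; linarith
      show |y x| ≤ _
      nlinarith [abs_mul_abs_self (y x), sq_nonneg (|y x| - 1)]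
    · refine (pi_norm_le_iff_of_nonneg (by positivity)).2 fun x => ?_
      have h1 : (|z x| - 1) ^ 2 ≤ ∑ x, (|z x| - 1) ^ 2 :=
        Finset.single_le_sum (f := fun x => (|z x| - 1) ^ 2) (fun x _ => sq_nonneg _) (Finset.mem_univ x)
      have h2 : 0 ≤ ε * (y ⬝ᵥ y) := by positivity
      show |z x| ≤ _
      nlinarith [sq_nonneg (|z x| - 2)]
  · rintro ⟨y, z⟩
    have := uu_zero_ineq Q y z
    have h1 : 0 ≤ ε * Real.exp (θ * 0) * (1 + y ⬝ᵥ y) := by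
      have := dot_self_nonneg' y; positivity
    simp only [zero_mul, sub_zero, inv_one, one_mul]
    linarith
  · rintro s ⟨hs0, hs1⟩ ⟨y, z⟩ - hmax
    have hs : s ∈ Set.Icc (0:ℝ) 1 := ⟨hs0.le, hs1⟩
    set E := ε * Real.exp (θ * s) with hE
    have hEpos : 0 < E := by positivity
    have hE1 : E ≤ 1 := hEle s hs
    set K := (1 - s * β)⁻¹ with hK
    have hmy : ∀ i, _ := fun i => max_y Q s y z (V i) E (fun r => by
      have := hmax (y + r • V i, z)
      simp only at this
      rw [show y + r • V i + z = y + z + r • V i by abel,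
        show y + r • V i - z = y - z + r • V i by abel] at this
      nlinarith)
    have hmz : ∀ i, _ := fun i => max_z Q s y z (V i) K (fun r => by
      have := hmax (y, z + r • V i)
      simp only at this
      rw [show y + (z + r • V i) = y + z + r • V i by abel,
        show y - (z + r • V i) = y - z - r • V i by abel] at this
      nlinarith)
    have hexp : HasDerivAt (fun s : ℝ => ε * Real.exp (θ * s) * (1 + y ⬝ᵥ y))
        (θ * E * (1 + y ⬝ᵥ y)) s := by
      have h1 : HasDerivAt (fun s : ℝ => θ * s) (θ * 1) s := (hasDerivAt_id s).const_mul θ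
      refine ((h1.exp.const_mul ε).mul_const _).congr_deriv ?_
      rw [hE]; ring
    have hder := ((((uu_time V Q hQ s (y + z)).fun_add (uu_time V Q hQ s (y - z))).fun_sub
      ((uu_time V Q hQ s y).const_mul 2)).fun_sub ((K_deriv β s (hden s hs)).mul_const (z ⬝ᵥ z))).fun_sub
      hexp
    refine ⟨_, ?_, hder⟩
    have hy0 := dot_self_nonneg' y
    have term : ∀ i, qq Q (V i) s (y + z) / 2 + qq Q (V i) s (y - z) / 2 - 2 * (qq Q (V i) s y / 2)
        ≤ E * (V i ⬝ᵥ V i) + E * (∑ x, |V i x|) ^ 2 + 2 * E * (V i ⬝ᵥ y) ^ 2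
          + K ^ 2 * (V i ⬝ᵥ z) ^ 2 := by
      intro i
      obtain ⟨a1, a2⟩ := hmy i
      have a3 := hmz i
      have hp : mm Q (V i) s (y + z) = mm Q (V i) s y + E * (V i ⬝ᵥ y) + K * (V i ⬝ᵥ z) := by linarith
      have hm : mm Q (V i) s (y - z) = mm Q (V i) s y + E * (V i ⬝ᵥ y) - K * (V i ⬝ᵥ z) := by linarith
      rw [hp, hm] at a2
      have hb : mm Q (V i) s y ^ 2 ≤ (∑ x, |V i x|) ^ 2 := by
        rw [← sq_abs]
        exact pow_le_pow_left₀ (abs_nonneg _) (mm_abs _ _ _ _) 2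
      have c1 : 2 * mm Q (V i) s y * (E * (V i ⬝ᵥ y)) ≤
          E * ((∑ x, |V i x|) ^ 2 + (V i ⬝ᵥ y) ^ 2) := by
        nlinarith [sq_nonneg (mm Q (V i) s y - (V i ⬝ᵥ y))]
      have c2 : (E * (V i ⬝ᵥ y)) ^ 2 ≤ E * (V i ⬝ᵥ y) ^ 2 := by
        have : E ^ 2 ≤ E := by nlinarith
        nlinarith [sq_nonneg (V i ⬝ᵥ y)]
      nlinarith
    have tot := Finset.sum_le_sum (s := Finset.univ) (fun i (_ : i ∈ Finset.univ) => term i)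
    simp only [Finset.sum_add_distrib, Finset.sum_sub_distrib, ← Finset.mul_sum] at tot
    rw [← hC, ← hC'] at tot
    have v1 := hV y
    have v2 := mul_le_mul_of_nonneg_left (hV z) (sq_nonneg K)
    have v3 : ∑ i, (V i ⬝ᵥ y) ^ 2 ≤ y ⬝ᵥ y := by nlinarith
    have v4 := mul_le_mul_of_nonneg_left v3 hEpos.le
    have v5 : 0 ≤ E * (C + C' + 1) * (y ⬝ᵥ y) := by positivity
    rw [hθ]
    nlinarith

theorem midpoint_ineq {ι : Type*} [Fintype ι] (V : ι → Λ → ℝ) (Q : (Λ → Bool) → ℝ)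
    (hQ : ∀ σ, Q σ = ∑ i, (V i ⬝ᵥ spin σ) ^ 2) (β : ℝ) (hβ0 : 0 < β) (hβ1 : β < 1)
    (hV : ∀ z, ∑ i, (V i ⬝ᵥ z) ^ 2 ≤ β * (z ⬝ᵥ z))
    (s : ℝ) (hs : s ∈ Set.Icc (0:ℝ) 1) (y z : Λ → ℝ) :
      uu Q s (y + z) + uu Q s (y - z) - 2 * uu Q s y ≤ (1 - s * β)⁻¹ * (z ⬝ᵥ z) := by
  obtain ⟨θ, hθ⟩ := midpoint_ineq_eps V Q hQ β hβ0 hβ1 hV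
  set D := Real.exp (θ * s) * (1 + y ⬝ᵥ y) with hD
  have hD0 : 0 < D := by have := dot_self_nonneg' y; positivity
  refine le_of_forall_pos_le_add fun δ hδ => ?_
  have hm : 0 < min (δ / D) (Real.exp (-θ)) := lt_min (by positivity) (Real.exp_pos _)
  have := hθ (min (δ / D) (Real.exp (-θ))) hm (by
    calc _ ≤ Real.exp (-θ) * Real.exp θ :=
          mul_le_mul_of_nonneg_right (min_le_right _ _) (Real.exp_pos _).le
      _ = 1 := by rw [← Real.exp_add]; simp) s hs (y, z)
  simp only [mul_assoc] at this
  rw [← hD] at this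
  have h2 : min (δ / D) (Real.exp (-θ)) * D ≤ δ := by
    calc _ ≤ δ / D * D := mul_le_mul_of_nonneg_right (min_le_left _ _) hD0.le
      _ = δ := by field_simp
  linarith

/-- variance bound -/
theorem var_le {ι : Type*} [Fintype ι] (V : ι → Λ → ℝ) (Q : (Λ → Bool) → ℝ)
    (hQ : ∀ σ, Q σ = ∑ i, (V i ⬝ᵥ spin σ) ^ 2) (β : ℝ) (hβ0 : 0 < β) (hβ1 : β < 1)
    (hV : ∀ z, ∑ i, (V i ⬝ᵥ z) ^ 2 ≤ β * (z ⬝ᵥ z))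
    (s : ℝ) (hs : s ∈ Set.Icc (0:ℝ) 1) (y v : Λ → ℝ) :
    qq Q v s y - mm Q v s y ^ 2 ≤ (1 - s * β)⁻¹ * (v ⬝ᵥ v) := by
  set K := (1 - s * β)⁻¹ with hK
  have key := second_deriv_test
    (fun r => uu Q s (y + (1 * r) • v) + uu Q s (y + (-1 * r) • v)
      - K * (0 + 0 * r + (v ⬝ᵥ v) * r ^ 2))
    (fun r => 1 * mm Q v s (y + (1 * r) • v) + -1 * mm Q v s (y + (-1 * r) • v)
      - K * (0 + 2 * (v ⬝ᵥ v) * r)) _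
    (fun r => (((uu_dir Q s y v 1 r).fun_add (uu_dir Q s y v (-1) r)).fun_sub
      ((quad_deriv _ _ _ r).const_mul K)))
    ((((mm_dir Q s y v 1 0).const_mul 1).fun_add ((mm_dir Q s y v (-1) 0).const_mul (-1))).fun_sub
      (((((hasDerivAt_id (0:ℝ)).const_mul (2 * (v ⬝ᵥ v)))).const_add 0).const_mul K))
    (fun r => by
      have := midpoint_ineq V Q hQ β hβ0 hβ1 hV s hs y (r • v)
      simp only [smul_dotProduct, dotProduct_smul, smul_eq_mul] at this
      simp [← sub_eq_add_neg]
      nlinarith)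
  have k2 := key.2
  simp at k2
  linarith

/-- quadratic upper bound of the log partition function -/
theorem uu_quad {ι : Type*} [Fintype ι] (V : ι → Λ → ℝ) (Q : (Λ → Bool) → ℝ)
    (hQ : ∀ σ, Q σ = ∑ i, (V i ⬝ᵥ spin σ) ^ 2) (β : ℝ) (hβ0 : 0 < β) (hβ1 : β < 1)
    (hV : ∀ z, ∑ i, (V i ⬝ᵥ z) ^ 2 ≤ β * (z ⬝ᵥ z))
    (s : ℝ) (hs : s ∈ Set.Icc (0:ℝ) 1) (y z : Λ → ℝ) :
    uu Q s (y + z) ≤ uu Q s y + mm Q z s y + (1 - s * β)⁻¹ * (z ⬝ᵥ z) / 2 := by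
  set K := (1 - s * β)⁻¹ with hK
  set a := K * (z ⬝ᵥ z) with ha
  -- first derivative bound
  have hB : AntitoneOn (fun r => mm Q z s (y + (1 * r) • z) - a * r) (Set.Icc 0 1) := by
    have hd : ∀ r : ℝ, HasDerivAt (fun r => mm Q z s (y + (1 * r) • z) - a * r)
        (1 * (qq Q z s (y + (1 * r) • z) - mm Q z s (y + (1 * r) • z) ^ 2) - a * 1) r :=
      fun r => (mm_dir Q s y z 1 r).fun_sub ((hasDerivAt_id r).const_mul a)
    apply antitoneOn_of_deriv_nonpos (convex_Icc _ _)
    · exact fun x _ => (hd x).continuousAt.continuousWithinAt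
    · exact fun x _ => (hd x).differentiableAt.differentiableWithinAt
    · intro r _
      rw [(hd r).deriv]
      have := var_le V Q hQ β hβ0 hβ1 hV s hs (y + (1 * r) • z) z
      linarith
  have hA : AntitoneOn (fun r => uu Q s (y + (1 * r) • z) - (0 + mm Q z s y * r + (a / 2) * r ^ 2))
      (Set.Icc 0 1) := by
    have hd : ∀ r : ℝ, HasDerivAt
        (fun r => uu Q s (y + (1 * r) • z) - (0 + mm Q z s y * r + (a / 2) * r ^ 2))
        (1 * mm Q z s (y + (1 * r) • z) - (mm Q z s y + 2 * (a / 2) * r)) r :=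
      fun r => (uu_dir Q s y z 1 r).fun_sub (quad_deriv _ _ _ r)
    apply antitoneOn_of_deriv_nonpos (convex_Icc _ _)
    · exact fun x _ => (hd x).continuousAt.continuousWithinAt
    · exact fun x _ => (hd x).differentiableAt.differentiableWithinAt
    · intro r hr
      rw [interior_Icc] at hr
      rw [(hd r).deriv]
      have := hB ⟨le_rfl, zero_le_one⟩ ⟨hr.1.le, hr.2.le⟩ hr.1.le
      simp only [mul_zero, zero_smul, add_zero, sub_zero] at this
      linarith
  have := hA ⟨le_rfl, zero_le_one⟩ ⟨zero_le_one, le_rfl⟩ zero_le_one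
  simp at this
  linarith

/-- unnormalised entropy -/
def PP (Q F : (Λ → Bool) → ℝ) (s : ℝ) (y : Λ → ℝ) : ℝ :=
  SS Q (fun σ => F σ * Real.log (F σ)) s y
    - SS Q F s y * (Real.log (SS Q F s y) - Real.log (SS Q (fun _ => 1) s y))

theorem gibbs_var (Q F : (Λ → Bool) → ℝ) (hF : ∀ σ, 0 < F σ) (s : ℝ) (y z : Λ → ℝ) :
    SS Q (fun σ => F σ * (z ⬝ᵥ spin σ)) s y - SS Q F s y * (uu Q s (y + z) - uu Q s y)
      ≤ PP Q F s y := by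
  have ha := SS_pos Q F hF s y
  have hU := one_pos' Q s (y + z)
  set a := SS Q F s y with hadef
  set U := SS Q (fun _ => 1) s (y + z) with hUdef
  have key : ∀ σ, Real.exp (s / 2 * Q σ + y ⬝ᵥ spin σ) * F σ
      - a / U * Real.exp (s / 2 * Q σ + (y + z) ⬝ᵥ spin σ) ≤
      F σ * Real.log (F σ) * Real.exp (s / 2 * Q σ + y ⬝ᵥ spin σ)
       - (F σ * (z ⬝ᵥ spin σ)) * Real.exp (s / 2 * Q σ + y ⬝ᵥ spin σ)
       - F σ * Real.exp (s / 2 * Q σ + y ⬝ᵥ spin σ) * (Real.log a - Real.log U) := by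
    intro σ
    have h := xlog_ge (F σ) (a / U * Real.exp (z ⬝ᵥ spin σ)) (hF σ).le (by positivity)
    rw [Real.log_mul (by positivity) (Real.exp_pos _).ne', Real.log_exp,
      Real.log_div ha.ne' hU.ne'] at h
    have h2 := mul_le_mul_of_nonneg_left h (Real.exp_pos (s / 2 * Q σ + y ⬝ᵥ spin σ)).le
    rw [add_dotProduct, ← add_assoc, Real.exp_add _ (z ⬝ᵥ spin σ)]
    nlinarith
  have tot := Finset.sum_le_sum (s := Finset.univ) (fun σ (_ : σ ∈ Finset.univ) => key σ)
  simp only [Finset.sum_sub_distrib, ← Finset.mul_sum, ← Finset.sum_mul] at tot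
  have e1 : ∑ σ : Λ → Bool, Real.exp (s / 2 * Q σ + y ⬝ᵥ spin σ) * F σ = a := by
    rw [hadef]; unfold SS; simp only [mul_comm]
  have e2 : ∑ σ : Λ → Bool, Real.exp (s / 2 * Q σ + (y + z) ⬝ᵥ spin σ) = U := by
    rw [hUdef]; unfold SS; simp only [one_mul]
  rw [e1, e2, div_mul_cancel₀ _ hU.ne', sub_self] at tot
  unfold PP uu
  change 0 ≤ SS Q (fun σ => F σ * Real.log (F σ)) s y - SS Q (fun σ => F σ * (z ⬝ᵥ spin σ)) s y
    - SS Q F s y * _ at tot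
  rw [← hadef, ← hUdef] at *
  linarith

theorem SS_dot (Q F : (Λ → Bool) → ℝ) (s : ℝ) (y v : Λ → ℝ) :
    SS Q (fun σ => F σ * (v ⬝ᵥ spin σ)) s y = v ⬝ᵥ (fun x => SS Q (fun σ => F σ * spin σ x) s y) := by
  have : (fun σ => F σ * (v ⬝ᵥ spin σ)) = fun σ => ∑ x, v x * (F σ * spin σ x) := by
    funext σ; unfold dotProduct; rw [Finset.mul_sum]
    apply Finset.sum_congr rfl; intro x _; ring
  rw [this, SS_sum]; rfl

/-- entropic stability -/
theorem stability {ι : Type*} [Fintype ι] (V : ι → Λ → ℝ) (Q : (Λ → Bool) → ℝ)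
    (hQ : ∀ σ, Q σ = ∑ i, (V i ⬝ᵥ spin σ) ^ 2) (β : ℝ) (hβ0 : 0 < β) (hβ1 : β < 1)
    (hV : ∀ z, ∑ i, (V i ⬝ᵥ z) ^ 2 ≤ β * (z ⬝ᵥ z))
    (s : ℝ) (hs : s ∈ Set.Icc (0:ℝ) 1) (y : Λ → ℝ) (F : (Λ → Bool) → ℝ) (hF : ∀ σ, 0 < F σ) :
    SS Q F s y * ∑ i, (SS Q (fun σ => F σ * (V i ⬝ᵥ spin σ)) s y / SS Q F s y - mm Q (V i) s y) ^ 2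
      ≤ 2 * β * (1 - s * β)⁻¹ * PP Q F s y := by
  set K := (1 - s * β)⁻¹ with hK
  have hK0 : 0 < K := inv_pos.2 (by nlinarith [hs.1, hs.2])
  have ha := SS_pos Q F hF s y
  have hb := one_pos' Q s y
  set Δ : Λ → ℝ := fun x => SS Q (fun σ => F σ * spin σ x) s y / SS Q F s y
    - SS Q (fun σ => 1 * spin σ x) s y / SS Q (fun _ => 1) s y with hΔ
  have hdot : ∀ v : Λ → ℝ, v ⬝ᵥ Δ =
      SS Q (fun σ => F σ * (v ⬝ᵥ spin σ)) s y / SS Q F s y - mm Q v s y := by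
    intro v
    have h1 : mm Q v s y = SS Q (fun σ => 1 * (v ⬝ᵥ spin σ)) s y / SS Q (fun _ => 1) s y := by
      simp only [mm, one_mul]
    rw [h1, SS_dot Q F, SS_dot Q (fun _ => 1)]
    simp only [dotProduct, Finset.sum_div, ← Finset.sum_sub_distrib, hΔ]
    apply Finset.sum_congr rfl; intro x _; ring
  simp only [← hdot]
  have g := gibbs_var Q F hF s y (K⁻¹ • Δ)
  have q := uu_quad V Q hQ β hβ0 hβ1 hV s hs y (K⁻¹ • Δ)
  have d := hdot (K⁻¹ • Δ)
  have e1 : SS Q (fun σ => F σ * ((K⁻¹ • Δ) ⬝ᵥ spin σ)) s y =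
      SS Q F s y * ((K⁻¹ • Δ) ⬝ᵥ Δ + mm Q (K⁻¹ • Δ) s y) := by
    rw [d]; field_simp; ring
  rw [e1] at g
  rw [← hK] at q
  simp only [smul_dotProduct, dotProduct_smul, smul_eq_mul] at g q
  have e2 : K * (K⁻¹ * (K⁻¹ * (Δ ⬝ᵥ Δ))) / 2 = K⁻¹ * (Δ ⬝ᵥ Δ) / 2 := by field_simp
  rw [e2] at q
  have q2 := mul_le_mul_of_nonneg_left q ha.le
  have g2 : SS Q F s y * (K⁻¹ * (Δ ⬝ᵥ Δ) / 2) ≤ PP Q F s y := by nlinarith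
  have g3 := mul_le_mul_of_nonneg_left g2 (show 0 ≤ 2 * β * K by positivity)
  have e3 : 2 * β * K * (SS Q F s y * (K⁻¹ * (Δ ⬝ᵥ Δ) / 2)) = SS Q F s y * (β * (Δ ⬝ᵥ Δ)) := by
    field_simp
  rw [e3] at g3
  exact (mul_le_mul_of_nonneg_left (hV Δ) ha.le).trans g3

theorem PP_continuous (Q F : (Λ → Bool) → ℝ) (hF : ∀ σ, 0 < F σ) :
    Continuous (fun p : ℝ × (Λ → ℝ) => PP Q F p.1 p.2) := by
  unfold PP
  exact (SS_continuous Q _).sub ((SS_continuous Q F).mul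
    (((SS_continuous Q F).log (fun p => (SS_pos Q F hF p.1 p.2).ne')).sub (uu_continuous Q)))

theorem PP_le (Q F : (Λ → Bool) → ℝ) (hF : ∀ σ, 0 < F σ) (s : ℝ) (y : Λ → ℝ) :
    PP Q F s y ≤ SS Q (fun σ => F σ * Real.log (F σ) - F σ + 1) s y := by
  have h := xlog_ge (SS Q F s y) (SS Q (fun _ => 1) s y) (SS_pos Q F hF s y).le (one_pos' Q s y)
  have e : SS Q (fun σ => F σ * Real.log (F σ) - F σ + 1) s y =
      SS Q (fun σ => F σ * Real.log (F σ)) s y - SS Q F s y + SS Q (fun _ => 1) s y := by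
    unfold SS; simp only [add_mul, sub_mul, Finset.sum_add_distrib, Finset.sum_sub_distrib]
  rw [e]; unfold PP; linarith

theorem PP_time (Q F : (Λ → Bool) → ℝ) (hF : ∀ σ, 0 < F σ) (s : ℝ) (y : Λ → ℝ) :
    HasDerivAt (fun s => PP Q F s y)
      (SS Q (fun σ => F σ * Real.log (F σ) * (Q σ / 2)) s y
        - SS Q (fun σ => F σ * (Q σ / 2)) s y *
          (Real.log (SS Q F s y) - Real.log (SS Q (fun _ => 1) s y) + 1)
        + SS Q F s y / SS Q (fun _ => 1) s y * SS Q (fun σ => 1 * (Q σ / 2)) s y) s := by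
  have ha := (SS_pos Q F hF s y).ne'
  have hb := (one_pos' Q s y).ne'
  have h1 := SS_hasDerivAt_time Q F s y
  refine ((SS_hasDerivAt_time Q _ s y).fun_sub (h1.fun_mul ((h1.log ha).fun_sub
    ((SS_hasDerivAt_time Q (fun _ => 1) s y).log hb)))).congr_deriv ?_
  field_simp
  ring

/-- first derivative of `PP` in direction `v`. -/
def PP1 (Q F : (Λ → Bool) → ℝ) (v : Λ → ℝ) (s : ℝ) (y : Λ → ℝ) : ℝ :=
  SS Q (fun σ => F σ * Real.log (F σ) * (v ⬝ᵥ spin σ)) s y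
        - SS Q (fun σ => F σ * (v ⬝ᵥ spin σ)) s y *
          (Real.log (SS Q F s y) - Real.log (SS Q (fun _ => 1) s y) + 1)
        + SS Q F s y / SS Q (fun _ => 1) s y * SS Q (fun σ => 1 * (v ⬝ᵥ spin σ)) s y

theorem PP_dir (Q F : (Λ → Bool) → ℝ) (hF : ∀ σ, 0 < F σ) (s : ℝ) (y v : Λ → ℝ) (r : ℝ) :
    HasDerivAt (fun r : ℝ => PP Q F s (y + (1 * r) • v)) (PP1 Q F v s (y + (1 * r) • v)) r := by
  have ha := (SS_pos Q F hF s (y + (1 * r) • v)).ne'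
  have hb := (one_pos' Q s (y + (1 * r) • v)).ne'
  have h1 := SS_hasDerivAt_dir Q F s y v 1 r
  refine ((SS_hasDerivAt_dir Q _ s y v 1 r).fun_sub (h1.fun_mul ((h1.log ha).fun_sub
    ((SS_hasDerivAt_dir Q (fun _ => 1) s y v 1 r).log hb)))).congr_deriv ?_
  unfold PP1
  generalize y + (1 * r) • v = w at *
  field_simp
  ring

theorem PP1_dir (Q F : (Λ → Bool) → ℝ) (hF : ∀ σ, 0 < F σ) (s : ℝ) (y v : Λ → ℝ) (r : ℝ) :
    HasDerivAt (fun r : ℝ => PP1 Q F v s (y + (1 * r) • v))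
      (SS Q (fun σ => F σ * Real.log (F σ) * (v ⬝ᵥ spin σ) * (v ⬝ᵥ spin σ)) s (y + (1 * r) • v)
        - SS Q (fun σ => F σ * (v ⬝ᵥ spin σ) * (v ⬝ᵥ spin σ)) s (y + (1 * r) • v) *
          (Real.log (SS Q F s (y + (1 * r) • v))
            - Real.log (SS Q (fun _ => 1) s (y + (1 * r) • v)) + 1)
        + SS Q F s (y + (1 * r) • v) / SS Q (fun _ => 1) s (y + (1 * r) • v) *
          SS Q (fun σ => 1 * (v ⬝ᵥ spin σ) * (v ⬝ᵥ spin σ)) s (y + (1 * r) • v)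
        - SS Q F s (y + (1 * r) • v) *
          (SS Q (fun σ => F σ * (v ⬝ᵥ spin σ)) s (y + (1 * r) • v) / SS Q F s (y + (1 * r) • v)
            - mm Q v s (y + (1 * r) • v)) ^ 2) r := by
  have ha := (SS_pos Q F hF s (y + (1 * r) • v)).ne'
  have hb := (one_pos' Q s (y + (1 * r) • v)).ne'
  have h1 := SS_hasDerivAt_dir Q F s y v 1 r
  have h2 := SS_hasDerivAt_dir Q (fun _ => 1) s y v 1 r
  refine (((SS_hasDerivAt_dir Q _ s y v 1 r).fun_sub
    ((SS_hasDerivAt_dir Q (fun σ => F σ * (v ⬝ᵥ spin σ)) s y v 1 r).fun_mul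
    (((h1.log ha).fun_sub (h2.log hb)).add_const 1))).fun_add
    ((h1.fun_div h2 hb).fun_mul
      (SS_hasDerivAt_dir Q (fun σ => 1 * (v ⬝ᵥ spin σ)) s y v 1 r))).congr_deriv ?_
  simp only [mm, one_mul] at *
  generalize y + r • v = w at *
  field_simp
  ring

/-- sum over directions of the second-moment sums -/
theorem SS_trace {ι : Type*} [Fintype ι] (V : ι → Λ → ℝ) (Q : (Λ → Bool) → ℝ)
    (hQ : ∀ σ, Q σ = ∑ i, (V i ⬝ᵥ spin σ) ^ 2) (Q' c : (Λ → Bool) → ℝ) (s : ℝ) (y : Λ → ℝ) :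
    ∑ i, SS Q' (fun σ => c σ * (V i ⬝ᵥ spin σ) * (V i ⬝ᵥ spin σ)) s y
      = 2 * SS Q' (fun σ => c σ * (Q σ / 2)) s y := by
  have : (fun σ => c σ * (Q σ / 2)) =
      fun σ => ∑ i, (1/2) * (c σ * (V i ⬝ᵥ spin σ) * (V i ⬝ᵥ spin σ)) := by
    funext σ; rw [hQ, Finset.sum_div, Finset.mul_sum]
    apply Finset.sum_congr rfl; intro i _; ring
  rw [this, SS_sum, ← Finset.mul_sum]; ring

/-- carré-du-champ of the Dirichlet form -/
def dd (g : (Λ → Bool) → ℝ) (σ : Λ → Bool) : ℝ := 1 / 2 * ∑ x, (g (spinFlip x σ) - g σ) ^ 2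

theorem dd_nonneg (g : (Λ → Bool) → ℝ) (σ : Λ → Bool) : 0 ≤ dd g σ :=
  mul_nonneg (by norm_num) (Finset.sum_nonneg fun _ _ => sq_nonneg _)

theorem dirichlet_norm (w g : (Λ → Bool) → ℝ) (Z : ℝ) :
    dirichlet (fun σ => w σ / Z) g = (∑ σ, dd g σ * w σ) / Z := by
  unfold dirichlet dd
  rw [Finset.sum_comm, Finset.mul_sum, Finset.sum_div]
  apply Finset.sum_congr rfl; intro σ _
  rw [← Finset.mul_sum]; ring

theorem fent_norm (w F : (Λ → Bool) → ℝ) (Z : ℝ) (hZ : 0 < Z) (hp : 0 < ∑ σ, F σ * w σ) :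
    fent (fun σ => w σ / Z) F = ((∑ σ, F σ * Real.log (F σ) * w σ)
      - (∑ σ, F σ * w σ) * (Real.log (∑ σ, F σ * w σ) - Real.log Z)) / Z := by
  unfold fent
  have e1 : ∑ σ, w σ / Z * (F σ * Real.log (F σ)) = (∑ σ, F σ * Real.log (F σ) * w σ) / Z := by
    rw [Finset.sum_div]; apply Finset.sum_congr rfl; intro σ _; ring
  have e2 : ∑ σ, w σ / Z * F σ = (∑ σ, F σ * w σ) / Z := by
    rw [Finset.sum_div]; apply Finset.sum_congr rfl; intro σ _; ring
  rw [e1, e2, Real.log_div hp.ne' hZ.ne']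
  ring

theorem base_case (Q F : (Λ → Bool) → ℝ) (hF : ∀ σ, 0 < F σ) (y : Λ → ℝ) :
    PP Q F 0 y ≤ SS Q (dd (fun σ => Real.sqrt (F σ))) 0 y := by
  have hc : ∀ x, 0 < 2 * Real.cosh (y x) := fun x => by have := Real.cosh_pos (y x); positivity
  have key := product_lsi (fun x b => Real.exp (if b then y x else - y x) / (2 * Real.cosh (y x)))
    (fun x b => by have := hc x; positivity)
    (fun x => by
      have := (hc x).ne'
      simp only [if_true, Bool.false_eq_true, if_false]
      rw [← add_div, div_eq_one_iff_eq this, Real.cosh_eq]; ring) (fun σ => Real.sqrt (F σ))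
  have hZ : 0 < ∏ x, (2 * Real.cosh (y x)) := Finset.prod_pos fun x _ => hc x
  have e1 : (fun σ : Λ → Bool => ∏ x, (Real.exp (if σ x then y x else - y x) / (2 * Real.cosh (y x))))
      = fun σ => Real.exp (y ⬝ᵥ spin σ) / ∏ x, (2 * Real.cosh (y x)) := by
    funext σ; rw [Finset.prod_div_distrib, exp_dot_spin]
  have e2 : (fun σ => Real.sqrt (F σ) ^ 2) = F := funext fun σ => Real.sq_sqrt (hF σ).le
  have e3 : ∀ c : (Λ → Bool) → ℝ, ∑ σ, c σ * Real.exp (y ⬝ᵥ spin σ) = SS Q c 0 y := by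
    intro c; unfold SS; simp
  rw [e1, e2, dirichlet_norm, fent_norm _ _ _ hZ (by rw [e3]; exact SS_pos Q F hF 0 y), e3, e3, e3] at key
  rw [div_le_div_iff_of_pos_right hZ, ← SS_zero Q] at key
  exact key

theorem spin_dot_self (σ : Λ → Bool) : spin σ ⬝ᵥ spin σ = Fintype.card Λ := by
  unfold dotProduct
  have : ∀ x, spin σ x * spin σ x = 1 := by
    intro x; rw [← abs_mul_abs_self, spin_abs]; norm_num
  simp [this]

theorem main_cont (Q F D : (Λ → Bool) → ℝ) (hF : ∀ σ, 0 < F σ) (β ε θ : ℝ)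
    (hden : ∀ s ∈ Set.Icc (0:ℝ) 1, 0 < 1 - s * β) :
    ContinuousOn (fun q : ℝ × (Λ → ℝ) =>
      Real.exp (-θ * q.1) * (PP Q F q.1 q.2 - (1 - q.1 * β)⁻¹ * SS Q D q.1 q.2)
        - ε * SS 0 (fun _ => 1) 0 ((2:ℝ) • q.2)) (Set.Icc 0 1 ×ˢ Set.univ) := by
  have c1 : Continuous (fun q : ℝ × (Λ → ℝ) => Real.exp (-θ * q.1)) := by fun_prop
  have c2 := PP_continuous Q F hF
  have c3 := SS_continuous Q D
  have c4 : ContinuousOn (fun q : ℝ × (Λ → ℝ) => (1 - q.1 * β)⁻¹)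
      (Set.Icc 0 1 ×ˢ Set.univ) := by
    apply ContinuousOn.inv₀
    · fun_prop
    · intro q hq; exact (hden q.1 hq.1).ne'
  have c5 : Continuous (fun q : ℝ × (Λ → ℝ) =>
      SS (0 : (Λ → Bool) → ℝ) (fun _ => 1) 0 ((2:ℝ) • q.2)) := by
    unfold SS dotProduct; fun_prop
  exact (c1.continuousOn.mul (c2.continuousOn.sub (c4.mul c3.continuousOn))).sub
    (c5.const_mul ε).continuousOn

/-- second order condition at a spatial maximum -/
theorem max_main (Q F D : (Λ → Bool) → ℝ) (hF : ∀ σ, 0 < F σ) (s : ℝ) (y v : Λ → ℝ) (T K ε : ℝ)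
    (hmax : ∀ y' : Λ → ℝ, T * (PP Q F s y' - K * SS Q D s y')
        - ε * SS 0 (fun _ => 1) 0 ((2:ℝ) • y') ≤ T * (PP Q F s y - K * SS Q D s y)
        - ε * SS 0 (fun _ => 1) 0 ((2:ℝ) • y)) :
    T * ((SS Q (fun σ => F σ * Real.log (F σ) * (v ⬝ᵥ spin σ) * (v ⬝ᵥ spin σ)) s y
        - SS Q (fun σ => F σ * (v ⬝ᵥ spin σ) * (v ⬝ᵥ spin σ)) s y *
          (Real.log (SS Q F s y) - Real.log (SS Q (fun _ => 1) s y) + 1)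
        + SS Q F s y / SS Q (fun _ => 1) s y *
          SS Q (fun σ => 1 * (v ⬝ᵥ spin σ) * (v ⬝ᵥ spin σ)) s y
        - SS Q F s y * (SS Q (fun σ => F σ * (v ⬝ᵥ spin σ)) s y / SS Q F s y - mm Q v s y) ^ 2)
      - K * SS Q (fun σ => D σ * (v ⬝ᵥ spin σ) * (v ⬝ᵥ spin σ)) s y)
      ≤ 4 * ε * SS 0 (fun σ => 1 * (v ⬝ᵥ spin σ) * (v ⬝ᵥ spin σ)) 0 ((2:ℝ) • y) := by
  have key := second_deriv_test
    (fun r => T * (PP Q F s (y + (1 * r) • v) - K * SS Q D s (y + (1 * r) • v))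
        - ε * SS 0 (fun _ => 1) 0 ((2:ℝ) • y + (2 * r) • v)) _ _
    (fun r => (((PP_dir Q F hF s y v r).fun_sub ((SS_hasDerivAt_dir Q D s y v 1 r).const_mul K)).const_mul
      T).fun_sub ((SS_hasDerivAt_dir 0 (fun _ => 1) 0 ((2:ℝ) • y) v 2 r).const_mul ε))
    ((((PP1_dir Q F hF s y v 0).fun_sub
      (((SS_hasDerivAt_dir Q _ s y v 1 0).const_mul 1).const_mul K)).const_mul T).fun_sub
      (((SS_hasDerivAt_dir 0 _ 0 ((2:ℝ) • y) v 2 0).const_mul 2).const_mul ε))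
    (fun r => by
      have := hmax (y + r • v)
      rw [smul_add, smul_smul] at this
      simpa using this)
  have k2 := key.2
  simp only [mul_zero, zero_smul, add_zero, one_mul] at k2 ⊢
  linarith

theorem main_compact (Q F D : (Λ → Bool) → ℝ) (hF : ∀ σ, 0 < F σ) (hQ0 : ∀ σ, 0 ≤ Q σ)
    (hD : ∀ σ, 0 ≤ D σ) (β ε θ : ℝ) (hθ : 0 ≤ θ) (hε : 0 < ε)
    (hden : ∀ s ∈ Set.Icc (0:ℝ) 1, 0 < 1 - s * β) :
    ∃ R : ℝ, ∀ s ∈ Set.Icc (0:ℝ) 1, ∀ y : Λ → ℝ,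
      0 < Real.exp (-θ * s) * (PP Q F s y - (1 - s * β)⁻¹ * SS Q D s y)
        - ε * SS 0 (fun _ => 1) 0 ((2:ℝ) • y) → ‖y‖ ≤ R := by
  set q : (Λ → Bool) → ℝ := fun σ => F σ * Real.log (F σ) - F σ + 1 with hq
  have hq0 : ∀ σ, 0 ≤ q σ := by
    intro σ
    have := xlog_ge (F σ) 1 (hF σ).le one_pos
    simp only [Real.log_one, mul_zero, sub_zero] at this
    simp only [hq]; linarith
  set C : ℝ := ∑ σ, q σ * Real.exp (Q σ / 2) with hC
  have hC0 : 0 ≤ C := Finset.sum_nonneg fun σ _ => mul_nonneg (hq0 σ) (Real.exp_pos _).le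
  set N : ℝ := (Fintype.card (Λ → Bool) : ℝ) with hN
  have hN0 : 0 ≤ N := Nat.cast_nonneg _
  set L : ℝ := C ^ 2 / (4 * ε) with hL
  have hL0 : 0 ≤ L := by positivity
  refine ⟨C / ε + N * L / ε + 1, ?_⟩
  intro s hs y hpos
  have h1 : PP Q F s y - (1 - s * β)⁻¹ * SS Q D s y ≤ SS Q q s y := by
    have a1 := PP_le Q F hF s y
    have a2 : 0 ≤ (1 - s * β)⁻¹ * SS Q D s y :=
      mul_nonneg (inv_nonneg.2 (hden s hs).le) (SS_nonneg Q D hD s y)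
    linarith
  have h2 : Real.exp (-θ * s) * (PP Q F s y - (1 - s * β)⁻¹ * SS Q D s y) ≤ SS Q q s y := by
    have a1 : Real.exp (-θ * s) ≤ 1 := Real.exp_le_one_iff.2 (by nlinarith [hs.1])
    have a2 := SS_nonneg Q q hq0 s y
    have a3 := mul_le_mul_of_nonneg_left h1 (Real.exp_pos (-θ * s)).le
    nlinarith
  have h3 : SS Q q s y ≤ ∑ σ : Λ → Bool, C * Real.exp (y ⬝ᵥ spin σ) := by
    apply Finset.sum_le_sum; intro σ _
    rw [Real.exp_add, ← mul_assoc]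
    apply mul_le_mul_of_nonneg_right _ (Real.exp_pos _).le
    calc q σ * Real.exp (s / 2 * Q σ) ≤ q σ * Real.exp (Q σ / 2) := by
          apply mul_le_mul_of_nonneg_left _ (hq0 σ)
          apply Real.exp_le_exp.2; nlinarith [hs.2, hQ0 σ]
      _ ≤ C := Finset.single_le_sum (f := fun σ => q σ * Real.exp (Q σ / 2))
          (fun σ _ => mul_nonneg (hq0 σ) (Real.exp_pos _).le) (Finset.mem_univ σ)
  have h4 : SS (0 : (Λ → Bool) → ℝ) (fun _ => 1) 0 ((2:ℝ) • y) =
      ∑ σ : Λ → Bool, Real.exp (y ⬝ᵥ spin σ) ^ 2 := by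
    unfold SS; apply Finset.sum_congr rfl; intro σ _
    rw [← Real.exp_nat_mul]; simp [smul_dotProduct]
  rw [h4] at hpos
  have h5 : 0 < ∑ σ : Λ → Bool, (C * Real.exp (y ⬝ᵥ spin σ) - ε * Real.exp (y ⬝ᵥ spin σ) ^ 2) := by
    rw [Finset.sum_sub_distrib, ← Finset.mul_sum (f := fun σ => Real.exp (y ⬝ᵥ spin σ) ^ 2)]; linarith
  have h6 : ∀ t : ℝ, C * t - ε * t ^ 2 ≤ L := by
    intro t
    rw [hL, le_div_iff₀ (by positivity)]
    nlinarith [sq_nonneg (2 * ε * t - C)]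
  set τ : Λ → Bool := fun x => decide (0 ≤ y x) with hτ
  have hτy : y ⬝ᵥ spin τ = ∑ x, |y x| := by
    unfold dotProduct; apply Finset.sum_congr rfl; intro x _
    simp only [spin, hτ, decide_eq_true_eq]
    split_ifs with h
    · rw [abs_of_nonneg h, mul_one]
    · rw [abs_of_neg (not_le.1 h)]; ring
  set t := Real.exp (y ⬝ᵥ spin τ) with ht
  have h7 : ∑ σ : Λ → Bool, (C * Real.exp (y ⬝ᵥ spin σ) - ε * Real.exp (y ⬝ᵥ spin σ) ^ 2)
      ≤ (C * t - ε * t ^ 2) + N * L := by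
    rw [← Finset.add_sum_erase _ _ (Finset.mem_univ τ)]
    gcongr
    refine (Finset.sum_le_card_nsmul _ _ L fun σ _ => h6 _).trans ?_
    rw [nsmul_eq_mul]
    apply mul_le_mul_of_nonneg_right _ hL0
    rw [hN]; exact_mod_cast Finset.card_le_univ _
  have h8 : t ≤ C / ε + N * L / ε + 1 := by
    by_contra! hlt
    have hR : 0 ≤ C / ε + N * L / ε := by positivity
    have ht1 : 1 ≤ t := by linarith
    have e : ε * (C / ε + N * L / ε + 1) = C + N * L + ε := by field_simp
    have : C + N * L + ε ≤ ε * t := by rw [← e]; exact mul_le_mul_of_nonneg_left hlt.le hε.le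
    have : (C + N * L + ε) * t ≤ ε * t * t := mul_le_mul_of_nonneg_right this (by linarith)
    have h9 : N * L ≤ N * L * t := le_mul_of_one_le_right (by positivity) ht1
    nlinarith
  refine (pi_norm_le_iff_of_nonneg (by positivity)).2 fun x => ?_
  have h10 : |y x| ≤ ∑ x, |y x| :=
    Finset.single_le_sum (f := fun x => |y x|) (fun x _ => abs_nonneg _) (Finset.mem_univ x)
  have h11 := Real.add_one_le_exp (y ⬝ᵥ spin τ)
  rw [hτy] at h11
  rw [ht, hτy] at h8
  show |y x| ≤ _
  linarith

set_option maxHeartbeats 1000000 in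
theorem main_eps {ι : Type*} [Fintype ι] (V : ι → Λ → ℝ) (Q : (Λ → Bool) → ℝ)
    (hQ : ∀ σ, Q σ = ∑ i, (V i ⬝ᵥ spin σ) ^ 2) (β : ℝ) (hβ0 : 0 < β) (hβ1 : β < 1)
    (hV : ∀ z, ∑ i, (V i ⬝ᵥ z) ^ 2 ≤ β * (z ⬝ᵥ z)) (F : (Λ → Bool) → ℝ) (hF : ∀ σ, 0 < F σ)
    (D : (Λ → Bool) → ℝ) (hD : ∀ σ, 0 ≤ D σ) (hbase : ∀ y, PP Q F 0 y ≤ SS Q D 0 y) :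
    ∃ θ : ℝ, ∀ ε : ℝ, 0 < ε → ∀ s ∈ Set.Icc (0:ℝ) 1, ∀ y : Λ → ℝ,
      Real.exp (-θ * s) * (PP Q F s y - (1 - s * β)⁻¹ * SS Q D s y)
        - ε * SS 0 (fun _ => 1) 0 ((2:ℝ) • y) ≤ 0 := by
  set n : ℝ := (Fintype.card Λ : ℝ) with hn
  have hn0 : 0 ≤ n := Nat.cast_nonneg _
  have h1β : 0 < 1 - β := by linarith
  set θ : ℝ := β * (1 - β)⁻¹ + 2 * n + 1 with hθ
  have hθ0 : 0 ≤ θ := by positivity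
  have hden : ∀ s ∈ Set.Icc (0:ℝ) 1, 0 < 1 - s * β := by
    intro s hs; nlinarith [hs.1, hs.2]
  have hQ0 : ∀ σ, 0 ≤ Q σ := fun σ => by rw [hQ]; exact Finset.sum_nonneg fun i _ => sq_nonneg _
  have hQn : ∀ σ, Q σ ≤ n := by
    intro σ
    have := hV (spin σ)
    rw [spin_dot_self, ← hQ, ← hn] at this
    nlinarith
  refine ⟨θ, fun ε hε => ?_⟩
  obtain ⟨R, hR⟩ := main_compact Q F D hF hQ0 hD β ε θ hθ0 hε hden
  refine max_principle (fun s (y : Λ → ℝ) =>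
      Real.exp (-θ * s) * (PP Q F s y - (1 - s * β)⁻¹ * SS Q D s y)
        - ε * SS 0 (fun _ => 1) 0 ((2:ℝ) • y)) (main_cont Q F D hF β ε θ hden) R hR ?_ ?_
  · intro y
    have := hbase y
    have h2 := mul_pos hε (one_pos' (0 : (Λ → Bool) → ℝ) 0 ((2:ℝ) • y))
    simp only [mul_zero, Real.exp_zero, one_mul, zero_mul, sub_zero, inv_one]
    linarith
  · rintro s ⟨hs0, hs1⟩ y hpos hmax
    have hs : s ∈ Set.Icc (0:ℝ) 1 := ⟨hs0.le, hs1⟩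
    have hexp : HasDerivAt (fun s : ℝ => Real.exp (-θ * s)) (Real.exp (-θ * s) * (-θ * 1)) s :=
      ((hasDerivAt_id s).const_mul (-θ)).exp
    have hder := (hexp.fun_mul ((PP_time Q F hF s y).fun_sub
      ((K_deriv β s (hden s hs)).fun_mul (SS_hasDerivAt_time Q D s y)))).sub_const
      (ε * SS 0 (fun _ => 1) 0 ((2:ℝ) • y))
    refine ⟨_, ?_, hder⟩
    have hKle : (1 - s * β)⁻¹ ≤ (1 - β)⁻¹ := by
      apply inv_anti₀ h1β; nlinarith
    have hst := stability V Q hQ β hβ0 hβ1 hV s hs y F hF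
    set T := Real.exp (-θ * s) with hT
    have hT0 : 0 < T := Real.exp_pos _
    set K := (1 - s * β)⁻¹ with hK
    have hm := fun i => max_main Q F D hF s y (V i) T K ε hmax
    have tot := Finset.sum_le_sum (s := Finset.univ) (fun i (_ : i ∈ Finset.univ) => hm i)
    simp only [Finset.sum_add_distrib, Finset.sum_sub_distrib, ← Finset.mul_sum,
      ← Finset.sum_mul] at tot
    rw [SS_trace V Q hQ Q F, SS_trace V Q hQ Q D, SS_trace V Q hQ Q (fun _ => 1),
      SS_trace V Q hQ 0 (fun _ => 1), SS_trace V Q hQ Q (fun σ => F σ * Real.log (F σ))] at tot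
    have hB : SS (0 : (Λ → Bool) → ℝ) (fun σ => 1 * (Q σ / 2)) 0 ((2:ℝ) • y) ≤
        n / 2 * SS (0 : (Λ → Bool) → ℝ) (fun _ => 1) 0 ((2:ℝ) • y) := by
      unfold SS
      rw [Finset.mul_sum]
      apply Finset.sum_le_sum; intro σ _
      rw [← mul_assoc]
      apply mul_le_mul_of_nonneg_right _ (Real.exp_pos _).le
      linarith [hQn σ]
    have hBp := one_pos' (0 : (Λ → Bool) → ℝ) 0 ((2:ℝ) • y)
    set B := SS (0 : (Λ → Bool) → ℝ) (fun _ => 1) 0 ((2:ℝ) • y) with hBdef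
    have hst2 := mul_le_mul_of_nonneg_left hst hT0.le
    have hεB := mul_pos hε hBp
    have hB2 := mul_le_mul_of_nonneg_left hB hε.le
    set P := PP Q F s y
    set G := SS Q D s y
    have hW : 0 < T * (P - K * G) := by linarith
    have hk : (θ - β * K) * (ε * B) ≤ (θ - β * K) * (T * (P - K * G)) := by
      apply mul_le_mul_of_nonneg_left (by linarith)
      have := mul_le_mul_of_nonneg_left hKle hβ0.le
      rw [hθ]; linarith
    have hk2 : (2 * n + 1) * (ε * B) ≤ (θ - β * K) * (ε * B) := by
      apply mul_le_mul_of_nonneg_right _ hεB.le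
      have := mul_le_mul_of_nonneg_left hKle hβ0.le
      rw [hθ]; linarith
    nlinarith

theorem main_pos {ι : Type*} [Fintype ι] (V : ι → Λ → ℝ) (Q : (Λ → Bool) → ℝ)
    (hQ : ∀ σ, Q σ = ∑ i, (V i ⬝ᵥ spin σ) ^ 2) (β : ℝ) (hβ0 : 0 < β) (hβ1 : β < 1)
    (hV : ∀ z, ∑ i, (V i ⬝ᵥ z) ^ 2 ≤ β * (z ⬝ᵥ z)) (F : (Λ → Bool) → ℝ) (hF : ∀ σ, 0 < F σ)
    (y : Λ → ℝ) :
    PP Q F 1 y ≤ (1 - β)⁻¹ * SS Q (dd (fun σ => Real.sqrt (F σ))) 1 y := by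
  obtain ⟨θ, hθ⟩ := main_eps V Q hQ β hβ0 hβ1 hV F hF (dd (fun σ => Real.sqrt (F σ)))
    (dd_nonneg _) (base_case Q F hF)
  set B := SS (0 : (Λ → Bool) → ℝ) (fun _ => 1) 0 ((2:ℝ) • y) with hB
  have hBp : 0 < B := one_pos' _ _ _
  have h : Real.exp (-θ * 1) * (PP Q F 1 y
      - (1 - 1 * β)⁻¹ * SS Q (dd (fun σ => Real.sqrt (F σ))) 1 y) ≤ 0 := by
    refine le_of_forall_pos_le_add fun δ hδ => ?_
    have := hθ (δ / B) (by positivity) 1 ⟨zero_le_one, le_rfl⟩ y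
    rw [← hB, div_mul_cancel₀ _ hBp.ne'] at this
    linarith
  have h2 := nonpos_of_mul_nonpos_right h (Real.exp_pos _)
  rw [one_mul] at h2
  linarith

end heat

open scoped MatrixOrder Matrix.Norms.L2Operator in
theorem psd_factor {Λ : Type*} [Fintype Λ] [DecidableEq Λ] (M : Matrix Λ Λ ℝ)
    (hM : M.PosSemidef) : ∃ B : Matrix Λ Λ ℝ, M = Bᴴ * B := by
  obtain ⟨B, hB⟩ := CStarAlgebra.nonneg_iff_eq_star_mul_self.mp hM.nonneg
  exact ⟨B, hB⟩

theorem lsi_pos {Λ : Type*} [Fintype Λ] [DecidableEq Λ]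
    (A : Matrix Λ Λ ℝ) (hAsymm : A.IsSymm)
    (hA0 : ∀ v : Λ → ℝ, 0 ≤ v ⬝ᵥ A.mulVec v)
    (hA1 : ∀ v : Λ → ℝ, v ⬝ᵥ A.mulVec v ≤ v ⬝ᵥ v)
    (β : ℝ) (hβ0 : 0 < β) (hβ1 : β < 1) (h : Λ → ℝ) (F : (Λ → Bool) → ℝ) (hF : ∀ σ, 0 < F σ) :
      fent (isingProb A β h) F ≤ (1 + 2 * β / (1 - β)) *
        dirichlet (isingProb A β h) (fun σ => Real.sqrt (F σ)) := by
  have hM : (β • (1 - A)).PosSemidef := by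
    refine Matrix.PosSemidef.of_dotProduct_mulVec_nonneg ?_ ?_
    · unfold Matrix.IsHermitian
      rw [Matrix.conjTranspose_eq_transpose_of_trivial]
      simp [Matrix.transpose_smul, Matrix.transpose_sub, hAsymm.eq]
    · intro v
      have := hA1 v
      simp only [star_trivial, Matrix.smul_mulVec, Matrix.sub_mulVec, Matrix.one_mulVec, dotProduct_smul,
        dotProduct_sub, smul_eq_mul]
      exact mul_nonneg hβ0.le (by linarith)
  obtain ⟨B, hB⟩ := psd_factor _ hM
  have hBv : ∀ v : Λ → ℝ, ∑ i, (B i ⬝ᵥ v) ^ 2 = β * (v ⬝ᵥ v - v ⬝ᵥ A.mulVec v) := by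
    intro v
    have e1 : v ⬝ᵥ (β • (1 - A)).mulVec v = β * (v ⬝ᵥ v - v ⬝ᵥ A.mulVec v) := by
      simp only [Matrix.smul_mulVec, Matrix.sub_mulVec, Matrix.one_mulVec, dotProduct_smul,
        dotProduct_sub, smul_eq_mul]
    rw [← e1, hB, Matrix.conjTranspose_eq_transpose_of_trivial, ← Matrix.mulVec_mulVec,
      Matrix.dotProduct_mulVec, Matrix.vecMul_transpose]
    simp only [dotProduct, Matrix.mulVec, sq]
  set Q : (Λ → Bool) → ℝ := fun σ => ∑ i, (B i ⬝ᵥ spin σ) ^ 2 with hQ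
  have key := main_pos (fun i => B i) Q (fun σ => rfl) β hβ0 hβ1
    (fun z => by rw [hBv]; nlinarith [hA0 z]) F hF h
  set n : ℝ := (Fintype.card Λ : ℝ) with hn
  set w : (Λ → Bool) → ℝ := fun σ => Real.exp (1 / 2 * Q σ + h ⬝ᵥ spin σ) with hw
  have hww : ∀ σ, isingWeight A β h σ = Real.exp (-(β / 2 * n)) * w σ := by
    intro σ
    simp only [isingWeight, hw, hQ]
    rw [hBv, spin_dot_self, ← Real.exp_add]
    congr 1; ring
  have hprob : isingProb A β h = fun σ => w σ / SS Q (fun _ => 1) 1 h := by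
    funext σ
    unfold isingProb SS
    simp only [hww, ← Finset.mul_sum, one_mul]
    rw [mul_div_mul_left _ _ (Real.exp_pos _).ne']
  have hZ := one_pos' Q 1 h
  have hSF := SS_pos Q F hF 1 h
  rw [hprob, dirichlet_norm, fent_norm w F _ hZ hSF]
  change PP Q F 1 h / _ ≤ _ * (SS Q (dd (fun σ => Real.sqrt (F σ))) 1 h / _)
  rw [← mul_div_assoc]
  apply div_le_div_of_nonneg_right _ hZ.le
  refine key.trans (mul_le_mul_of_nonneg_right ?_ (SS_nonneg _ _ (dd_nonneg _) _ _))
  have : 0 < 1 - β := by linarith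
  rw [inv_eq_one_div, div_le_iff₀ this]
  field_simp
  linarith

/-- Log-Sobolev inequality for Ising models under the spectral high-temperature
condition `0 ≤ A ≤ Id`, `β < 1`:
`Ent_μ(F) ≤ (1 + 2β/(1−β)) D_μ(√F)`. -/
theorem ising_high_temperature_lsi {Λ : Type*} [Fintype Λ] [DecidableEq Λ]
    (A : Matrix Λ Λ ℝ) (hAsymm : A.IsSymm)
    (hA0 : ∀ v : Λ → ℝ, 0 ≤ v ⬝ᵥ A.mulVec v)
    (hA1 : ∀ v : Λ → ℝ, v ⬝ᵥ A.mulVec v ≤ v ⬝ᵥ v)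
    (β : ℝ) (hβ0 : 0 < β) (hβ1 : β < 1) (h : Λ → ℝ) :
    ∀ F : (Λ → Bool) → ℝ, (∀ σ, 0 ≤ F σ) →
      fent (isingProb A β h) F ≤ (1 + 2 * β / (1 - β)) *
        dirichlet (isingProb A β h) (fun σ => Real.sqrt (F σ)) := by
  intro F hF
  set μ := isingProb A β h with hμ
  have c1 : Continuous (fun δ : ℝ => fent μ (fun σ => F σ + δ)) := by
    unfold fent
    refine Continuous.sub ?_ ?_
    · refine continuous_finsetSum _ fun σ _ => ?_
      exact (Real.continuous_mul_log.comp (continuous_const.add continuous_id)).const_mul _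
    · exact Real.continuous_mul_log.comp (by fun_prop :
        Continuous (fun δ : ℝ => ∑ σ : Λ → Bool, μ σ * (F σ + δ)))
  have c2 : Continuous (fun δ : ℝ => (1 + 2 * β / (1 - β)) *
      dirichlet μ (fun σ => Real.sqrt (F σ + δ))) := by
    unfold dirichlet
    fun_prop
  have t1 := (c1.tendsto 0).mono_left (nhdsWithin_le_nhds (s := Set.Ioi 0))
  have t2 := (c2.tendsto 0).mono_left (nhdsWithin_le_nhds (s := Set.Ioi 0))
  have := le_of_tendsto_of_tendsto t1 t2 (by
    filter_upwards [self_mem_nhdsWithin] with δ hδ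
    exact lsi_pos A hAsymm hA0 hA1 β hβ0 hβ1 h (fun σ => F σ + δ)
      (fun σ => add_pos_of_nonneg_of_pos (hF σ) hδ))
  simpa only [add_zero] using this

end
end
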